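/- Let (u, w, b, Π) be a smooth solution of the stationary magneto-micropolar equations on ℝ³. Assume that there exist smooth matrix-valued potentials Φ, Ψ, Υ : ℝ³ → ℝ^{3×3} with div Φ = u, div Ψ = b, div Υ = w, and that for some exponent s with 3 < s ≤ 6 there is a constant C > 0 such that for all r > 1: (|B_r|^{-1} ∫_{B_r} |Φ − Φ_{B_r}|^s dx)^{1/s} + (|B_r|^{-1} ∫_{B_r} |Ψ − Ψ_{B_r}|^s dx)^{1/s} + (|B_r|^{-1} ∫_{B_r} |Υ − Υ_{B_r}|^s dx)^{1/s} ≤ C r^{1/3 − 1/s}. Then u ≡ 0, b ≡ 0 and w ≡ 0 on ℝ³. -/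

import Mathlib

open MeasureTheory Real Filter Metric
open scoped Topology ENNReal

noncomputable section

/-- Three-dimensional Euclidean space. -/
abbrev E3 := EuclideanSpace ℝ (Fin 3)

/-- Partial derivative in the `i`-th coordinate direction. -/
def pd (i : Fin 3) (f : E3 → ℝ) (x : E3) : ℝ := fderiv ℝ f x (EuclideanSpace.single i 1)

/-- Laplacian of a scalar function. -/
def lap (f : E3 → ℝ) (x : E3) : ℝ := ∑ i, pd i (fun y => pd i f y) x

/-- Divergence of a vector field. -/
def vdiv (v : E3 → E3) (x : E3) : ℝ := ∑ i, pd i (fun y => v y i) x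

/-- Curl of a vector field on ℝ³. -/
def curl3 (v : E3 → E3) (x : E3) : Fin 3 → ℝ :=
  ![pd 1 (fun y => v y 2) x - pd 2 (fun y => v y 1) x,
    pd 2 (fun y => v y 0) x - pd 0 (fun y => v y 2) x,
    pd 0 (fun y => v y 1) x - pd 1 (fun y => v y 0) x]

/-- Squared norm of the full gradient of a vector field: |∇v|² = Σᵢⱼ (∂ᵢ vⱼ)². -/
def gradSq (v : E3 → E3) (x : E3) : ℝ := ∑ j, ∑ i, (pd i (fun y => v y j) x) ^ 2

/-- The open ball of radius `r` centered at the origin. -/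
def ball3 (r : ℝ) : Set E3 := Metric.ball (0 : E3) r

/-- `(u, w, b, Π)` is a smooth solution of the stationary magneto-micropolar equations on ℝ³
(with all physical constants set to 1):
−Δu + (u·∇)u + ∇Π = ∇×w + (b·∇)b; −Δw + (u·∇)w = ∇(div w) + ∇×u − 2w;
−Δb + (u·∇)b = (b·∇)u; div u = 0, div b = 0. -/
structure IsMMPSolution (u w b : E3 → E3) (P : E3 → ℝ) : Prop where
  smooth_u : ContDiff ℝ (⊤ : ℕ∞) u
  smooth_w : ContDiff ℝ (⊤ : ℕ∞) w
  smooth_b : ContDiff ℝ (⊤ : ℕ∞) b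
  smooth_P : ContDiff ℝ (⊤ : ℕ∞) P
  eq_u : ∀ x : E3, ∀ j : Fin 3,
    -(lap (fun y => u y j) x) + (∑ i, u x i * pd i (fun y => u y j) x) + pd j P x
      = curl3 w x j + ∑ i, b x i * pd i (fun y => b y j) x
  eq_w : ∀ x : E3, ∀ j : Fin 3,
    -(lap (fun y => w y j) x) + (∑ i, u x i * pd i (fun y => w y j) x)
      = pd j (fun y => vdiv w y) x + curl3 u x j - 2 * w x j
  eq_b : ∀ x : E3, ∀ j : Fin 3,
    -(lap (fun y => b y j) x) + (∑ i, u x i * pd i (fun y => b y j) x)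
      = ∑ i, b x i * pd i (fun y => u y j) x
  div_u : ∀ x : E3, vdiv u x = 0
  div_b : ∀ x : E3, vdiv b x = 0

/-- Divergence of a matrix-valued function: (div Φ)ⱼ = Σᵢ ∂ᵢ Φᵢⱼ. -/
def mdiv (Φ : E3 → Fin 3 → Fin 3 → ℝ) (x : E3) (j : Fin 3) : ℝ :=
  ∑ i, pd i (fun y => Φ y i j) x

/-- Mean value of a matrix-valued function over the ball of radius `r`. -/
def mavg (Φ : E3 → Fin 3 → Fin 3 → ℝ) (r : ℝ) (i j : Fin 3) : ℝ :=
  (volume (ball3 r)).toReal⁻¹ * ∫ x in ball3 r, Φ x i j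

/-- Frobenius norm of a 3×3 matrix. -/
def frob (A : Fin 3 → Fin 3 → ℝ) : ℝ := Real.sqrt (∑ i, ∑ j, (A i j) ^ 2)

/-- The `s`-mean oscillation of `Φ` over the ball of radius `r`:
`(|B_r|⁻¹ ∫_{B_r} |Φ − Φ_{B_r}|^s dx)^(1/s)`. -/
def meanOsc (Φ : E3 → Fin 3 → Fin 3 → ℝ) (s r : ℝ) : ℝ :=
  ((volume (ball3 r)).toReal⁻¹ *
      ∫ x in ball3 r, (frob fun i j => Φ x i j - mavg Φ r i j) ^ s) ^ (1 / s)

/-- Smooth scalar functions on three-dimensional space. -/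
abbrev Sm (f : E3 → ℝ) : Prop := ContDiff ℝ (⊤ : ℕ∞) f

/-- The coordinate unit vectors. -/
abbrev ee (i : Fin 3) : E3 := EuclideanSpace.single i 1

section Calculus

variable {f g h : E3 → ℝ} {i j : Fin 3} {x : E3}

theorem Sm.diff (hf : Sm f) : Differentiable ℝ f := hf.differentiable (by simp)

theorem Sm.diffAt (hf : Sm f) : DifferentiableAt ℝ f x := hf.diff x

theorem Sm.cont (hf : Sm f) : Continuous f := hf.continuous

theorem Sm.pd (hf : Sm f) (i : Fin 3) : Sm (pd i f) := by
  have h : ContDiff ℝ (⊤ : ℕ∞) (fderiv ℝ f) := hf.fderiv_right (m := (⊤ : ℕ∞)) (by simp)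
  exact h.clm_apply contDiff_const

theorem pd_congr_of_eventuallyEq (h : f =ᶠ[𝓝 x] g) : pd i f x = pd i g x := by
  simp only [pd, h.fderiv_eq]

theorem pd_const (c : ℝ) : pd i (fun _ => c) x = 0 := by simp [pd]

theorem pd_add (hf : DifferentiableAt ℝ f x) (hg : DifferentiableAt ℝ g x) :
    pd i (fun y => f y + g y) x = pd i f x + pd i g x := by
  simp [pd, fderiv_fun_add hf hg]

theorem pd_sub (hf : DifferentiableAt ℝ f x) (hg : DifferentiableAt ℝ g x) :
    pd i (fun y => f y - g y) x = pd i f x - pd i g x := by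
  simp [pd, fderiv_fun_sub hf hg]

theorem pd_mul (hf : DifferentiableAt ℝ f x) (hg : DifferentiableAt ℝ g x) :
    pd i (fun y => f y * g y) x = pd i f x * g x + f x * pd i g x := by
  simp [pd, fderiv_fun_mul hf hg]; ring

theorem pd_const_mul (c : ℝ) (hf : DifferentiableAt ℝ f x) :
    pd i (fun y => c * f y) x = c * pd i f x := by
  rw [pd_mul (differentiableAt_const c) hf, pd_const]; ring

theorem pd_sum {ι : Type*} (t : Finset ι) {F : ι → E3 → ℝ}
    (hF : ∀ k ∈ t, DifferentiableAt ℝ (F k) x) :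
    pd i (fun y => ∑ k ∈ t, F k y) x = ∑ k ∈ t, pd i (F k) x := by
  simp [pd, fderiv_fun_sum hF]

theorem pd_sq (hf : DifferentiableAt ℝ f x) :
    pd i (fun y => f y ^ 2) x = 2 * f x * pd i f x := by
  simp only [pow_two]
  rw [pd_mul hf hf]; ring

theorem pd_comp {φ : ℝ → ℝ} (hφ : DifferentiableAt ℝ φ (f x)) (hf : DifferentiableAt ℝ f x) :
    pd i (fun y => φ (f y)) x = deriv φ (f x) * pd i f x := by
  have := (hφ.hasDerivAt.comp_hasFDerivAt x hf.hasFDerivAt).fderiv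
  simp only [Function.comp_def] at this
  simp [pd, this]

theorem pd_pow (n : ℕ) (hf : DifferentiableAt ℝ f x) :
    pd i (fun y => f y ^ n) x = n * f x ^ (n - 1) * pd i f x := by
  rw [pd_comp (φ := fun t => t ^ n) (by fun_prop) hf]; simp

theorem pd_coord : pd i (fun y : E3 => y j) x = if j = i then 1 else 0 := by
  have : (fun y : E3 => y j) = (EuclideanSpace.proj j : E3 →L[ℝ] ℝ) := rfl
  rw [pd, this, ContinuousLinearMap.fderiv]
  simp [eq_comm]

theorem pd_comm (hf : Sm f) (i j : Fin 3) (x : E3) :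
    pd i (pd j f) x = pd j (pd i f) x := by
  have hs : IsSymmSndFDerivAt ℝ f x :=
    hf.contDiffAt.isSymmSndFDerivAt (by simp; exact WithTop.coe_le_coe.2 (le_top : (2 : ℕ∞) ≤ ⊤))
  have hd : DifferentiableAt ℝ (fderiv ℝ f) x :=
    ((hf.fderiv_right (m := (⊤ : ℕ∞)) (by simp)).differentiable (by simp)) x
  have key : ∀ v w : E3, fderiv ℝ (fun y => fderiv ℝ f y w) x v = fderiv ℝ (fderiv ℝ f) x v w := by
    intro v w
    rw [fderiv_clm_apply hd (differentiableAt_const w)]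
    simp
  change fderiv ℝ (fun y => fderiv ℝ f y (ee j)) x (ee i) =
    fderiv ℝ (fun y => fderiv ℝ f y (ee i)) x (ee j)
  rw [key, key]; exact hs _ _

theorem HasCompactSupport.pd (hf : HasCompactSupport f) (i : Fin 3) :
    HasCompactSupport (pd i f) := hf.fderiv_apply ℝ (ee i)

theorem Sm.integrable (hf : Sm f) (hc : HasCompactSupport f) : Integrable f :=
  hf.cont.integrable_of_hasCompactSupport hc

theorem integral_pd (hf : Sm f) (hc : HasCompactSupport f) (i : Fin 3) :
    ∫ x, pd i f x = 0 := by
  have h1 := (hf.pd i).integrable (hc.pd i)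
  have h2 := hf.integrable hc
  have h := integral_mul_fderiv_eq_neg_fderiv_mul_of_integrable (𝕜 := ℝ) (μ := (volume : Measure E3))
    (f := fun _ : E3 => (1 : ℝ)) (g := f) (v := ee i) (by simp)
    (by simp only [one_mul]; exact h1)
    (by simp only [one_mul]; exact h2)
    (by fun_prop) (fun x _ => hf.diffAt)
  simp only [one_mul, fderiv_fun_const, Pi.zero_apply, zero_apply, zero_mul,
    integral_zero, neg_zero] at h
  exact h

theorem integral_div_eq_zero {G : Fin 3 → E3 → ℝ} (hG : ∀ i, Sm (G i))
    (hc : ∀ i, HasCompactSupport (G i)) : ∫ x, ∑ i, pd i (G i) x = 0 := by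
  rw [integral_finsetSum _ fun i _ => ((hG i).pd i).integrable ((hc i).pd i)]
  simp [integral_pd, hG, hc]

theorem integral_parts (hf : Sm f) (hg : Sm g) (hc : HasCompactSupport f) (i : Fin 3) :
    ∫ x, f x * pd i g x = -∫ x, pd i f x * g x := by
  have h := integral_pd (hf.mul hg) hc.mul_right i
  have e : ∀ x, pd i (fun y => f y * g y) x = pd i f x * g x + f x * pd i g x :=
    fun x => pd_mul hf.diffAt hg.diffAt
  simp only [e] at h
  rw [integral_add (Sm.integrable ((hf.pd i).mul hg) (hc.pd i).mul_right)
    (Sm.integrable (hf.mul (hg.pd i)) hc.mul_right)] at h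
  linarith

theorem Sm.coord {v : E3 → E3} (hv : ContDiff ℝ (⊤ : ℕ∞) v) (j : Fin 3) : Sm fun y => v y j :=
  contDiff_euclidean.1 hv j

end Calculus

/-- A smooth cutoff: one on the ball of radius `a`, zero outside the ball of radius `b`, with
derivative bounds governed by `C`. -/
structure IsCut (C a b : ℝ) (ψ : E3 → ℝ) : Prop where
  smooth : Sm ψ
  nonneg : ∀ x, 0 ≤ ψ x
  le_one : ∀ x, ψ x ≤ 1
  eq_one : ∀ x, ‖x‖ ≤ a → ψ x = 1
  eq_zero : ∀ x, b ≤ ‖x‖ → ψ x = 0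
  pd_in : ∀ x i, ‖x‖ ≤ a → pd i ψ x = 0
  pd_out : ∀ x i, b ≤ ‖x‖ → pd i ψ x = 0
  pdd_in : ∀ x i j, ‖x‖ ≤ a → pd i (pd j ψ) x = 0
  pdd_out : ∀ x i j, b ≤ ‖x‖ → pd i (pd j ψ) x = 0
  pd_le : ∀ x i, |pd i ψ x| ≤ C / (b - a)
  pdd_le : ∀ x i j, |pd i (pd j ψ) x| ≤ C / (b - a) ^ 2

theorem hasCompactSupport_of_norm {f : E3 → ℝ} {b : ℝ} (h : ∀ x, b ≤ ‖x‖ → f x = 0) :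
    HasCompactSupport f :=
  HasCompactSupport.intro (isCompact_closedBall (0 : E3) b) fun x hx => h x (by
    simp only [mem_closedBall, dist_zero_right, not_le] at hx; exact hx.le)

theorem IsCut.compact {C a b : ℝ} {ψ : E3 → ℝ} (h : IsCut C a b ψ) : HasCompactSupport ψ :=
  hasCompactSupport_of_norm h.eq_zero

theorem contDiff_deriv_top {φ : ℝ → ℝ} (h : ContDiff ℝ (⊤ : ℕ∞) φ) :
    ContDiff ℝ (⊤ : ℕ∞) (deriv φ) := by
  rw [show ((⊤ : ℕ∞) : WithTop ℕ∞) = (⊤ : ℕ∞) + 1 by rfl, contDiff_succ_iff_deriv] at h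
  exact h.2.2

/-- A smooth function which is constant left of `0` and right of `1` has derivative vanishing
outside the open unit interval. -/
theorem deriv_eq_zero_outside {φ : ℝ → ℝ} {c₀ c₁ : ℝ} (h : ContDiff ℝ (⊤ : ℕ∞) φ)
    (h0 : ∀ t ≤ 0, φ t = c₀) (h1 : ∀ t, 1 ≤ t → φ t = c₁) {t : ℝ} (ht : t ≤ 0 ∨ 1 ≤ t) :
    deriv φ t = 0 := by
  have hc : Continuous (deriv φ) := (contDiff_deriv_top h).continuous
  rcases ht with ht | ht
  · have : Set.EqOn (deriv φ) (fun _ => 0) (closure (Set.Iio 0)) := by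
      refine Set.EqOn.closure (fun t ht => ?_) hc continuous_const
      have : φ =ᶠ[𝓝 t] fun _ => c₀ := by
        filter_upwards [Iio_mem_nhds ht] with y hy using h0 y (le_of_lt hy)
      rw [this.deriv_eq, deriv_const]
    exact this (by simpa using ht)
  · have : Set.EqOn (deriv φ) (fun _ => 0) (closure (Set.Ioi 1)) := by
      refine Set.EqOn.closure (fun t ht => ?_) hc continuous_const
      have : φ =ᶠ[𝓝 t] fun _ => c₁ := by
        filter_upwards [Ioi_mem_nhds ht] with y hy using h1 y (le_of_lt hy)
      rw [this.deriv_eq, deriv_const]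
    exact this (by simpa using ht)

theorem bounded_of_zero_outside {φ : ℝ → ℝ} (h : Continuous φ)
    (h0 : ∀ t, t ≤ 0 ∨ 1 ≤ t → φ t = 0) : ∃ C, 0 ≤ C ∧ ∀ t, |φ t| ≤ C := by
  obtain ⟨C, hC⟩ := h.bounded_above_of_compact_support
    (HasCompactSupport.intro (isCompact_Icc (a := (0 : ℝ)) (b := 1)) fun t ht => h0 t (by
      by_contra hh; push Not at hh; exact ht ⟨hh.1.le, hh.2.le⟩))
  exact ⟨C, (norm_nonneg _).trans (hC 0), hC⟩

theorem normSq_eq (x : E3) : ‖x‖ ^ 2 = ∑ i, x i ^ 2 := by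
  rw [EuclideanSpace.norm_sq_eq]; simp

theorem coord_le (x : E3) (i : Fin 3) : |x i| ≤ ‖x‖ := by
  simpa using PiLp.norm_apply_le x i

theorem sm_normSq : Sm fun x : E3 => ‖x‖ ^ 2 := contDiff_norm_sq ℝ

theorem pd_normSq (i : Fin 3) (x : E3) : pd i (fun y : E3 => ‖y‖ ^ 2) x = 2 * x i := by
  simp only [normSq_eq]
  have hc : ∀ j : Fin 3, DifferentiableAt ℝ (fun y : E3 => y j) x := fun j =>
    (Sm.coord (v := id) contDiff_id j).diffAt
  rw [pd_sum _ (F := fun j y => y j ^ 2) fun j _ => (hc j).pow 2]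
  simp only [pd_sq (hc _), pd_coord]
  simp

theorem sm_coord (j : Fin 3) : Sm fun y : E3 => y j := Sm.coord (v := id) contDiff_id j

theorem exists_cut : ∃ C : ℝ, 1 ≤ C ∧ ∀ a b : ℝ, 0 < a → a < b → ∃ ψ, IsCut C a b ψ := by
  have hS : ContDiff ℝ (⊤ : ℕ∞) smoothTransition := smoothTransition.contDiff
  have hS1 := contDiff_deriv_top hS
  have hS2 := contDiff_deriv_top hS1
  have z1 : ∀ t, t ≤ 0 ∨ 1 ≤ t → deriv smoothTransition t = 0 := fun t ht =>
    deriv_eq_zero_outside hS (fun t h => smoothTransition.zero_of_nonpos h)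
      (fun t h => smoothTransition.one_of_one_le h) ht
  have z2 : ∀ t, t ≤ 0 ∨ 1 ≤ t → deriv (deriv smoothTransition) t = 0 := fun t ht =>
    deriv_eq_zero_outside hS1 (fun t h => z1 t (.inl h)) (fun t h => z1 t (.inr h)) ht
  obtain ⟨C1, hC1, b1⟩ := bounded_of_zero_outside hS1.continuous z1
  obtain ⟨C2, hC2, b2⟩ := bounded_of_zero_outside hS2.continuous z2
  refine ⟨1 + 2 * C1 + 4 * C2, by linarith, fun a b ha hab => ?_⟩
  set L := b ^ 2 - a ^ 2 with hL
  have hLpos : 0 < L := by nlinarith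
  set τ : E3 → ℝ := fun x => (b ^ 2 - ‖x‖ ^ 2) * L⁻¹ with hτ
  have hτs : Sm τ := (contDiff_const.sub sm_normSq).mul contDiff_const
  have pτ : ∀ i x, pd i τ x = x i * (-2 * L⁻¹) := by
    intro i x
    rw [hτ, pd_mul (Sm.diffAt (contDiff_const.sub sm_normSq)) (differentiableAt_const _),
      pd_const, pd_sub (differentiableAt_const _) sm_normSq.diffAt, pd_const, pd_normSq]
    ring
  have tin : ∀ x, ‖x‖ ≤ a → τ x ≤ 0 ∨ 1 ≤ τ x := fun x hx => .inr (by
    simp only [hτ]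
    rw [← div_eq_mul_inv, le_div_iff₀ hLpos]
    nlinarith [norm_nonneg x])
  have tout : ∀ x, b ≤ ‖x‖ → τ x ≤ 0 ∨ 1 ≤ τ x := fun x hx => .inl (by
    simp only [hτ]
    rw [← div_eq_mul_inv]
    exact div_nonpos_of_nonpos_of_nonneg (by nlinarith [norm_nonneg x]) hLpos.le)
  have e1 : ∀ i, pd i (fun x => smoothTransition (τ x)) =
      fun x => deriv smoothTransition (τ x) * (x i * (-2 * L⁻¹)) := by
    intro i; funext x
    rw [pd_comp (hS.differentiable (by simp) _) hτs.diffAt, pτ]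
  have e2 : ∀ i j x, pd i (pd j fun x => smoothTransition (τ x)) x =
      deriv (deriv smoothTransition) (τ x) * (x i * (-2 * L⁻¹)) * (x j * (-2 * L⁻¹)) +
        deriv smoothTransition (τ x) * ((if j = i then 1 else 0) * (-2 * L⁻¹)) := by
    intro i j x
    rw [e1, pd_mul (f := fun x => deriv smoothTransition (τ x)) (Sm.diffAt (hS1.comp hτs))
      (Sm.diffAt ((sm_coord j).mul contDiff_const)),
      pd_comp (hS1.differentiable (by simp) _) hτs.diffAt, pτ,
      pd_mul (sm_coord j).diffAt (differentiableAt_const _), pd_coord, pd_const]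
    ring
  have hba : 0 < b - a := sub_pos.2 hab
  have hL2 : (b - a) ^ 2 ≤ L := by nlinarith
  have hinv : L⁻¹ ≤ ((b - a) ^ 2)⁻¹ := inv_anti₀ (by positivity) hL2
  have hbL : b * L⁻¹ ≤ (b - a)⁻¹ := by
    rw [← div_eq_mul_inv, div_le_iff₀ hLpos, ← div_eq_inv_mul, le_div_iff₀ hba]
    nlinarith
  have hb : 0 < b := ha.trans hab
  have cx : ∀ x : E3, ¬ (b ≤ ‖x‖) → ∀ i, |x i * (-2 * L⁻¹)| ≤ 2 * (b - a)⁻¹ := by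
    intro x hx i
    have h1 : |x i| ≤ b := (coord_le x i).trans (not_le.1 hx).le
    rw [abs_mul, abs_mul, abs_neg, abs_two, abs_of_pos (inv_pos.2 hLpos)]
    nlinarith [inv_pos.2 hLpos, abs_nonneg (x i), mul_le_mul_of_nonneg_right h1
      (inv_pos.2 hLpos).le]
  refine ⟨fun x => smoothTransition (τ x), hS.comp hτs, fun x => smoothTransition.nonneg _,
    fun x => smoothTransition.le_one _, fun x hx => ?_, fun x hx => ?_, ?_, ?_, ?_, ?_, ?_, ?_⟩
  · apply smoothTransition.one_of_one_le
    simp only [hτ]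
    rw [← div_eq_mul_inv, le_div_iff₀ hLpos]
    nlinarith [norm_nonneg x]
  · apply smoothTransition.zero_of_nonpos
    simp only [hτ]
    rw [← div_eq_mul_inv]
    exact div_nonpos_of_nonpos_of_nonneg (by nlinarith [norm_nonneg x]) hLpos.le
  · intro x i hx; rw [e1]; simp only [z1 _ (tin x hx), zero_mul]
  · intro x i hx; rw [e1]; simp only [z1 _ (tout x hx), zero_mul]
  · intro x i j hx; rw [e2]; simp only [z1 _ (tin x hx), z2 _ (tin x hx)]; ring
  · intro x i j hx; rw [e2]; simp only [z1 _ (tout x hx), z2 _ (tout x hx)]; ring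
  · intro x i
    rw [e1]
    by_cases hx : b ≤ ‖x‖
    · simp only [z1 _ (tout x hx), zero_mul, abs_zero]; positivity
    · rw [abs_mul, div_eq_mul_inv]
      calc _ ≤ C1 * (2 * (b - a)⁻¹) := mul_le_mul (b1 _) (cx x hx i) (abs_nonneg _) hC1
        _ ≤ _ := by
          have : 0 < (b - a)⁻¹ := by positivity
          nlinarith
  · intro x i j
    rw [e2]
    by_cases hx : b ≤ ‖x‖
    · simp only [z1 _ (tout x hx), z2 _ (tout x hx), zero_mul, add_zero, abs_zero]; positivity
    · refine (abs_add_le _ _).trans ?_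
      rw [div_eq_mul_inv, abs_mul, abs_mul, abs_mul (deriv smoothTransition _)]
      have h3 : |(if j = i then (1 : ℝ) else 0) * (-2 * L⁻¹)| ≤ 2 * ((b - a) ^ 2)⁻¹ := by
        have := inv_pos.2 hLpos
        split_ifs
        · rw [one_mul, abs_mul, abs_neg, abs_two, abs_of_pos this]; linarith
        · simp; positivity
      calc _ ≤ C2 * (2 * (b - a)⁻¹) * (2 * (b - a)⁻¹) + C1 * (2 * ((b - a) ^ 2)⁻¹) := by
            gcongr
            · exact b2 _
            · exact cx x hx i
            · exact cx x hx j
            · exact b1 _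
        _ = (2 * C1 + 4 * C2) * ((b - a) ^ 2)⁻¹ := by rw [← inv_pow]; ring
        _ ≤ _ := by gcongr; linarith

section Integrals

variable {f g h : E3 → ℝ} {r R : ℝ}

theorem measurableSet_ball3 : MeasurableSet (ball3 r) := measurableSet_ball

theorem mem_ball3 {x : E3} : x ∈ ball3 r ↔ ‖x‖ < r := by simp [ball3]

theorem ball3_subset (h : r ≤ R) : ball3 r ⊆ ball3 R := ball_subset_ball h

theorem Continuous.intOn (hf : Continuous f) (r : ℝ) : IntegrableOn f (ball3 r) :=
  (hf.continuousOn.integrableOn_compact (isCompact_closedBall (0 : E3) r)).mono_set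
    ball_subset_closedBall

theorem setIntegral_ball_mono_set (hf : Continuous f) (h0 : ∀ x, 0 ≤ f x) (h : r ≤ R) :
    ∫ x in ball3 r, f x ≤ ∫ x in ball3 R, f x :=
  setIntegral_mono_set (hf.intOn R) (ae_of_all _ h0) (ball3_subset h).eventuallyLE

theorem setIntegral_ball_mono (hf : Continuous f) (hg : Continuous g)
    (h : ∀ x, ‖x‖ < r → f x ≤ g x) : ∫ x in ball3 r, f x ≤ ∫ x in ball3 r, g x :=
  setIntegral_mono_on (hf.intOn r) (hg.intOn r) measurableSet_ball3 fun x hx => h x (mem_ball3.1 hx)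

theorem setIntegral_ball_nonneg (h : ∀ x, ‖x‖ < r → 0 ≤ f x) : 0 ≤ ∫ x in ball3 r, f x :=
  setIntegral_nonneg measurableSet_ball3 fun x hx => h x (mem_ball3.1 hx)

theorem ballInt_add (hf : Continuous f) (hg : Continuous g) (r : ℝ) :
    ∫ x in ball3 r, (f x + g x) = (∫ x in ball3 r, f x) + ∫ x in ball3 r, g x :=
  integral_add (hf.intOn r) (hg.intOn r)

theorem ballInt_sum {ι : Type*} (t : Finset ι) {F : ι → E3 → ℝ} (hF : ∀ k, Continuous (F k)) (r : ℝ) :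
    ∫ x in ball3 r, ∑ k ∈ t, F k x = ∑ k ∈ t, ∫ x in ball3 r, F k x :=
  integral_finsetSum _ fun k _ => (hF k).intOn r

theorem ballInt_const_mul (c : ℝ) (f : E3 → ℝ) (r : ℝ) :
    ∫ x in ball3 r, c * f x = c * ∫ x in ball3 r, f x := integral_const_mul c _

/-- Integrals of functions vanishing outside a ball localise to that ball. -/
theorem integral_eq_ball (h : ∀ x, r ≤ ‖x‖ → f x = 0) : ∫ x, f x = ∫ x in ball3 r, f x :=
  (setIntegral_eq_integral_of_forall_compl_eq_zero fun x hx => h x (by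
    simpa [mem_ball3] using hx)).symm

theorem volume_ball3 (hr : 0 ≤ r) :
    (volume (ball3 r)).toReal = (volume (ball3 1)).toReal * r ^ 3 := by
  have h := Measure.addHaar_ball (volume : Measure E3) 0 hr
  simp only [finrank_euclideanSpace, Fintype.card_fin] at h
  rw [ball3, h, ENNReal.toReal_mul, ENNReal.toReal_ofReal (by positivity), mul_comm]; rfl

theorem volume_ball3_pos (hr : 0 < r) : 0 < (volume (ball3 r)).toReal :=
  ENNReal.toReal_pos (measure_ball_pos _ _ hr).ne' measure_ball_lt_top.ne

/-- Hölder's inequality for two nonnegative functions, with powers. -/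
theorem holder_two {α : Type*} [MeasurableSpace α] {μ : Measure α} {f g : α → ℝ} {p q : ℝ}
    (hf : ∀ x, 0 ≤ f x) (hg : ∀ x, 0 ≤ g x) (fi : Integrable f μ) (gi : Integrable g μ)
    (hp : 0 ≤ p) (hq : 0 ≤ q) (hpq : p + q = 1) :
    Integrable (fun x => f x ^ p * g x ^ q) μ ∧
    ∫ x, f x ^ p * g x ^ q ∂μ ≤ (∫ x, f x ∂μ) ^ p * (∫ x, g x ∂μ) ^ q := by
  have hm : AEStronglyMeasurable (fun x => f x ^ p * g x ^ q) μ :=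
    ((fi.aemeasurable.pow_const p).mul (gi.aemeasurable.pow_const q)).aestronglyMeasurable
  have h0 : ∀ x, 0 ≤ f x ^ p * g x ^ q := fun x =>
    mul_nonneg (rpow_nonneg (hf x) _) (rpow_nonneg (hg x) _)
  have hle : ∀ x, f x ^ p * g x ^ q ≤ p * f x + q * g x := fun x =>
    Real.geom_mean_le_arith_mean2_weighted hp hq (hf x) (hg x) hpq
  have hi : Integrable (fun x => f x ^ p * g x ^ q) μ :=
    ((fi.const_mul p).add (gi.const_mul q)).mono' hm (ae_of_all _ fun x => by
      rw [norm_of_nonneg (h0 x)]; exact hle x)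
  refine ⟨hi, ?_⟩
  have key := ENNReal.lintegral_mul_norm_pow_le (μ := μ) (f := fun x => ENNReal.ofReal (f x))
    (g := fun x => ENNReal.ofReal (g x)) fi.aemeasurable.ennreal_ofReal
    gi.aemeasurable.ennreal_ofReal hp hq hpq
  rw [integral_eq_lintegral_of_nonneg_ae (ae_of_all _ h0) hm,
    integral_eq_lintegral_of_nonneg_ae (ae_of_all _ hf) fi.1,
    integral_eq_lintegral_of_nonneg_ae (ae_of_all _ hg) gi.1,
    ENNReal.toReal_rpow, ENNReal.toReal_rpow, ← ENNReal.toReal_mul]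
  refine ENNReal.toReal_mono ?_ (le_of_eq_of_le ?_ key)
  · refine ENNReal.mul_ne_top ?_ ?_
    · exact ENNReal.rpow_ne_top_of_nonneg hp (ne_of_lt fi.lintegral_lt_top)
    · exact ENNReal.rpow_ne_top_of_nonneg hq (ne_of_lt gi.lintegral_lt_top)
  · refine lintegral_congr fun x => ?_
    rw [ENNReal.ofReal_mul (rpow_nonneg (hf x) _), ENNReal.ofReal_rpow_of_nonneg (hf x) hp,
      ENNReal.ofReal_rpow_of_nonneg (hg x) hq]

/-- The Cauchy–Schwarz inequality on balls. -/
theorem cauchy_schwarz_ball (hf : Continuous f) (hg : Continuous g) (r : ℝ) :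
    ∫ x in ball3 r, |f x| * |g x| ≤
      (∫ x in ball3 r, f x ^ 2) ^ (1 / 2 : ℝ) * (∫ x in ball3 r, g x ^ 2) ^ (1 / 2 : ℝ) := by
  have := (holder_two (μ := volume.restrict (ball3 r)) (f := fun x => f x ^ 2)
    (g := fun x => g x ^ 2) (p := 1 / 2) (q := 1 / 2) (fun x => sq_nonneg _) (fun x => sq_nonneg _)
    ((hf.pow 2).intOn r) ((hg.pow 2).intOn r) (by norm_num) (by norm_num) (by norm_num)).2
  simpa only [← Real.sqrt_eq_rpow, Real.sqrt_sq_eq_abs] using this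

theorem sq_rpow_half (x : ℝ) : (x ^ 2) ^ (1 / 2 : ℝ) = |x| := by
  rw [← Real.sqrt_eq_rpow, Real.sqrt_sq_eq_abs]

/-- The four-factor Hölder inequality behind the trilinear estimates. -/
theorem trilinear_ball {s : ℝ} (hs1 : 3 < s) (hs2 : s ≤ 6) (hf : Continuous f) (hg : Continuous g)
    (hh : Continuous h) (r : ℝ) :
    ∫ x in ball3 r, |f x| * |g x| * |h x| ≤
      (∫ x in ball3 r, |f x| ^ s) ^ (1 / s) * (∫ x in ball3 r, g x ^ 2) ^ (1 / 2 : ℝ) *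
      (∫ x in ball3 r, |h x| ^ 3) ^ (2 / 3 - 2 / s) *
      (∫ x in ball3 r, h x ^ 6) ^ (1 / s - 1 / 6) := by
  have hs0 : 0 < s := by linarith
  have ha : 0 ≤ 2 / 3 - 2 / s := by
    rw [sub_nonneg, div_le_div_iff₀ hs0 (by norm_num)]; linarith
  have hb : 0 ≤ 1 / s - 1 / 6 := by
    rw [sub_nonneg, div_le_div_iff₀ (by norm_num) hs0]; linarith
  set a := 2 / 3 - 2 / s with ha'
  set b := 1 / s - 1 / 6 with hb'
  have hp : 0 < 1 / s := by positivity
  have hab : 1 / s + 1 / 2 + a + b = 1 := by rw [ha', hb']; ring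
  have hq : 0 < 1 / s + 1 / 2 := by positivity
  have hab2 : 0 < a + b := by
    have : a + b = 1 / 2 - 1 / s := by rw [ha', hb']; ring
    rw [this, sub_pos, div_lt_div_iff₀ hs0 (by norm_num)]; linarith
  set μ := (volume.restrict (ball3 r) : Measure E3) with hμ
  have cf : Continuous fun x => |f x| ^ s := hf.abs.rpow_const fun x => .inr hs0.le
  have i1 : Integrable (fun x => |f x| ^ s) μ := cf.intOn r
  have i2 : Integrable (fun x => g x ^ 2) μ := (hg.pow 2).intOn r
  have i3 : Integrable (fun x => |h x| ^ 3) μ := (hh.abs.pow 3).intOn r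
  have i4 : Integrable (fun x => h x ^ 6) μ := (hh.pow 6).intOn r
  have n1 : ∀ x, 0 ≤ |f x| ^ s := fun x => rpow_nonneg (abs_nonneg _) _
  have n2 : ∀ x, 0 ≤ g x ^ 2 := fun x => sq_nonneg _
  have n3 : ∀ x, 0 ≤ |h x| ^ 3 := fun x => by positivity
  have n4 : ∀ x, 0 ≤ h x ^ 6 := fun x => by positivity
  obtain ⟨j1, k1⟩ := holder_two (p := (1 / s) / (1 / s + 1 / 2)) (q := (1 / 2) / (1 / s + 1 / 2))
    n1 n2 i1 i2 (by positivity) (by positivity) (by rw [← add_div, div_self hq.ne'])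
  obtain ⟨j2, k2⟩ := holder_two (p := a / (a + b)) (q := b / (a + b))
    n3 n4 i3 i4 (by positivity) (by positivity) (by rw [← add_div, div_self hab2.ne'])
  have m1 : ∀ x, 0 ≤ (|f x| ^ s) ^ ((1 / s) / (1 / s + 1 / 2)) *
      (g x ^ 2) ^ ((1 / 2) / (1 / s + 1 / 2)) := fun x =>
    mul_nonneg (rpow_nonneg (n1 x) _) (rpow_nonneg (n2 x) _)
  have m2 : ∀ x, 0 ≤ (|h x| ^ 3) ^ (a / (a + b)) * (h x ^ 6) ^ (b / (a + b)) := fun x =>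
    mul_nonneg (rpow_nonneg (n3 x) _) (rpow_nonneg (n4 x) _)
  obtain ⟨-, k3⟩ := holder_two (p := 1 / s + 1 / 2) (q := a + b) m1 m2 j1 j2 hq.le hab2.le
    (by linarith)
  have e : ∀ x, |f x| * |g x| * |h x| = ((|f x| ^ s) ^ ((1 / s) / (1 / s + 1 / 2)) *
      (g x ^ 2) ^ ((1 / 2) / (1 / s + 1 / 2))) ^ (1 / s + 1 / 2) *
      ((|h x| ^ 3) ^ (a / (a + b)) * (h x ^ 6) ^ (b / (a + b))) ^ (a + b) := by
    intro x
    rw [mul_rpow (rpow_nonneg (n1 x) _) (rpow_nonneg (n2 x) _),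
      mul_rpow (rpow_nonneg (n3 x) _) (rpow_nonneg (n4 x) _),
      ← rpow_mul (n1 x), ← rpow_mul (n2 x), ← rpow_mul (n3 x), ← rpow_mul (n4 x),
      div_mul_cancel₀ _ hq.ne', div_mul_cancel₀ _ hq.ne', div_mul_cancel₀ _ hab2.ne',
      div_mul_cancel₀ _ hab2.ne', sq_rpow_half, ← rpow_mul (abs_nonneg _),
      mul_one_div_cancel hs0.ne', rpow_one]
    congr 1
    have e6 : h x ^ 6 = |h x| ^ 6 := by
      rw [show 6 = 2 * 3 by rfl, pow_mul, pow_mul, sq_abs]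
    rw [e6, ← rpow_natCast, ← rpow_natCast, ← rpow_mul (abs_nonneg _), ← rpow_mul (abs_nonneg _)]
    rw [← rpow_add_of_nonneg (abs_nonneg _) (by positivity) (by positivity)]
    have : ((3 : ℕ) : ℝ) * a + ((6 : ℕ) : ℝ) * b = 1 := by rw [ha', hb']; push_cast; ring
    rw [this, rpow_one]
  simp_rw [e]
  refine k3.trans ?_
  have I1 : 0 ≤ ∫ x, |f x| ^ s ∂μ := integral_nonneg n1
  have I2 : 0 ≤ ∫ x, g x ^ 2 ∂μ := integral_nonneg n2
  have I3 : 0 ≤ ∫ x, |h x| ^ 3 ∂μ := integral_nonneg n3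
  have I4 : 0 ≤ ∫ x, h x ^ 6 ∂μ := integral_nonneg n4
  have q1 := rpow_le_rpow (integral_nonneg m1) k1 hq.le
  have q2 := rpow_le_rpow (integral_nonneg m2) k2 hab2.le
  rw [mul_rpow (rpow_nonneg I1 _) (rpow_nonneg I2 _), ← rpow_mul I1, ← rpow_mul I2,
    div_mul_cancel₀ _ hq.ne', div_mul_cancel₀ _ hq.ne'] at q1
  rw [mul_rpow (rpow_nonneg I3 _) (rpow_nonneg I4 _), ← rpow_mul I3, ← rpow_mul I4,
    div_mul_cancel₀ _ hab2.ne', div_mul_cancel₀ _ hab2.ne'] at q2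
  rw [mul_assoc (_ * _)]
  exact mul_le_mul q1 q2 (rpow_nonneg (integral_nonneg m2) _)
    (mul_nonneg (rpow_nonneg I1 _) (rpow_nonneg I2 _))

/-- Hölder's inequality against the constant one on a ball. -/
theorem power_mean_ball {s t : ℝ} (ht : 0 < t) (hts : t ≤ s) (hf : Continuous f) (hr : 0 ≤ r) :
    ∫ x in ball3 r, |f x| ^ t ≤
      (∫ x in ball3 r, |f x| ^ s) ^ (t / s) *
        ((volume (ball3 1)).toReal * r ^ 3) ^ (1 - t / s) := by
  have hs : 0 < s := ht.trans_le hts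
  have cf : Continuous fun x => |f x| ^ s := hf.abs.rpow_const fun x => .inr hs.le
  have := (holder_two (μ := volume.restrict (ball3 r)) (f := fun x => |f x| ^ s)
    (g := fun _ => (1 : ℝ)) (p := t / s) (q := 1 - t / s)
    (fun x => rpow_nonneg (abs_nonneg _) _) (fun _ => zero_le_one) (cf.intOn r)
    (continuous_const.intOn r) (by positivity)
    (by rw [sub_nonneg, div_le_one hs]; exact hts) (by ring)).2
  simp only [← rpow_mul (abs_nonneg _), mul_div_cancel₀ t hs.ne', one_rpow, mul_one,
    integral_const, smul_eq_mul] at this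
  rw [measureReal_restrict_apply_univ, measureReal_def, volume_ball3 hr] at this
  exact this

theorem norm_fderiv_sq_le (x : E3) : ‖fderiv ℝ f x‖ ^ 2 ≤ ∑ i, pd i f x ^ 2 := by
  have h0 : 0 ≤ ∑ i, pd i f x ^ 2 := Finset.sum_nonneg fun i _ => sq_nonneg _
  rw [← Real.le_sqrt (norm_nonneg _) h0]
  refine ContinuousLinearMap.opNorm_le_bound _ (Real.sqrt_nonneg _) fun v => ?_
  have hv : fderiv ℝ f x v = ∑ i, v i * pd i f x := by
    conv_lhs => rw [← (EuclideanSpace.basisFun (Fin 3) ℝ).sum_repr v]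
    simp [pd]
  rw [hv, norm_eq_abs]
  have h1 : |∑ i, v i * pd i f x| ≤ Real.sqrt (∑ i, v i ^ 2) * Real.sqrt (∑ i, pd i f x ^ 2) := by
    rw [abs_le]
    constructor
    · have := Real.sum_mul_le_sqrt_mul_sqrt Finset.univ (fun i => -v i) (fun i => pd i f x)
      simp only [neg_mul, Finset.sum_neg_distrib, neg_sq] at this
      linarith
    · exact Real.sum_mul_le_sqrt_mul_sqrt _ _ _
  rw [← normSq_eq, Real.sqrt_sq (norm_nonneg _)] at h1
  linarith

theorem pd_of_notMem_tsupport {x : E3} {i : Fin 3} (hx : x ∉ tsupport f) : pd i f x = 0 := by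
  have h : f =ᶠ[𝓝 x] fun _ => 0 := notMem_tsupport_iff_eventuallyEq.1 hx
  rw [pd_congr_of_eventuallyEq h, pd_const]

theorem integrable_sum_pd_sq (hf : Sm f) (hc : HasCompactSupport f) :
    Integrable fun x => ∑ i, pd i f x ^ 2 := by
  have hsm : Sm fun x => ∑ i, pd i f x ^ 2 := ContDiff.sum fun i _ => (hf.pd i).pow 2
  have hcs : HasCompactSupport fun x => ∑ i, pd i f x ^ 2 :=
    HasCompactSupport.intro (K := tsupport f) hc.isCompact fun x hx => by
      have : ∀ i, pd i f x = 0 := fun i => pd_of_notMem_tsupport hx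
      simp [this]
  exact hsm.integrable hcs

theorem integrable_norm_fderiv_sq (hf : Sm f) (hc : HasCompactSupport f) :
    Integrable fun x => ‖fderiv ℝ f x‖ ^ 2 := by
  have cd : Continuous (fderiv ℝ f) := hf.continuous_fderiv (by simp)
  have hcs : HasCompactSupport fun x => ‖fderiv ℝ f x‖ ^ 2 :=
    HasCompactSupport.intro (K := tsupport f) hc.isCompact fun x hx => by
      have h : f =ᶠ[𝓝 x] fun _ => 0 := notMem_tsupport_iff_eventuallyEq.1 hx
      rw [h.fderiv_eq]; simp
  exact (cd.norm.pow 2).integrable_of_hasCompactSupport hcs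

/-- The Sobolev inequality for smooth compactly supported functions. -/
theorem exists_sobolev : ∃ C : ℝ, 1 ≤ C ∧ ∀ f : E3 → ℝ, Sm f → HasCompactSupport f →
    ∫ x, f x ^ 6 ≤ C * (∫ x, ∑ i, pd i f x ^ 2) ^ 3 := by
  set K := eLpNormLESNormFDerivOfEqInnerConst (volume : Measure E3) 2 with hK
  refine ⟨max 1 ((K : ℝ) ^ 6), le_max_left _ _, fun f hf hc => ?_⟩
  have key := eLpNorm_le_eLpNorm_fderiv_of_eq_inner (μ := (volume : Measure E3)) (p := 2) (p' := 6)
    (hf.of_le (by simp)) hc (by norm_num) (by simp) (by simp; norm_num)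
  have cd : Continuous (fderiv ℝ f) := hf.continuous_fderiv (by simp)
  have m1 : MemLp f (6 : NNReal) volume := hf.cont.memLp_of_hasCompactSupport hc
  have m2 : MemLp (fderiv ℝ f) (2 : NNReal) volume :=
    cd.memLp_of_hasCompactSupport (hc.fderiv (𝕜 := ℝ))
  rw [m1.eLpNorm_eq_integral_rpow_norm (by simp) (by simp),
    m2.eLpNorm_eq_integral_rpow_norm (by simp) (by simp)] at key
  simp only [ENNReal.coe_toReal, NNReal.coe_ofNat, norm_eq_abs] at key
  have n1 : 0 ≤ ∫ x, |f x| ^ (6 : ℝ) := integral_nonneg fun x => by positivity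
  have n2 : 0 ≤ ∫ x, ‖fderiv ℝ f x‖ ^ (2 : ℝ) := integral_nonneg fun x => by positivity
  rw [← hK, ← ENNReal.ofReal_coe_nnreal, ← ENNReal.ofReal_mul K.coe_nonneg,
    ENNReal.ofReal_le_ofReal_iff (by positivity)] at key
  have key6 := pow_le_pow_left₀ (by positivity) key 6
  rw [← rpow_mul_natCast n1, mul_pow, ← rpow_mul_natCast n2] at key6
  norm_num at key6
  have e6 : ∀ x, |f x| ^ 6 = f x ^ 6 := fun x => by
    rw [show 6 = 2 * 3 by rfl, pow_mul, pow_mul, sq_abs]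
  simp only [e6] at key6
  refine key6.trans ?_
  have hle : ∫ x, ‖fderiv ℝ f x‖ ^ 2 ≤ ∫ x, ∑ i, pd i f x ^ 2 := by
    refine integral_mono ?_ ?_ fun x => norm_fderiv_sq_le x
    · exact integrable_norm_fderiv_sq hf hc
    · exact integrable_sum_pd_sq hf hc
  have n3 : 0 ≤ ∫ x, ‖fderiv ℝ f x‖ ^ 2 := integral_nonneg fun x => by positivity
  gcongr
  exact le_max_right _ _

end Integrals

section Potentials

variable {f g h : E3 → ℝ} {r R : ℝ}

theorem integral_parts_of_contDiff_one (hf : ContDiff ℝ 1 f) (hg : Sm g) (hc : HasCompactSupport f)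
    (i : Fin 3) : ∫ x, f x * pd i g x = -∫ x, pd i f x * g x := by
  have cpf : Continuous (pd i f) :=
    (hf.continuous_fderiv (by simp)).clm_apply continuous_const
  have h1 : Integrable fun x => pd i f x * g x :=
    (cpf.mul hg.cont).integrable_of_hasCompactSupport (hc.pd i).mul_right
  have h2 : Integrable fun x => f x * pd i g x :=
    (hf.continuous.mul (hg.pd i).cont).integrable_of_hasCompactSupport hc.mul_right
  have h3 : Integrable fun x => f x * g x :=
    (hf.continuous.mul hg.cont).integrable_of_hasCompactSupport hc.mul_right
  exact integral_mul_fderiv_eq_neg_fderiv_mul_of_integrable (v := ee i) h1 h2 h3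
    (fun x _ => hf.differentiable (by simp) x) (fun x _ => hg.diffAt)

/-- `F` has mean oscillation of the admissible growth on all balls of radius larger than one. -/
def OscBound (s K : ℝ) (F : E3 → ℝ) : Prop :=
  ∀ r : ℝ, 1 < r → ∃ c : ℝ, ∫ x in ball3 r, |F x - c| ^ s ≤ K * r ^ (2 + s / 3)

/-- The scalar field `f` is the divergence of the smooth vector potential `F`, the components of
which have controlled oscillation. -/
structure HasPot (s K : ℝ) (f : E3 → ℝ) (F : Fin 3 → E3 → ℝ) : Prop where
  smooth : ∀ k, Sm (F k)
  eq : ∀ x, f x = ∑ k, pd k (F k) x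
  osc : ∀ k, OscBound s K (F k)

theorem HasPot.sm {s K : ℝ} {F : Fin 3 → E3 → ℝ} (h : HasPot s K f F) : Sm f := by
  have : f = fun x => ∑ k, pd k (F k) x := funext h.eq
  rw [this]; exact ContDiff.sum fun k _ => (h.smooth k).pd k

theorem power_mean_osc {s K t : ℝ} (ht : 0 < t) (hts : t ≤ s) (hK : 0 ≤ K) (hr : 0 < r) {c : ℝ}
    (hf : Continuous f) (h : ∫ x in ball3 r, |f x - c| ^ s ≤ K * r ^ (2 + s / 3)) :
    ∫ x in ball3 r, |f x - c| ^ t ≤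
      K ^ (t / s) * (volume (ball3 1)).toReal ^ (1 - t / s) * r ^ (3 + t / 3 - t / s) := by
  have hs : 0 < s := ht.trans_le hts
  refine (power_mean_ball ht hts (hf.sub continuous_const) hr.le).trans ?_
  have hp : 0 ≤ t / s := by positivity
  have h0 : 0 ≤ ∫ x in ball3 r, |f x - c| ^ s :=
    setIntegral_ball_nonneg fun x _ => rpow_nonneg (abs_nonneg _) _
  refine (mul_le_mul_of_nonneg_right (rpow_le_rpow h0 h hp) (by positivity)).trans ?_
  rw [mul_rpow hK (by positivity), mul_rpow (by positivity) (by positivity), ← rpow_mul hr.le,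
    ← rpow_natCast r 3, ← rpow_mul hr.le]
  apply le_of_eq
  have : 3 + t / 3 - t / s = (2 + s / 3) * (t / s) + ((3 : ℕ) : ℝ) * (1 - t / s) := by
    field_simp; push_cast; ring
  rw [this, rpow_add hr]; ring

theorem integral_sq_mul_potential {s K : ℝ} {F : Fin 3 → E3 → ℝ} (hf : HasPot s K f F)
    {φ : E3 → ℝ} (hφ : ContDiff ℝ 1 φ) (hc : HasCompactSupport φ) (c : Fin 3 → ℝ) :
    ∫ x, φ x * f x = ∑ k, -∫ x, pd k φ x * (F k x - c k) := by
  have hF : ∀ k, Sm fun x => F k x - c k := fun k => (hf.smooth k).sub contDiff_const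
  have e : ∀ k x, pd k (fun x => F k x - c k) x = pd k (F k) x := fun k x => by
    rw [pd_sub (hf.smooth k).diffAt (differentiableAt_const _), pd_const, sub_zero]
  have hi : ∀ k, Integrable fun x => φ x * pd k (fun x => F k x - c k) x := fun k =>
    (hφ.continuous.mul ((hF k).pd k).cont).integrable_of_hasCompactSupport hc.mul_right
  calc ∫ x, φ x * f x = ∫ x, ∑ k, φ x * pd k (fun x => F k x - c k) x := by
        refine integral_congr_ae (ae_of_all _ fun x => ?_)
        simp only [e, hf.eq x, Finset.mul_sum]
    _ = ∑ k, ∫ x, φ x * pd k (fun x => F k x - c k) x := integral_finsetSum _ fun k _ => hi k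
    _ = _ := Finset.sum_congr rfl fun k _ => integral_parts_of_contDiff_one hφ (hF k) hc k

theorem half_young (a b : ℝ) : a * b ≤ (1 / 6) * a ^ 2 + (3 / 2) * b ^ 2 := by
  nlinarith [sq_nonneg (a - 3 * b)]

/-- The basic `L²` estimate for a field with a potential. -/
theorem exists_l2_bound {s K : ℝ} (hs1 : 3 < s) (hs2 : s ≤ 6) (hK : 0 ≤ K) :
    ∃ C : ℝ, 1 ≤ C ∧ ∀ f F, HasPot s K f F → ∀ r a b E : ℝ, 1 < r → 0 < a → a < b →
      b ≤ 2 * r → b - a ≤ r → 0 ≤ E → (∀ i, ∫ x in ball3 b, pd i f x ^ 2 ≤ E) →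
      ∫ x in ball3 a, f x ^ 2 ≤ C * (r / (b - a)) ^ 2 * r ^ (5 / 3 : ℝ) * (1 + E) ^ (1 / 2 : ℝ) := by
  obtain ⟨C₁, hC₁, hcut⟩ := exists_cut
  have hs0 : 0 < s := by linarith
  set A : ℝ := K ^ (2 / s) * (volume (ball3 1)).toReal ^ (1 - 2 / s) with hA
  have hA0 : 0 ≤ A := by positivity
  set B : ℝ := A * 2 ^ (3 + 2 / 3 - 2 / s) with hB
  have hB0 : 0 ≤ B := by positivity
  refine ⟨1 + 36 * C₁ ^ 2 * B + 6 * B ^ (1 / 2 : ℝ), by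
    have : 0 ≤ B ^ (1 / 2 : ℝ) := by positivity
    nlinarith [mul_nonneg (sq_nonneg C₁) hB0], ?_⟩
  intro f F hf r a b E hr ha hab hbr hdr hE hpd
  obtain ⟨ψ, hψ⟩ := hcut a b ha hab
  have hr0 : 0 < r := by linarith
  set d := b - a with hd
  have hd0 : 0 < d := sub_pos.2 hab
  choose c hc using fun k => hf.osc k (2 * r) (by linarith)
  have hcF : ∀ k, Continuous fun x => F k x - c k := fun k => (hf.smooth k).cont.sub continuous_const
  have hFb : ∀ k, ∫ x in ball3 b, (F k x - c k) ^ 2 ≤ B * r ^ (11 / 3 - 2 / s) := by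
    intro k
    have h1 := power_mean_osc (t := 2) (by norm_num) (by linarith) hK (by linarith)
      (hf.smooth k).cont (hc k)
    rw [← hA, mul_rpow (by norm_num) hr0.le, ← mul_assoc, ← hB] at h1
    norm_num at h1
    exact (setIntegral_ball_mono_set ((hcF k).pow 2) (fun x => sq_nonneg _) hbr).trans h1
  set Q : ℝ := B * r ^ (11 / 3 - 2 / s) with hQ
  have hQ0 : 0 ≤ Q := by positivity
  set I := ∫ x in ball3 b, (ψ x * f x) ^ 2 with hI
  have hφ : Sm fun x => ψ x ^ 2 * f x := (hψ.smooth.pow 2).mul hf.sm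
  have hz : ∀ x, b ≤ ‖x‖ → ψ x ^ 2 * f x = 0 := fun x hx => by rw [hψ.eq_zero x hx]; ring
  have e1 : I = ∑ k, -∫ x in ball3 b, pd k (fun x => ψ x ^ 2 * f x) x * (F k x - c k) := by
    have h1 := integral_sq_mul_potential hf (hφ.of_le (by simp)) (hasCompactSupport_of_norm hz) c
    rw [integral_eq_ball (r := b) fun x hx => by rw [hz x hx, zero_mul]] at h1
    rw [hI]
    have h2 : ∀ x, (ψ x * f x) ^ 2 = ψ x ^ 2 * f x * f x := fun x => by ring
    simp only [h2, h1]
    refine Finset.sum_congr rfl fun k _ => ?_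
    rw [integral_eq_ball (r := b)]
    intro x hx
    rw [pd_mul (Sm.diffAt (hψ.smooth.pow 2)) hf.sm.diffAt, pd_sq hψ.smooth.diffAt, hψ.eq_zero x hx]
    ring
  have e2 : ∀ k, -∫ x in ball3 b, pd k (fun x => ψ x ^ 2 * f x) x * (F k x - c k) ≤
      (1 / 6) * I + 6 * (C₁ / d) ^ 2 * Q + E ^ (1 / 2 : ℝ) * Q ^ (1 / 2 : ℝ) := by
    intro k
    have i1 : Continuous fun x => (1 / 6) * (ψ x * f x) ^ 2 :=
      ((hψ.smooth.cont.mul hf.sm.cont).pow 2).const_mul _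
    have i2 : Continuous fun x => 6 * (C₁ / d) ^ 2 * (F k x - c k) ^ 2 :=
      ((hcF k).pow 2).const_mul _
    have i3 : Continuous fun x => |pd k f x| * |F k x - c k| :=
      (hf.sm.pd k).cont.abs.mul (hcF k).abs
    have i12 : Continuous fun x => (1 / 6) * (ψ x * f x) ^ 2 +
        6 * (C₁ / d) ^ 2 * (F k x - c k) ^ 2 := i1.add i2
    calc _ = ∫ x in ball3 b, -(pd k (fun x => ψ x ^ 2 * f x) x * (F k x - c k)) :=
          (integral_neg _).symm
      _ ≤ ∫ x in ball3 b, ((1 / 6) * (ψ x * f x) ^ 2 + 6 * (C₁ / d) ^ 2 * (F k x - c k) ^ 2 +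
            |pd k f x| * |F k x - c k|) := by
          refine setIntegral_ball_mono ((hφ.pd k).cont.mul (hcF k)).neg ?_ fun x _ => ?_
          · exact (i1.add i2).add i3
          rw [pd_mul (Sm.diffAt (hψ.smooth.pow 2)) hf.sm.diffAt, pd_sq hψ.smooth.diffAt]
          have y1 := half_young (ψ x * f x) (-(2 * pd k ψ x * (F k x - c k)))
          have y2 : pd k ψ x ^ 2 ≤ (C₁ / d) ^ 2 := by
            rw [← sq_abs]; exact pow_le_pow_left₀ (abs_nonneg _) (hψ.pd_le x k) 2
          have y3 : -(ψ x ^ 2 * pd k f x * (F k x - c k)) ≤ |pd k f x| * |F k x - c k| := by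
            refine (neg_le_abs _).trans ?_
            rw [abs_mul, abs_mul, abs_of_nonneg (sq_nonneg (ψ x))]
            have := pow_le_one₀ (n := 2) (hψ.nonneg x) (hψ.le_one x)
            nlinarith [mul_nonneg (abs_nonneg (pd k f x)) (abs_nonneg (F k x - c k))]
          nlinarith [mul_le_mul_of_nonneg_right y2 (sq_nonneg (F k x - c k))]
      _ = (1 / 6) * I + 6 * (C₁ / d) ^ 2 * (∫ x in ball3 b, (F k x - c k) ^ 2) +
            ∫ x in ball3 b, |pd k f x| * |F k x - c k| := by
          rw [ballInt_add i12 i3, ballInt_add i1 i2, ballInt_const_mul, ballInt_const_mul]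
      _ ≤ _ := by
          have h0 : 0 ≤ ∫ x in ball3 b, pd k f x ^ 2 := setIntegral_ball_nonneg fun x _ => sq_nonneg _
          have h0' : 0 ≤ ∫ x in ball3 b, (F k x - c k) ^ 2 :=
            setIntegral_ball_nonneg fun x _ => sq_nonneg _
          gcongr
          · exact hFb k
          · refine (cauchy_schwarz_ball (hf.sm.pd k).cont (hcF k) b).trans ?_
            gcongr
            · exact hpd k
            · exact hFb k
  have e3 : I ≤ 36 * (C₁ / d) ^ 2 * Q + 6 * (E ^ (1 / 2 : ℝ) * Q ^ (1 / 2 : ℝ)) := by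
    have : I ≤ ∑ _k : Fin 3, ((1 / 6) * I + 6 * (C₁ / d) ^ 2 * Q + E ^ (1 / 2 : ℝ) * Q ^ (1 / 2 : ℝ)) :=
      e1.le.trans (Finset.sum_le_sum fun k _ => e2 k)
    simp only [Finset.sum_const, Finset.card_univ, Fintype.card_fin, nsmul_eq_mul] at this
    push_cast at this
    linarith
  have e4 : ∫ x in ball3 a, f x ^ 2 ≤ I := by
    have : ∫ x in ball3 a, f x ^ 2 = ∫ x in ball3 a, (ψ x * f x) ^ 2 :=
      setIntegral_congr_fun measurableSet_ball3 fun x hx => by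
        simp only [hψ.eq_one x (mem_ball3.1 hx).le, one_mul]
    rw [this]
    exact setIntegral_ball_mono_set ((hψ.smooth.cont.mul hf.sm.cont).pow 2)
      (fun x => sq_nonneg _) hab.le
  refine (e4.trans e3).trans ?_
  have hs6 : 1 / 6 ≤ 1 / s := one_div_le_one_div_of_le hs0 hs2
  have hq1 : 1 ≤ r / d := (one_le_div hd0).2 hdr
  have t1 : (C₁ / d) ^ 2 * Q ≤ C₁ ^ 2 * B * ((r / d) ^ 2 * r ^ (5 / 3 : ℝ) * (1 + E) ^ (1 / 2 : ℝ)) := by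
    have h1 : r ^ (11 / 3 - 2 / s) ≤ r ^ 2 * r ^ (5 / 3 : ℝ) := by
      rw [← rpow_natCast r 2, ← rpow_add hr0]
      refine rpow_le_rpow_of_exponent_le hr.le ?_
      have : 0 < 2 / s := by positivity
      push_cast; linarith
    have h2 : 1 ≤ (1 + E) ^ (1 / 2 : ℝ) := one_le_rpow (by linarith) (by norm_num)
    calc (C₁ / d) ^ 2 * Q ≤ (C₁ / d) ^ 2 * (B * (r ^ 2 * r ^ (5 / 3 : ℝ))) := by rw [hQ]; gcongr
      _ = C₁ ^ 2 * B * ((r / d) ^ 2 * r ^ (5 / 3 : ℝ) * 1) := by rw [div_pow, div_pow]; ring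
      _ ≤ _ := by gcongr
  have t2 : E ^ (1 / 2 : ℝ) * Q ^ (1 / 2 : ℝ) ≤
      B ^ (1 / 2 : ℝ) * ((r / d) ^ 2 * r ^ (5 / 3 : ℝ) * (1 + E) ^ (1 / 2 : ℝ)) := by
    have h1 : (r ^ (11 / 3 - 2 / s)) ^ (1 / 2 : ℝ) ≤ r ^ (5 / 3 : ℝ) := by
      rw [← rpow_mul hr0.le]
      refine rpow_le_rpow_of_exponent_le hr.le ?_
      have : 2 / s = 2 * (1 / s) := by ring
      rw [this]; linarith
    have h2 : E ^ (1 / 2 : ℝ) ≤ (1 + E) ^ (1 / 2 : ℝ) :=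
      rpow_le_rpow hE (by linarith) (by norm_num)
    have h3 : 1 ≤ (r / d) ^ 2 := one_le_pow₀ hq1
    calc E ^ (1 / 2 : ℝ) * Q ^ (1 / 2 : ℝ) ≤ (1 + E) ^ (1 / 2 : ℝ) * (B ^ (1 / 2 : ℝ) * r ^ (5 / 3 : ℝ)) := by
          rw [hQ, mul_rpow hB0 (by positivity)]; gcongr
      _ = B ^ (1 / 2 : ℝ) * (1 * r ^ (5 / 3 : ℝ) * (1 + E) ^ (1 / 2 : ℝ)) := by ring
      _ ≤ _ := by gcongr
  have t0 : 0 ≤ (r / d) ^ 2 * r ^ (5 / 3 : ℝ) * (1 + E) ^ (1 / 2 : ℝ) := by positivity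
  nlinarith

end Potentials

theorem hasDerivAt_mul_abs (t : ℝ) : HasDerivAt (fun t : ℝ => t * |t|) (2 * |t|) t := by
  rcases eq_or_ne t 0 with rfl | ht
  · rw [hasDerivAt_iff_tendsto_slope]
    have : Tendsto (fun t : ℝ => |t|) (𝓝[≠] 0) (𝓝 (2 * |0|)) := by
      have : Continuous fun t : ℝ => |t| := continuous_abs
      simpa using (this.tendsto 0).mono_left nhdsWithin_le_nhds
    refine this.congr' ?_
    filter_upwards [self_mem_nhdsWithin] with y hy
    have hy : y ≠ 0 := hy
    rw [slope_def_field]; field_simp; simp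
  · refine ((hasDerivAt_id' t).fun_mul (hasDerivAt_abs ht)).congr_deriv ?_
    rcases lt_or_gt_of_ne ht with h | h
    · rw [abs_of_neg h, sign_neg h]; simp; ring
    · rw [abs_of_pos h, sign_pos h]; simp; ring

theorem contDiff_mul_abs : ContDiff ℝ 1 fun t : ℝ => t * |t| := by
  rw [contDiff_one_iff_deriv]
  refine ⟨fun t => (hasDerivAt_mul_abs t).differentiableAt, ?_⟩
  have : deriv (fun t : ℝ => t * |t|) = fun t => 2 * |t| := funext fun t => (hasDerivAt_mul_abs t).deriv
  rw [this]; fun_prop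

theorem absorb_power {X M a : ℝ} (hX : 0 ≤ X) (hM : 0 ≤ M) (ha : a < 1) (h : X ≤ M * X ^ a) :
    X ≤ M ^ (1 / (1 - a)) := by
  rcases hX.eq_or_lt with h0 | h0
  · rw [← h0]; positivity
  have h1 : X ^ (1 - a) ≤ M := by
    rw [rpow_sub h0, rpow_one, div_le_iff₀ (rpow_pos_of_pos h0 _)]; exact h
  have h2 := rpow_le_rpow (by positivity) h1 (one_div_pos.2 (sub_pos.2 ha)).le
  rwa [← rpow_mul hX, mul_one_div_cancel (sub_pos.2 ha).ne', rpow_one] at h2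

theorem sq_add_le (a b : ℝ) : (a + b) ^ 2 ≤ 2 * a ^ 2 + 2 * b ^ 2 := by nlinarith [sq_nonneg (a - b)]

section CubicBound

variable {f ζ : E3 → ℝ} {r d b C₀ T : ℝ}

theorem integral_gradsq_cut_le (hf : Sm f) (hζ : Sm ζ) (hd : 0 < d)
    (hpd : ∀ x i, |pd i ζ x| ≤ C₀ / d)
    (hg : ∀ i, ∫ x in ball3 b, (ζ x * pd i f x) ^ 2 ≤ T)
    (hf2 : ∫ x in ball3 b, f x ^ 2 ≤ T * d ^ 2) (i : Fin 3) :
    ∫ x in ball3 b, (|pd i ζ x * f x| + |ζ x * pd i f x|) ^ 2 ≤ 2 * (C₀ ^ 2 + 1) * T := by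
  have c1 : Continuous fun x => 2 * (C₀ / d) ^ 2 * f x ^ 2 := (hf.cont.pow 2).const_mul _
  have c2 : Continuous fun x => 2 * (ζ x * pd i f x) ^ 2 :=
    ((hζ.cont.mul (hf.pd i).cont).pow 2).const_mul _
  have c3 : Continuous fun x => (|pd i ζ x * f x| + |ζ x * pd i f x|) ^ 2 :=
    (((hζ.pd i).cont.mul hf.cont).abs.add (hζ.cont.mul (hf.pd i).cont).abs).pow 2
  calc _ ≤ ∫ x in ball3 b, (2 * (C₀ / d) ^ 2 * f x ^ 2 + 2 * (ζ x * pd i f x) ^ 2) := by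
        refine setIntegral_ball_mono c3 (c1.add c2) fun x _ => ?_
        refine (sq_add_le _ _).trans ?_
        rw [sq_abs, sq_abs, mul_pow, mul_assoc 2]
        have : pd i ζ x ^ 2 ≤ (C₀ / d) ^ 2 := by
          rw [← sq_abs]; exact pow_le_pow_left₀ (abs_nonneg _) (hpd x i) 2
        gcongr
    _ = 2 * (C₀ / d) ^ 2 * (∫ x in ball3 b, f x ^ 2) +
          2 * ∫ x in ball3 b, (ζ x * pd i f x) ^ 2 := by
        rw [ballInt_add c1 c2, ballInt_const_mul, ballInt_const_mul]
    _ ≤ 2 * (C₀ / d) ^ 2 * (T * d ^ 2) + 2 * T := by gcongr; exact hg i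
    _ = _ := by field_simp

theorem integral_six_cut_le {C₆ : ℝ} (hC : 0 ≤ C₆) (hS : ∀ f : E3 → ℝ, Sm f → HasCompactSupport f →
      ∫ x, f x ^ 6 ≤ C₆ * (∫ x, ∑ i, pd i f x ^ 2) ^ 3) (hf : Sm f) (hζ : Sm ζ) (hd : 0 < d)
    (hpd : ∀ x i, |pd i ζ x| ≤ C₀ / d) (hz : ∀ x, b ≤ ‖x‖ → ζ x = 0)
    (hz' : ∀ x i, b ≤ ‖x‖ → pd i ζ x = 0)
    (hg : ∀ i, ∫ x in ball3 b, (ζ x * pd i f x) ^ 2 ≤ T)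
    (hf2 : ∫ x in ball3 b, f x ^ 2 ≤ T * d ^ 2) :
    ∫ x in ball3 b, (ζ x * f x) ^ 6 ≤ C₆ * (6 * (C₀ ^ 2 + 1)) ^ 3 * T ^ 3 := by
  have hh : Sm fun x => ζ x * f x := hζ.mul hf
  have hc : HasCompactSupport fun x => ζ x * f x :=
    hasCompactSupport_of_norm (b := b) fun x hx => by rw [hz x hx, zero_mul]
  have h1 := hS _ hh hc
  have e : ∀ i x, pd i (fun x => ζ x * f x) x = pd i ζ x * f x + ζ x * pd i f x := fun i x =>
    pd_mul hζ.diffAt hf.diffAt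
  rw [integral_eq_ball (r := b) fun x hx => by rw [hz x hx]; ring,
    integral_eq_ball (r := b) (fun x hx => by simp [e, hz x hx, hz' x _ hx])] at h1
  refine h1.trans ?_
  rw [mul_assoc, ← mul_pow]
  have h0 : 0 ≤ ∫ x in ball3 b, ∑ i, pd i (fun x => ζ x * f x) x ^ 2 :=
    setIntegral_ball_nonneg fun x _ => Finset.sum_nonneg fun i _ => sq_nonneg _
  gcongr
  rw [ballInt_sum (F := fun i x => pd i (fun x => ζ x * f x) x ^ 2) _ fun i =>
    ((hh.pd i).cont.pow 2)]
  calc _ ≤ ∑ _i : Fin 3, 2 * (C₀ ^ 2 + 1) * T := by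
        refine Finset.sum_le_sum fun i _ => le_trans ?_
          (integral_gradsq_cut_le hf hζ hd hpd hg hf2 i)
        refine setIntegral_ball_mono ((hh.pd i).cont.pow 2)
          ((((hζ.pd i).cont.mul hf.cont).abs.add (hζ.cont.mul (hf.pd i).cont).abs).pow 2)
          fun x _ => ?_
        rw [e, ← sq_abs]
        exact pow_le_pow_left₀ (abs_nonneg _) (abs_add_le _ _) 2
    _ = _ := by simp; ring

/-- The localised sixth and third power estimates for a field with a potential. -/
theorem exists_cubic_bound {s K C₀ : ℝ} (hs1 : 3 < s) (hs2 : s ≤ 6) (hK : 0 ≤ K) :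
    ∃ C : ℝ, 1 ≤ C ∧ ∀ f F, HasPot s K f F → ∀ ζ : E3 → ℝ, Sm ζ → (∀ x, 0 ≤ ζ x) → (∀ x, ζ x ≤ 1) →
      ∀ r d b T : ℝ, 1 < r → 0 < d → b ≤ 2 * r → 0 ≤ T → (∀ x i, |pd i ζ x| ≤ C₀ / d) →
      (∀ x, b ≤ ‖x‖ → ζ x = 0) → (∀ x i, b ≤ ‖x‖ → pd i ζ x = 0) →
      (∀ i, ∫ x in ball3 b, (ζ x * pd i f x) ^ 2 ≤ T) → (∫ x in ball3 b, f x ^ 2 ≤ T * d ^ 2) →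
      (∫ x in ball3 b, (ζ x * f x) ^ 6 ≤ C * T ^ 3) ∧
      ∫ x in ball3 b, |ζ x * f x| ^ 3 ≤ C * r * T ^ (9 / (s + 6)) := by
  obtain ⟨C₆, hC₆, hS⟩ := exists_sobolev
  have hs0 : 0 < s := by linarith
  set a := 2 / 3 - 2 / s with ha
  set β := 1 / s - 1 / 6 with hβ
  have ha0 : 0 ≤ a := by
    rw [ha, sub_nonneg, div_le_div_iff₀ hs0 (by norm_num)]; linarith
  have hβ0 : 0 ≤ β := by
    rw [hβ, sub_nonneg, div_le_div_iff₀ (by norm_num) hs0]; linarith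
  have ha1 : a < 1 := by rw [ha]; have : 0 < 2 / s := by positivity
                         linarith
  set D₆ := C₆ * (6 * (C₀ ^ 2 + 1)) ^ 3 with hD₆
  have hD₆0 : 0 ≤ D₆ := by positivity
  set A := 9 * ((K * 2 ^ (2 + s / 3)) ^ (1 / s) * (2 * (C₀ ^ 2 + 1)) ^ (1 / 2 : ℝ) * D₆ ^ β) with hA
  have hA0 : 0 ≤ A := by positivity
  refine ⟨1 + D₆ + A ^ (1 / (1 - a)), by
    have : 0 ≤ A ^ (1 / (1 - a)) := by positivity
    linarith, ?_⟩
  intro f F hf ζ hζ hζ0 hζ1 r d b T hr hd hbr hT hpd hz hz' hg hf2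
  have hA1 : 0 ≤ A ^ (1 / (1 - a)) := by positivity
  have hr0 : 0 < r := by linarith
  have b6 := integral_six_cut_le (by linarith) hS hf.sm hζ hd hpd hz hz' hg hf2
  rw [← hD₆] at b6
  refine ⟨b6.trans (by gcongr; linarith), ?_⟩
  set X := ∫ x in ball3 b, |ζ x * f x| ^ 3 with hX
  have hX0 : 0 ≤ X := setIntegral_ball_nonneg fun x _ => by positivity
  choose c hc using fun k => hf.osc k (2 * r) (by linarith)
  have hcF : ∀ k, Continuous fun x => F k x - c k := fun k => (hf.smooth k).cont.sub continuous_const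
  have hFb : ∀ k, ∫ x in ball3 b, |F k x - c k| ^ s ≤ K * 2 ^ (2 + s / 3) * r ^ (2 + s / 3) := by
    intro k
    refine (setIntegral_ball_mono_set ((hcF k).abs.rpow_const fun x => .inr hs0.le)
      (fun x => rpow_nonneg (abs_nonneg _) _) hbr).trans ((hc k).trans (le_of_eq ?_))
    rw [mul_rpow (by norm_num) hr0.le, mul_assoc]
  have hφf : ContDiff ℝ 1 fun x => f x * |f x| := contDiff_mul_abs.comp (hf.sm.of_le (by simp))
  have hζ3 : Sm fun x => ζ x ^ 3 := hζ.pow 3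
  have hφ : ContDiff ℝ 1 fun x => ζ x ^ 3 * (f x * |f x|) := (hζ3.of_le (by simp)).mul hφf
  have hz3 : ∀ x, b ≤ ‖x‖ → ζ x ^ 3 * (f x * |f x|) = 0 := fun x hx => by rw [hz x hx]; ring
  have e0 : ∀ k x, pd k (fun x => ζ x ^ 3 * (f x * |f x|)) x =
      3 * ζ x ^ 2 * pd k ζ x * (f x * |f x|) + ζ x ^ 3 * (2 * |f x| * pd k f x) := by
    intro k x
    rw [pd_mul hζ3.diffAt (hφf.differentiable (by simp) x), pd_pow 3 hζ.diffAt,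
      pd_comp (φ := fun t => t * |t|) (hasDerivAt_mul_abs _).differentiableAt hf.sm.diffAt,
      (hasDerivAt_mul_abs _).deriv]
    norm_num
  have e1 : X = ∑ k, -∫ x in ball3 b, pd k (fun x => ζ x ^ 3 * (f x * |f x|)) x * (F k x - c k) := by
    have h1 := integral_sq_mul_potential hf hφ (hasCompactSupport_of_norm hz3) c
    rw [integral_eq_ball (r := b) fun x hx => by rw [hz3 x hx, zero_mul]] at h1
    have h2 : ∀ x, |ζ x * f x| ^ 3 = ζ x ^ 3 * (f x * |f x|) * f x := fun x => by
      rw [abs_mul, abs_of_nonneg (hζ0 x), mul_pow, pow_succ |f x| 2, sq_abs]; ring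
    rw [hX]
    simp only [h2, h1]
    refine Finset.sum_congr rfl fun k _ => ?_
    rw [integral_eq_ball (r := b)]
    intro x hx
    rw [e0, hz x hx]
    ring
  have cpφ : ∀ k, Continuous (pd k fun x => ζ x ^ 3 * (f x * |f x|)) := fun k =>
    (hφ.continuous_fderiv (by simp)).clm_apply continuous_const
  have e2 : ∀ k, -∫ x in ball3 b, pd k (fun x => ζ x ^ 3 * (f x * |f x|)) x * (F k x - c k) ≤
      3 * ((K * 2 ^ (2 + s / 3) * r ^ (2 + s / 3)) ^ (1 / s) *
        (2 * (C₀ ^ 2 + 1) * T) ^ (1 / 2 : ℝ) * X ^ a * (D₆ * T ^ 3) ^ β) := by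
    intro k
    have cg : Continuous fun x => |pd k ζ x * f x| + |ζ x * pd k f x| :=
      ((hζ.pd k).cont.mul hf.sm.cont).abs.add (hζ.cont.mul (hf.sm.pd k).cont).abs
    have ch : Continuous fun x => ζ x * f x := hζ.cont.mul hf.sm.cont
    have c3 : Continuous fun x => |F k x - c k| * |(|pd k ζ x * f x| + |ζ x * pd k f x|)| *
        |ζ x * f x| := ((hcF k).abs.mul cg.abs).mul ch.abs
    calc _ = ∫ x in ball3 b, -(pd k (fun x => ζ x ^ 3 * (f x * |f x|)) x * (F k x - c k)) :=
          (integral_neg _).symm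
      _ ≤ ∫ x in ball3 b, 3 * (|F k x - c k| * |(|pd k ζ x * f x| + |ζ x * pd k f x|)| *
            |ζ x * f x|) := by
          refine setIntegral_ball_mono ((cpφ k).mul (hcF k)).neg (c3.const_mul 3) fun x _ => ?_
          refine (neg_le_abs _).trans ?_
          rw [e0, abs_mul, abs_of_nonneg (by positivity : 0 ≤ |pd k ζ x * f x| + |ζ x * pd k f x|)]
          have h1 : |3 * ζ x ^ 2 * pd k ζ x * (f x * |f x|) + ζ x ^ 3 * (2 * |f x| * pd k f x)| ≤
              3 * (|pd k ζ x * f x| + |ζ x * pd k f x|) * |ζ x * f x| := by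
            refine (abs_add_le _ _).trans ?_
            simp only [abs_mul, abs_pow, abs_abs, abs_of_nonneg (hζ0 x), Nat.abs_ofNat]
            have p1 : ζ x ^ 2 ≤ ζ x := by nlinarith [hζ0 x, hζ1 x]
            have p2 : ζ x ^ 3 ≤ ζ x ^ 2 := by nlinarith [hζ0 x, hζ1 x, sq_nonneg (ζ x)]
            have q1 := mul_le_mul_of_nonneg_right p1
              (mul_nonneg (abs_nonneg (pd k ζ x)) (mul_self_nonneg |f x|))
            have q2 := mul_le_mul_of_nonneg_right p2
              (mul_nonneg (abs_nonneg (f x)) (abs_nonneg (pd k f x)))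
            have q3 := mul_nonneg (sq_nonneg (ζ x))
              (mul_nonneg (abs_nonneg (f x)) (abs_nonneg (pd k f x)))
            nlinarith
          have h2 := mul_le_mul_of_nonneg_right h1 (abs_nonneg (F k x - c k))
          linarith
      _ = 3 * ∫ x in ball3 b, |F k x - c k| * |(|pd k ζ x * f x| + |ζ x * pd k f x|)| *
            |ζ x * f x| := ballInt_const_mul _ _ _
      _ ≤ _ := by
          have n1 : 0 ≤ ∫ x in ball3 b, |F k x - c k| ^ s :=
            setIntegral_ball_nonneg fun x _ => rpow_nonneg (abs_nonneg _) _
          have n2 : 0 ≤ ∫ x in ball3 b, (|pd k ζ x * f x| + |ζ x * pd k f x|) ^ 2 :=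
            setIntegral_ball_nonneg fun x _ => sq_nonneg _
          have n3 : 0 ≤ ∫ x in ball3 b, (ζ x * f x) ^ 6 :=
            setIntegral_ball_nonneg fun x _ => by positivity
          refine mul_le_mul_of_nonneg_left
            ((trilinear_ball hs1 hs2 (hcF k) cg ch b).trans ?_) (by norm_num)
          gcongr
          · exact hFb k
          · exact integral_gradsq_cut_le hf.sm hζ hd hpd hg hf2 k
  have e3 : X ≤ (A * r ^ (1 - a) * T ^ (3 / s)) * X ^ a := by
    have : X ≤ ∑ _k : Fin 3, 3 * ((K * 2 ^ (2 + s / 3) * r ^ (2 + s / 3)) ^ (1 / s) *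
        (2 * (C₀ ^ 2 + 1) * T) ^ (1 / 2 : ℝ) * X ^ a * (D₆ * T ^ 3) ^ β) :=
      e1.le.trans (Finset.sum_le_sum fun k _ => e2 k)
    refine this.trans (le_of_eq ?_)
    simp only [Finset.sum_const, Finset.card_univ, Fintype.card_fin, nsmul_eq_mul]
    rw [mul_rpow (by positivity) (by positivity), mul_rpow (by positivity) hT,
      mul_rpow hD₆0 (by positivity), ← rpow_mul hr0.le, ← rpow_natCast T 3, ← rpow_mul hT]
    have h1 : (2 + s / 3) * (1 / s) = 1 - a := by rw [ha]; field_simp; ring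
    have h2 : 3 / s = 1 / 2 + ((3 : ℕ) : ℝ) * β := by rw [hβ]; push_cast; ring
    rw [h1, h2, rpow_add_of_nonneg hT (by norm_num) (by positivity), hA]
    push_cast; ring
  have e4 := absorb_power hX0 (by positivity) ha1 e3
  refine e4.trans ?_
  have ha1' : 0 < 1 - a := sub_pos.2 ha1
  rw [mul_rpow (by positivity) (by positivity), mul_rpow hA0 (by positivity), ← rpow_mul hr0.le,
    mul_one_div_cancel ha1'.ne', rpow_one, ← rpow_mul hT]
  have h3 : 3 / s * (1 / (1 - a)) = 9 / (s + 6) := by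
    have : 1 - a = (s + 6) / (3 * s) := by rw [ha]; field_simp; ring
    rw [this]; field_simp; ring
  rw [h3]
  gcongr
  linarith

end CubicBound

theorem abs_le_frob (A : Fin 3 → Fin 3 → ℝ) (i j : Fin 3) : |A i j| ≤ frob A := by
  rw [frob]
  apply Real.le_sqrt_of_sq_le
  rw [sq_abs]
  exact (Finset.single_le_sum (f := fun j => A i j ^ 2) (fun _ _ => sq_nonneg _)
    (Finset.mem_univ j)).trans (Finset.single_le_sum (f := fun i => ∑ j, A i j ^ 2)
      (fun _ _ => Finset.sum_nonneg fun _ _ => sq_nonneg _) (Finset.mem_univ i))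

theorem meanOsc_nonneg (Φ : E3 → Fin 3 → Fin 3 → ℝ) (s r : ℝ) : 0 ≤ meanOsc Φ s r := by
  unfold meanOsc
  refine rpow_nonneg (mul_nonneg (by positivity) (integral_nonneg fun x => ?_)) _
  exact rpow_nonneg (sqrt_nonneg _) _

theorem oscBound_of_meanOsc {Φ : E3 → Fin 3 → Fin 3 → ℝ} {s C₀ : ℝ} (hs : 0 < s) (hC₀ : 0 ≤ C₀)
    (hΦ : ∀ i j, Sm fun x => Φ x i j)
    (h : ∀ r : ℝ, 1 < r → meanOsc Φ s r ≤ C₀ * r ^ ((1 : ℝ) / 3 - 1 / s)) (i j : Fin 3) :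
    OscBound s (C₀ ^ s * (volume (ball3 1)).toReal) fun x => Φ x i j := by
  intro r hr
  have hr0 : 0 < r := by linarith
  refine ⟨mavg Φ r i j, ?_⟩
  have hv := volume_ball3_pos hr0
  have cfrob : Continuous fun x => (frob fun i j => Φ x i j - mavg Φ r i j) ^ s := by
    refine Continuous.rpow_const ?_ fun x => Or.inr hs.le
    unfold frob
    exact continuous_sqrt.comp (continuous_finsetSum _ fun i _ => continuous_finsetSum _ fun j _ =>
      ((hΦ i j).cont.sub continuous_const).pow 2)
  have h1 : ∫ x in ball3 r, |Φ x i j - mavg Φ r i j| ^ s ≤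
      ∫ x in ball3 r, (frob fun i j => Φ x i j - mavg Φ r i j) ^ s := by
    refine setIntegral_ball_mono ?_ cfrob fun x _ => ?_
    · exact Continuous.rpow_const ((hΦ i j).cont.sub continuous_const).abs fun x => Or.inr hs.le
    · exact rpow_le_rpow (abs_nonneg _) (abs_le_frob (fun i j => Φ x i j - mavg Φ r i j) i j) hs.le
  have hI0 : 0 ≤ ∫ x in ball3 r, (frob fun i j => Φ x i j - mavg Φ r i j) ^ s :=
    setIntegral_ball_nonneg fun x _ => rpow_nonneg (sqrt_nonneg _) _
  have h2 := rpow_le_rpow (meanOsc_nonneg Φ s r) (h r hr) hs.le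
  rw [meanOsc, ← rpow_mul (by positivity), one_div_mul_cancel hs.ne', rpow_one,
    inv_mul_le_iff₀ hv, mul_rpow hC₀ (by positivity), ← rpow_mul hr0.le, volume_ball3 hr0.le] at h2
  refine h1.trans (h2.trans_eq ?_)
  have e : (2 + s / 3 : ℝ) = (3 : ℕ) + (1 / 3 - 1 / s) * s := by field_simp; push_cast; ring
  rw [e, rpow_add hr0, rpow_natCast]; ring

theorem hasPot_of_meanOsc {Φ : E3 → Fin 3 → Fin 3 → ℝ} {v : E3 → E3} {s C₀ : ℝ} (hs : 0 < s)
    (hC₀ : 0 ≤ C₀) (hΦ : ∀ i j, Sm fun x => Φ x i j) (hv : ∀ x j, mdiv Φ x j = v x j)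
    (h : ∀ r : ℝ, 1 < r → meanOsc Φ s r ≤ C₀ * r ^ ((1 : ℝ) / 3 - 1 / s)) (j : Fin 3) :
    HasPot s (C₀ ^ s * (volume (ball3 1)).toReal) (fun x => v x j) fun i x => Φ x i j where
  smooth i := hΦ i j
  eq x := (hv x j).symm
  osc i := oscBound_of_meanOsc hs hC₀ hΦ h i j

theorem exists_radial_profile : ∃ P : ℝ → ℝ, ContDiff ℝ (⊤ : ℕ∞) P ∧ (∀ t, t ≤ 1 → P t = 0) ∧
    (∀ t, 2 ≤ t → P t = t ^ (-(3 / 2) : ℝ)) ∧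
    ∀ t, 0 < t → 3 * P t + 2 * t * deriv P t =
      2 * t ^ (-(1 / 2) : ℝ) * deriv smoothTransition (t - 1) := by
  have hS : ContDiff ℝ (⊤ : ℕ∞) smoothTransition := smoothTransition.contDiff
  set P : ℝ → ℝ := fun t => t ^ (-(3 / 2) : ℝ) * smoothTransition (t - 1) with hP
  have hz : ∀ t, t ≤ 1 → P t = 0 := fun t ht => by
    simp only [hP]; rw [smoothTransition.zero_of_nonpos (by linarith), mul_zero]
  have sm : ContDiff ℝ (⊤ : ℕ∞) P := by
    rw [contDiff_iff_contDiffAt]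
    intro t
    rcases lt_or_ge t 1 with h | h
    · refine (contDiffAt_const (c := (0 : ℝ))).congr_of_eventuallyEq ?_
      filter_upwards [Iio_mem_nhds h] with y hy using hz y (le_of_lt hy)
    · exact (contDiffAt_rpow_const_of_ne (by linarith : t ≠ 0)).mul
        (hS.comp (contDiff_id.sub contDiff_const)).contDiffAt
  refine ⟨P, sm, hz, fun t ht => ?_, fun t ht => ?_⟩
  · simp only [hP]; rw [smoothTransition.one_of_one_le (by linarith), mul_one]
  · have h1 : HasDerivAt P (-(3 / 2) * t ^ (-(3 / 2) - 1 : ℝ) * smoothTransition (t - 1) +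
        t ^ (-(3 / 2) : ℝ) * deriv smoothTransition (t - 1)) t := by
      have h2 : HasDerivAt (fun t => smoothTransition (t - 1)) (deriv smoothTransition (t - 1)) t :=
        HasDerivAt.comp_sub_const t 1 ((hS.differentiable (by simp)) _).hasDerivAt
      exact (hasDerivAt_rpow_const (Or.inl ht.ne')).fun_mul h2
    rw [h1.deriv]
    simp only [hP]
    have e1 : t * t ^ (-(3 / 2) - 1 : ℝ) = t ^ (-(3 / 2) : ℝ) := by
      rw [rpow_sub ht, rpow_one]; field_simp
    have e2 : t * t ^ (-(3 / 2) : ℝ) = t ^ (-(1 / 2) : ℝ) := by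
      rw [show (-(1 / 2) : ℝ) = -(3 / 2) + 1 by norm_num, rpow_add ht, rpow_one, mul_comm]
    linear_combination (-3 * smoothTransition (t - 1)) * e1 +
      (2 * deriv smoothTransition (t - 1)) * e2

/-- A compactly supported smooth curl-free field whose divergence is the difference of a mollifier
and its dilate by the factor two. -/
structure IsDyadicKernel (q : Fin 3 → E3 → ℝ) (η : E3 → ℝ) : Prop where
  smooth_q : ∀ j, Sm (q j)
  smooth_eta : Sm η
  q_zero : ∀ j x, 3 ≤ ‖x‖ → q j x = 0
  eta_zero : ∀ x, 3 ≤ ‖x‖ → η x = 0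
  curl : ∀ m j x, pd m (q j) x = pd j (q m) x
  div : ∀ x, ∑ j, pd j (q j) x = η x - η ((2 : ℝ)⁻¹ • x) / 8
  eta_nonneg : ∀ x, 0 ≤ η x
  eta_int : ∫ x, η x = 1

theorem sm_radial {Q : ℝ → ℝ} (hQ : ContDiff ℝ (⊤ : ℕ∞) Q) : Sm fun x : E3 => Q (‖x‖ ^ 2) :=
  hQ.comp sm_normSq

theorem pd_coord_mul_radial {Q : ℝ → ℝ} (hQ : ContDiff ℝ (⊤ : ℕ∞) Q) (m j : Fin 3) (x : E3) :
    pd m (fun y : E3 => y j * Q (‖y‖ ^ 2)) x =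
      (if j = m then 1 else 0) * Q (‖x‖ ^ 2) + 2 * x j * x m * deriv Q (‖x‖ ^ 2) := by
  rw [pd_mul (f := fun y : E3 => y j) (sm_coord j).diffAt (sm_radial hQ).diffAt, pd_coord,
    pd_comp (φ := Q) (hQ.differentiable (by simp)).differentiableAt sm_normSq.diffAt, pd_normSq]
  ring

theorem sum_pd_coord_mul_radial {Q : ℝ → ℝ} (hQ : ContDiff ℝ (⊤ : ℕ∞) Q) (x : E3) :
    ∑ j, pd j (fun y : E3 => y j * Q (‖y‖ ^ 2)) x =
      3 * Q (‖x‖ ^ 2) + 2 * ‖x‖ ^ 2 * deriv Q (‖x‖ ^ 2) := by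
  simp only [pd_coord_mul_radial hQ]
  have := normSq_eq x
  rw [Fin.sum_univ_three] at this ⊢
  simp only [if_true]
  linear_combination (-2 * deriv Q (‖x‖ ^ 2)) * this

theorem exists_dyadicKernel : ∃ q η, IsDyadicKernel q η := by
  obtain ⟨P, sP, P1, P2, P3⟩ := exists_radial_profile
  have hS : ContDiff ℝ (⊤ : ℕ∞) smoothTransition := smoothTransition.contDiff
  set H : ℝ → ℝ := fun t => 3 * P t + 2 * t * deriv P t with hH
  have sH : ContDiff ℝ (⊤ : ℕ∞) H := (contDiff_const.mul sP).add
    ((contDiff_const.mul contDiff_id).mul (contDiff_deriv_top sP))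
  have H0 : ∀ t, 0 ≤ t → 0 ≤ H t := fun t ht => by
    rcases ht.eq_or_lt with rfl | ht
    · simp [hH, P1]
    · simp only [hH]; rw [P3 t ht]
      exact mul_nonneg (by positivity) smoothTransition.monotone.deriv_nonneg
  have H2 : ∀ t, 2 < t → H t = 0 := fun t ht => by
    simp only [hH]
    rw [P3 t (by linarith)]
    have : smoothTransition =ᶠ[𝓝 (t - 1)] fun _ => 1 := by
      filter_upwards [Ioi_mem_nhds (by linarith : 1 < t - 1)] with y hy
        using smoothTransition.one_of_one_le (le_of_lt hy)
    rw [this.deriv_eq]; simp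
  have Hne : ∃ t, 0 < t ∧ H t ≠ 0 := by
    by_contra! hcon
    have h0 : ∀ t : ℝ, -1 < t → deriv smoothTransition t = 0 := fun t ht => by
      have h1 := hcon (t + 1) (by linarith)
      simp only [hH] at h1
      rw [P3 _ (by linarith), add_sub_cancel_right] at h1
      have : 0 < 2 * (t + 1) ^ (-(1 / 2) : ℝ) := by
        have := rpow_pos_of_pos (by linarith : 0 < t + 1) (-(1 / 2)); linarith
      exact (mul_eq_zero.1 h1).resolve_left this.ne'
    obtain ⟨c, hc, hc'⟩ := exists_deriv_eq_slope smoothTransition (zero_lt_one (α := ℝ))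
      hS.continuous.continuousOn (hS.differentiable (by simp)).differentiableOn
    rw [h0 c (by linarith [hc.1])] at hc'
    simp at hc'
  set η₀ : E3 → ℝ := fun x => H (‖x‖ ^ 2) with hη₀
  have sη : Sm η₀ := sm_radial sH
  have zη : ∀ x : E3, 3 ≤ ‖x‖ → η₀ x = 0 := fun x hx => H2 _ (by nlinarith)
  have cη : HasCompactSupport η₀ := hasCompactSupport_of_norm zη
  have pη : 0 < ∫ x, η₀ x := by
    obtain ⟨t, ht, hne⟩ := Hne
    refine sη.cont.integral_pos_of_hasCompactSupport_nonneg_nonzero cη (fun x => H0 _ (sq_nonneg _))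
      (x := EuclideanSpace.single 0 (√t)) ?_
    simp only [hη₀]
    rw [PiLp.norm_single, norm_eq_abs, sq_abs, sq_sqrt ht.le]; exact hne
  set c := ∫ x, η₀ x with hc
  set Q : ℝ → ℝ := fun t => c⁻¹ * (P t - P (t / 4) / 8) with hQ
  have sQ : ContDiff ℝ (⊤ : ℕ∞) Q :=
    contDiff_const.mul (sP.sub ((sP.comp (contDiff_id.div_const 4)).div_const 8))
  have dQ : ∀ t, 3 * Q t + 2 * t * deriv Q t = c⁻¹ * (H t - H (t / 4) / 8) := fun t => by
    have hd : ∀ t, HasDerivAt P (deriv P t) t := fun t =>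
      (sP.differentiable (by simp)).differentiableAt.hasDerivAt
    have h1 : HasDerivAt Q (c⁻¹ * (deriv P t - deriv P (t / 4) * (1 / 4) / 8)) t :=
      ((hd t).sub (((hd (t / 4)).comp t ((hasDerivAt_id t).div_const 4)).div_const 8)).const_mul _
    rw [h1.deriv]
    simp only [hQ, hH]; ring
  refine ⟨fun j x => x j * Q (‖x‖ ^ 2), fun x => c⁻¹ * η₀ x, ?_⟩
  refine ⟨fun j => (sm_coord j).mul (sm_radial sQ), contDiff_const.mul sη, fun j x hx => ?_,
    fun x hx => by rw [zη x hx, mul_zero], fun m j x => ?_, fun x => ?_, fun x => ?_, ?_⟩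
  · have h9 : 9 ≤ ‖x‖ ^ 2 := by nlinarith
    have : Q (‖x‖ ^ 2) = 0 := by
      simp only [hQ]
      rw [P2 _ (by linarith), P2 _ (by linarith), div_rpow (by linarith) (by norm_num)]
      have : (4 : ℝ) ^ (-(3 / 2) : ℝ) = 1 / 8 := by
        rw [show (4 : ℝ) = 2 ^ (2 : ℝ) by norm_num, ← rpow_mul (by norm_num)]
        norm_num
      rw [this]; ring
    rw [this, mul_zero]
  · simp only [pd_coord_mul_radial sQ]
    rcases eq_or_ne j m with rfl | h
    · rfl
    · rw [if_neg h, if_neg h.symm]; ring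
  · rw [sum_pd_coord_mul_radial sQ, dQ]
    simp only [hη₀, norm_smul]
    rw [mul_pow, norm_inv, norm_ofNat]
    rw [show (2⁻¹ : ℝ) ^ 2 * ‖x‖ ^ 2 = ‖x‖ ^ 2 / 4 by ring]; ring
  · exact mul_nonneg (inv_nonneg.2 pη.le) (H0 _ (sq_nonneg _))
  · rw [integral_const_mul]; exact inv_mul_cancel₀ (ne_of_gt pη)

/-- Convolution of a kernel with a function on space. -/
def cv (k g : E3 → ℝ) (x : E3) : ℝ := ∫ y, k (x - y) * g y

section Convolution

open ContinuousLinearMap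

variable {k l g h : E3 → ℝ} {x : E3}

theorem cv_eq_convolution : cv k g = convolution g k (ContinuousLinearMap.mul ℝ ℝ) volume := by
  funext x
  rw [cv, convolution_mul]
  exact integral_congr_ae (Eventually.of_forall fun y => mul_comm _ _)

theorem cv_swap : cv k g x = ∫ y, k y * g (x - y) := by
  rw [cv_eq_convolution, convolution_mul_swap]
  exact integral_congr_ae (Eventually.of_forall fun y => mul_comm _ _)

theorem Sm.cv (hk : Sm k) (hc : HasCompactSupport k) (hg : LocallyIntegrable g) : Sm (cv k g) := by
  rw [cv_eq_convolution]
  exact hc.contDiff_convolution_right _ hg hk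

theorem pd_cv (hk : Sm k) (hc : HasCompactSupport k) (hg : LocallyIntegrable g) (i : Fin 3) :
    pd i (cv k g) x = cv (pd i k) g x := by
  have h1 := hc.hasFDerivAt_convolution_right (ContinuousLinearMap.mul ℝ ℝ) hg
    (hk.of_le (by simp)) x
  rw [pd, cv_eq_convolution, h1.fderiv, cv_eq_convolution]
  rw [convolution_precompR_apply _ hg (hc.fderiv ℝ) (hk.continuous_fderiv (by simp))]
  rfl

theorem cv_comm : cv k g x = cv g k x := by
  rw [cv_swap, cv]
  exact integral_congr_ae (Eventually.of_forall fun y => mul_comm _ _)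

/-- The convolution only depends on the values near the point. -/
theorem cv_congr_ball {a : ℝ} (hk : ∀ y, a ≤ ‖y‖ → k y = 0) (h : ∀ y, ‖y - x‖ < a → g y = l y) :
    cv k g x = cv k l x := by
  refine integral_congr_ae (Eventually.of_forall fun y => ?_)
  rcases lt_or_ge ‖y - x‖ a with hy | hy
  · simp only [h y hy]
  · rw [norm_sub_rev] at hy
    simp only [hk _ hy, zero_mul]

theorem HasCompactSupport.exists_norm (hc : HasCompactSupport k) :
    ∃ a, 0 < a ∧ ∀ y, a ≤ ‖y‖ → k y = 0 := by
  obtain ⟨a, ha⟩ := hc.isCompact.isBounded.subset_ball 0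
  refine ⟨max a 1, by positivity, fun y hy => ?_⟩
  by_contra hne
  have := ha (subset_tsupport k hne)
  rw [mem_ball_zero_iff] at this
  linarith [le_max_left a 1]

theorem exists_sm_cutoff (hg : Sm g) {a : ℝ} (ha : 0 < a) :
    ∃ G, Sm G ∧ HasCompactSupport G ∧ ∀ y, ‖y‖ ≤ a → G y = g y := by
  obtain ⟨C, -, h⟩ := exists_cut
  obtain ⟨χ, hχ⟩ := h a (a + 1) ha (by linarith)
  exact ⟨fun y => χ y * g y, hχ.smooth.mul hg, hχ.compact.mul_right, fun y hy => by
    simp only [hχ.eq_one y hy, one_mul]⟩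

theorem exists_cv_cutoff (hc : HasCompactSupport k) (hg : Sm g) (x : E3) :
    ∃ G, Sm G ∧ HasCompactSupport G ∧ cv k g =ᶠ[𝓝 x] cv k G ∧
      ∀ i, cv k (pd i g) x = cv k (pd i G) x := by
  obtain ⟨a, ha, hk⟩ := hc.exists_norm
  obtain ⟨G, sG, cG, eG⟩ := exists_sm_cutoff hg (a := ‖x‖ + a + 1) (by positivity)
  refine ⟨G, sG, cG, ?_, fun i => ?_⟩
  · filter_upwards [ball_mem_nhds x one_pos] with z hz
    refine cv_congr_ball hk fun y hy => (eG y ?_).symm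
    rw [mem_ball, dist_eq_norm] at hz
    have h1 := norm_add_le (y - z) (z - x)
    have h2 := norm_add_le (y - z + (z - x)) x
    simp only [sub_add_sub_cancel, sub_add_cancel] at h1 h2
    linarith
  · refine cv_congr_ball hk fun y hy => ?_
    refine pd_congr_of_eventuallyEq ?_
    filter_upwards [ball_mem_nhds y one_pos] with z hz
    rw [mem_ball, dist_eq_norm] at hz
    refine (eG z ?_).symm
    have h1 := norm_add_le (z - y) (y - x)
    have h2 := norm_add_le (z - y + (y - x)) x
    simp only [sub_add_sub_cancel, sub_add_cancel] at h1 h2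
    linarith

theorem pd_cv_right (hk : Continuous k) (hc : HasCompactSupport k) (hg : Sm g) (i : Fin 3) :
    pd i (cv k g) x = cv k (pd i g) x := by
  obtain ⟨G, sG, cG, e1, e2⟩ := exists_cv_cutoff hc hg x
  have : cv k G = cv G k := funext fun _ => cv_comm
  rw [pd_congr_of_eventuallyEq e1, e2, this, pd_cv sG cG hk.locallyIntegrable, cv_comm]

theorem integrable_cv (hk : Continuous k) (hc : HasCompactSupport k) (hg : LocallyIntegrable g)
    (x : E3) : Integrable fun y => k (x - y) * g y := by
  have := hc.convolutionExists_right (ContinuousLinearMap.mul ℝ ℝ) hg hk x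
  refine this.congr (Eventually.of_forall fun y => ?_)
  exact mul_comm _ _

theorem continuous_cv (hk : Continuous k) (hc : HasCompactSupport k) (hg : LocallyIntegrable g) :
    Continuous (cv k g) := by
  rw [cv_eq_convolution]
  exact hc.continuous_convolution_right _ hg hk

theorem cv_add_left (hk : Continuous k) (hc : HasCompactSupport k) (hl : Continuous l)
    (hcl : HasCompactSupport l) (hg : LocallyIntegrable g) :
    cv (fun y => k y + l y) g x = cv k g x + cv l g x := by
  rw [cv, cv, cv, ← integral_add (integrable_cv hk hc hg x) (integrable_cv hl hcl hg x)]
  simp only [add_mul]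

theorem cv_sub_left (hk : Continuous k) (hc : HasCompactSupport k) (hl : Continuous l)
    (hcl : HasCompactSupport l) (hg : LocallyIntegrable g) :
    cv (fun y => k y - l y) g x = cv k g x - cv l g x := by
  rw [cv, cv, cv, ← integral_sub (integrable_cv hk hc hg x) (integrable_cv hl hcl hg x)]
  simp only [sub_mul]

theorem cv_add_right (hk : Continuous k) (hc : HasCompactSupport k) (hg : LocallyIntegrable g)
    (hh : LocallyIntegrable h) : cv k (fun y => g y + h y) x = cv k g x + cv k h x := by
  rw [cv, cv, cv, ← integral_add (integrable_cv hk hc hg x) (integrable_cv hk hc hh x)]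
  simp only [mul_add]

theorem cv_sum_left {ι : Type*} (t : Finset ι) {k : ι → E3 → ℝ} (hk : ∀ i, Continuous (k i))
    (hc : ∀ i, HasCompactSupport (k i)) (hg : LocallyIntegrable g) :
    cv (fun y => ∑ i ∈ t, k i y) g x = ∑ i ∈ t, cv (k i) g x := by
  simp only [cv]
  rw [← integral_finsetSum _ fun i _ => integrable_cv (hk i) (hc i) hg x]
  simp only [Finset.sum_mul]

theorem cv_sum_right {ι : Type*} (t : Finset ι) {g : ι → E3 → ℝ} (hk : Continuous k)
    (hc : HasCompactSupport k) (hg : ∀ i, LocallyIntegrable (g i)) :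
    cv k (fun y => ∑ i ∈ t, g i y) x = ∑ i ∈ t, cv k (g i) x := by
  simp only [cv]
  rw [← integral_finsetSum _ fun i _ => integrable_cv hk hc (hg i) x]
  simp only [Finset.mul_sum]

theorem abs_cv_le (hk : Continuous k) (hc : HasCompactSupport k) {M : ℝ} (hM : ∀ y, |g y| ≤ M) :
    |cv k g x| ≤ (∫ y, |k y|) * M := by
  have hi : Integrable fun y => |k (x - y)| * M :=
    ((hk.integrable_of_hasCompactSupport hc).comp_sub_left x).abs.mul_const M
  calc |cv k g x| ≤ ∫ y, |k (x - y)| * M := by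
        rw [cv, ← norm_eq_abs]
        refine norm_integral_le_of_norm_le hi (Eventually.of_forall fun y => ?_)
        rw [norm_mul, norm_eq_abs, norm_eq_abs]
        exact mul_le_mul_of_nonneg_left (hM y) (abs_nonneg _)
    _ = _ := by rw [integral_mul_const, integral_sub_left_eq_self (fun y => |k y|) volume x]

/-- Moving a derivative from the function onto the kernel. -/
theorem cv_pd (hk : Sm k) (hc : HasCompactSupport k) (hg : Sm g) (i : Fin 3) :
    cv k (pd i g) x = cv (pd i k) g x := by
  rw [← pd_cv_right hk.cont hc hg, pd_cv hk hc hg.cont.locallyIntegrable]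

theorem cv_eq_zero_of_norm {a b : ℝ} (hk : ∀ y, a ≤ ‖y‖ → k y = 0) (hg : ∀ y, b ≤ ‖y‖ → g y = 0)
    (hx : a + b ≤ ‖x‖) : cv k g x = 0 := by
  refine integral_eq_zero_of_ae (Eventually.of_forall fun y => ?_)
  rcases lt_or_ge ‖y‖ b with hy | hy
  · have : a ≤ ‖x - y‖ := by have := norm_sub_norm_le x y; linarith
    simp [hk _ this]
  · simp [hg _ hy]

end Convolution

/-- Bounded measurable functions with bounded support. -/
structure Tame (g : E3 → ℝ) : Prop where
  meas : Measurable g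
  bdd : ∃ M, ∀ x, |g x| ≤ M
  supp : ∃ R, ∀ x, R ≤ ‖x‖ → g x = 0

section Tame

variable {g h k : E3 → ℝ}

theorem Tame.integrable (hg : Tame g) : Integrable g := by
  obtain ⟨M, hM⟩ := hg.bdd
  obtain ⟨R, hR⟩ := hg.supp
  have h1 : IntegrableOn g (ball3 R) :=
    Measure.integrableOn_of_bounded (M := M) measure_ball_lt_top.ne hg.meas.aestronglyMeasurable
      (ae_of_all _ hM)
  refine (integrableOn_iff_integrable_of_support_subset fun x hx => ?_).1 h1
  by_contra hn
  exact hx (hR x (by simpa [mem_ball3] using hn))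

theorem Tame.loc (hg : Tame g) : LocallyIntegrable g := hg.integrable.locallyIntegrable

theorem Tame.abs_rpow (hg : Tame g) {p : ℝ} (hp : 0 < p) : Tame fun x => |g x| ^ p := by
  obtain ⟨M, hM⟩ := hg.bdd
  obtain ⟨R, hR⟩ := hg.supp
  refine ⟨hg.meas.abs.pow_const p, ⟨M ^ p, fun x => ?_⟩, R, fun x hx => ?_⟩
  · rw [abs_of_nonneg (by positivity)]
    exact rpow_le_rpow (abs_nonneg _) (hM x) hp.le
  · rw [hR x hx, abs_zero, zero_rpow hp.ne']

theorem Tame.sq (hg : Tame g) : Tame fun x => g x ^ 2 := by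
  have := hg.abs_rpow two_pos
  simpa using this

theorem Tame.indicator (hg : Tame g) {S : Set E3} (hS : MeasurableSet S) : Tame (S.indicator g) := by
  obtain ⟨M, hM⟩ := hg.bdd
  obtain ⟨R, hR⟩ := hg.supp
  refine ⟨hg.meas.indicator hS, ⟨M, fun x => ?_⟩, R, fun x hx => ?_⟩
  · rw [← norm_eq_abs]
    exact (norm_indicator_le_norm_self g x).trans (hM x)
  · by_cases hx' : x ∈ S <;> simp [hx', hR x hx]

theorem Continuous.tame (hg : Continuous g) (hc : HasCompactSupport g) : Tame g := by
  obtain ⟨M, hM⟩ := hg.bounded_above_of_compact_support hc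
  obtain ⟨a, -, ha⟩ := hc.exists_norm
  exact ⟨hg.measurable, ⟨M, hM⟩, a, ha⟩

theorem Continuous.tame_ball (hg : Continuous g) (r : ℝ) : Tame ((ball3 r).indicator g) := by
  obtain ⟨M, hM⟩ := (isCompact_closedBall (0 : E3) r).exists_bound_of_continuousOn hg.continuousOn
  refine ⟨hg.measurable.indicator measurableSet_ball3, ⟨max M 0, fun x => ?_⟩, r, fun x hx => ?_⟩
  · by_cases hx : x ∈ ball3 r
    · rw [Set.indicator_of_mem hx]
      exact (hM x (ball_subset_closedBall hx)).trans (le_max_left _ _)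
    · rw [Set.indicator_of_notMem hx, abs_zero]; exact le_max_right _ _
  · exact Set.indicator_of_notMem (by simpa [mem_ball3] using hx) _

theorem tame_cv (hk : Continuous k) (hc : HasCompactSupport k) (hg : Tame g) : Tame (cv k g) := by
  obtain ⟨a, -, ha⟩ := hc.exists_norm
  obtain ⟨b, hb⟩ := hg.supp
  refine (continuous_cv hk hc hg.loc).tame (hasCompactSupport_of_norm (b := a + b) fun x hx => ?_)
  exact cv_eq_zero_of_norm ha hb hx

theorem hasCompactSupport_cv (hc : HasCompactSupport k) (hg : Tame g) : HasCompactSupport (cv k g) := by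
  obtain ⟨a, -, ha⟩ := hc.exists_norm
  obtain ⟨b, hb⟩ := hg.supp
  exact hasCompactSupport_of_norm (b := a + b) fun x hx => cv_eq_zero_of_norm ha hb hx

theorem integral_cv (hk : Integrable k) (hg : Integrable g) :
    ∫ x, cv k g x = (∫ x, k x) * ∫ x, g x := by
  rw [cv_eq_convolution, integral_convolution _ hg hk]
  exact mul_comm _ _

/-- Young's inequality for convolution with an integrable kernel. -/
theorem young {s : ℝ} (hs : 1 ≤ s) (hk : Continuous k) (hc : HasCompactSupport k) (hg : Tame g) :
    ∫ x, |cv k g x| ^ s ≤ (∫ x, |k x|) ^ s * ∫ x, |g x| ^ s := by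
  have hs0 : 0 < s := by linarith
  have hgs := hg.abs_rpow hs0
  have hk1 : Integrable fun x => |k x| := (hk.integrable_of_hasCompactSupport hc).abs
  have hN : 0 ≤ ∫ x, |k x| := integral_nonneg fun x => abs_nonneg _
  have hca : HasCompactSupport fun x => |k x| := hc.abs
  have pt : ∀ x, |cv k g x| ^ s ≤ (∫ x, |k x|) ^ (s - 1) * cv (fun x => |k x|) (fun x => |g x| ^ s) x := by
    intro x
    have i1 : Integrable fun y => |k (x - y)| := hk1.comp_sub_left x
    have i2 : Integrable fun y => |k (x - y)| * |g y| ^ s := integrable_cv hk.abs hca hgs.loc x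
    have h := holder_two (f := fun y => |k (x - y)|) (g := fun y => |k (x - y)| * |g y| ^ s)
      (p := 1 - 1 / s) (q := 1 / s) (fun y => abs_nonneg _) (fun y => by positivity) i1 i2
      (sub_nonneg.2 ((div_le_one hs0).2 hs)) (by positivity) (by ring)
    have e : ∀ y, |k (x - y)| ^ (1 - 1 / s) * (|k (x - y)| * |g y| ^ s) ^ (1 / s) =
        |k (x - y) * g y| := fun y => by
      rw [mul_rpow (abs_nonneg _) (by positivity), ← rpow_mul (abs_nonneg _),
        mul_one_div_cancel hs0.ne', rpow_one, ← mul_assoc, abs_mul]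
      rcases (abs_nonneg (k (x - y))).eq_or_lt with h0 | h0
      · rw [← h0, zero_rpow (one_div_pos.2 hs0).ne']; simp
      · rw [← rpow_add h0]; simp
    have h2 : |cv k g x| ≤ (∫ x, |k x|) ^ (1 - 1 / s) *
        (cv (fun x => |k x|) (fun x => |g x| ^ s) x) ^ (1 / s) := by
      refine (abs_integral_le_integral_abs).trans ?_
      have h3 := h.2
      simp only [e] at h3
      rwa [integral_sub_left_eq_self (fun y => |k y|) volume x] at h3
    have h0 : 0 ≤ cv (fun x => |k x|) (fun x => |g x| ^ s) x :=
      integral_nonneg fun y => by positivity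
    calc _ ≤ _ := rpow_le_rpow (abs_nonneg _) h2 hs0.le
      _ = _ := by
        rw [mul_rpow (by positivity) (by positivity), ← rpow_mul hN, ← rpow_mul h0,
          one_div_mul_cancel hs0.ne', rpow_one]
        congr 2; field_simp
  have t1 := (tame_cv hk hc hg).abs_rpow hs0
  have t2 := tame_cv hk.abs hca hgs
  calc ∫ x, |cv k g x| ^ s
      ≤ ∫ x, (∫ x, |k x|) ^ (s - 1) * cv (fun x => |k x|) (fun x => |g x| ^ s) x :=
        integral_mono t1.integrable (t2.integrable.const_mul _) pt
    _ = (∫ x, |k x|) ^ (s - 1) * ((∫ x, |k x|) * ∫ x, |g x| ^ s) := by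
        rw [integral_const_mul, integral_cv hk1 hgs.integrable]
    _ = _ := by
        rw [← mul_assoc]
        congr 1
        rcases hN.eq_or_lt with h0 | h0
        · rw [← h0, zero_rpow hs0.ne', mul_zero]
        · rw [rpow_sub_one h0.ne']; field_simp

theorem young_sq (hk : Continuous k) (hc : HasCompactSupport k) (hg : Tame g) :
    ∫ x, cv k g x ^ 2 ≤ (∫ x, |k x|) ^ 2 * ∫ x, g x ^ 2 := by
  have := young one_le_two hk hc hg
  simpa using this

theorem lintegral_tame (hg : Tame g) (h0 : ∀ x, 0 ≤ g x) :
    ∫⁻ x, ENNReal.ofReal (g x) = ENNReal.ofReal (∫ x, g x) :=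
  (ofReal_integral_eq_lintegral_ofReal hg.integrable (ae_of_all _ h0)).symm

/-- The weak-type estimate behind the interpolation of `cv k` between `L²` and `L^∞`. -/
theorem measure_cv_gt_le (hk : Continuous k) (hc : HasCompactSupport k) {A M t : ℝ} (hA : 0 ≤ A)
    (hM : 0 < M) (ht : 0 < t) (hkM : ∫ x, |k x| ≤ M)
    (h2 : ∀ g, Tame g → ∫ x, cv k g x ^ 2 ≤ A * ∫ x, g x ^ 2) (hg : Tame g) :
    volume {x | t < |cv k g x|} ≤ ENNReal.ofReal (4 * A * t ^ (-2 : ℝ)) *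
      volume.withDensity (fun x => ENNReal.ofReal (g x ^ 2)) {x | t < 2 * M * |g x|} := by
  set S : Set E3 := {x | t < 2 * M * |g x|} with hS
  have mS : MeasurableSet S := measurableSet_lt measurable_const (hg.meas.abs.const_mul _)
  have hb := hg.indicator mS
  have hl := hg.indicator mS.compl
  have e : ∀ x, cv k g x = cv k (S.indicator g) x + cv k (Sᶜ.indicator g) x := fun x => by
    rw [← cv_add_right hk hc hb.loc hl.loc]
    congr 1; funext y
    exact (Set.indicator_self_add_compl_apply S g y).symm
  have hsmall : ∀ x, |cv k (Sᶜ.indicator g) x| ≤ t / 2 := fun x => by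
    refine (abs_cv_le hk hc (M := t / (2 * M)) fun y => ?_).trans ?_
    · by_cases hy : y ∈ S
      · rw [Set.indicator_of_notMem (by simpa using hy), abs_zero]; positivity
      · rw [Set.indicator_of_mem (by simpa using hy), le_div_iff₀ (by positivity), mul_comm]
        exact not_lt.1 hy
    · calc _ ≤ M * (t / (2 * M)) := by gcongr
        _ = t / 2 := by field_simp
  have hsub : {x | t < |cv k g x|} ⊆
      {x | ENNReal.ofReal ((t / 2) ^ 2) ≤ ENNReal.ofReal (cv k (S.indicator g) x ^ 2)} := fun x hx => by
    have hx : t < |cv k g x| := hx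
    refine ENNReal.ofReal_le_ofReal ?_
    rw [← sq_abs (cv k _ x)]
    refine pow_le_pow_left₀ (by positivity) ?_ 2
    rw [e] at hx
    linarith [hsmall x, abs_add_le (cv k (S.indicator g) x) (cv k (Sᶜ.indicator g) x)]
  have hm := mul_meas_ge_le_lintegral₀ (μ := volume)
    (f := fun x => ENNReal.ofReal (cv k (S.indicator g) x ^ 2))
    ((tame_cv hk hc hb).sq.meas.ennreal_ofReal.aemeasurable) (ENNReal.ofReal ((t / 2) ^ 2))
  have hν : volume.withDensity (fun x => ENNReal.ofReal (g x ^ 2)) S =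
      ENNReal.ofReal (∫ x, S.indicator g x ^ 2) := by
    rw [withDensity_apply _ mS, ← lintegral_tame hb.sq (fun x => sq_nonneg _), ← lintegral_indicator mS]
    congr 1; funext x
    by_cases hx : x ∈ S <;> simp [hx]
  rw [lintegral_tame (tame_cv hk hc hb).sq fun x => sq_nonneg _] at hm
  have hm2 := hm.trans (ENNReal.ofReal_le_ofReal (h2 _ hb))
  rw [hν]
  have e2 : ENNReal.ofReal (4 * A * t ^ (-2 : ℝ)) * ENNReal.ofReal (∫ x, S.indicator g x ^ 2) =
      ENNReal.ofReal (A * ∫ x, S.indicator g x ^ 2) / ENNReal.ofReal ((t / 2) ^ 2) := by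
    rw [← ENNReal.ofReal_div_of_pos (by positivity), ← ENNReal.ofReal_mul (by positivity)]
    congr 1
    rw [rpow_neg ht.le, rpow_two]; field_simp; ring
  rw [e2, ENNReal.le_div_iff_mul_le (Or.inl (by simpa using ht.ne')) (Or.inl ENNReal.ofReal_ne_top),
    mul_comm]
  exact (mul_le_mul_right (measure_mono hsub) _).trans hm2

/-- Interpolation of convolution operators between `L²` and `L^∞`. -/
theorem integral_cv_rpow_le (hk : Continuous k) (hc : HasCompactSupport k) {A M s : ℝ} (hA : 0 ≤ A)
    (hM : 0 < M) (hs : 2 < s) (hkM : ∫ x, |k x| ≤ M)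
    (h2 : ∀ g, Tame g → ∫ x, cv k g x ^ 2 ≤ A * ∫ x, g x ^ 2) (hg : Tame g) :
    (s - 2) * ∫ x, |cv k g x| ^ s ≤ s * (4 * A) * (2 * M) ^ (s - 2) * ∫ x, |g x| ^ s := by
  have hs0 : 0 < s := by linarith
  have hs2 : 0 < s - 2 := by linarith
  set ν := (volume : Measure E3).withDensity fun x => ENNReal.ofReal (g x ^ 2) with hν
  have mg : Measurable fun x => 2 * M * |g x| := hg.meas.abs.const_mul _
  have T1 := (tame_cv hk hc hg).abs_rpow hs0
  have L1 := lintegral_rpow_eq_lintegral_meas_lt_mul volume (f := fun x => |cv k g x|)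
    (ae_of_all _ fun x => abs_nonneg _) (tame_cv hk hc hg).meas.abs.aemeasurable hs0
  have L2 := lintegral_rpow_eq_lintegral_meas_lt_mul ν (f := fun x => 2 * M * |g x|)
    (ae_of_all _ fun x => by positivity) mg.aemeasurable hs2
  have L3 : ∫⁻ x, ENNReal.ofReal ((2 * M * |g x|) ^ (s - 2)) ∂ν =
      ENNReal.ofReal ((2 * M) ^ (s - 2) * ∫ x, |g x| ^ s) := by
    rw [hν, lintegral_withDensity_eq_lintegral_mul _ hg.sq.meas.ennreal_ofReal
      (mg.pow_const _).ennreal_ofReal, ENNReal.ofReal_mul (by positivity),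
      ← lintegral_tame (hg.abs_rpow hs0) (fun x => by positivity),
      ← lintegral_const_mul _ (hg.abs_rpow hs0).meas.ennreal_ofReal]
    refine lintegral_congr fun x => ?_
    simp only [Pi.mul_apply]
    rw [← ENNReal.ofReal_mul (sq_nonneg _), ← ENNReal.ofReal_mul (by positivity),
      mul_rpow (by positivity) (abs_nonneg _)]
    congr 1
    rcases (abs_nonneg (g x)).eq_or_lt with h0 | h0
    · rw [← sq_abs, ← h0, zero_rpow hs2.ne', zero_rpow hs0.ne']; ring
    · rw [rpow_sub h0, rpow_two, ← sq_abs]; field_simp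
  have L4 : ∫⁻ t in Set.Ioi 0, volume {x | t < |cv k g x|} * ENNReal.ofReal (t ^ (s - 1)) ≤
      ENNReal.ofReal (4 * A) *
        ∫⁻ t in Set.Ioi 0, ν {x | t < 2 * M * |g x|} * ENNReal.ofReal (t ^ (s - 2 - 1)) := by
    rw [← lintegral_const_mul' _ _ ENNReal.ofReal_ne_top]
    refine setLIntegral_mono' measurableSet_Ioi fun t ht => ?_
    have ht : 0 < t := ht
    calc _ ≤ ENNReal.ofReal (4 * A * t ^ (-2 : ℝ)) * ν {x | t < 2 * M * |g x|} *
          ENNReal.ofReal (t ^ (s - 1)) := by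
          gcongr; exact measure_cv_gt_le hk hc hA hM ht hkM h2 hg
      _ = ENNReal.ofReal (4 * A) * (ENNReal.ofReal (t ^ (-2 : ℝ)) * ENNReal.ofReal (t ^ (s - 1))) *
          ν {x | t < 2 * M * |g x|} := by
          rw [ENNReal.ofReal_mul (by positivity)]; ring
      _ = _ := by
          rw [← ENNReal.ofReal_mul (by positivity), ← rpow_add ht,
            show -2 + (s - 1) = s - 2 - 1 by ring]; ring
  rw [lintegral_tame T1 fun x => by positivity] at L1
  have L5 : ENNReal.ofReal ((s - 2) * ∫ x, |cv k g x| ^ s) ≤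
      ENNReal.ofReal (s * (4 * A) * (2 * M) ^ (s - 2) * ∫ x, |g x| ^ s) := by
    rw [ENNReal.ofReal_mul hs2.le, L1, mul_assoc (s * (4 * A)),
      ENNReal.ofReal_mul (by positivity), ← L3, L2, ENNReal.ofReal_mul hs0.le]
    calc _ ≤ ENNReal.ofReal (s - 2) * (ENNReal.ofReal s * (ENNReal.ofReal (4 * A) *
          ∫⁻ t in Set.Ioi 0, ν {x | t < 2 * M * |g x|} * ENNReal.ofReal (t ^ (s - 2 - 1)))) := by
          gcongr
      _ = _ := by ring
  refine (ENNReal.ofReal_le_ofReal_iff ?_).1 L5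
  have : 0 ≤ ∫ x, |g x| ^ s := integral_nonneg fun x => by positivity
  positivity

end Tame

section Dilation

variable {f : E3 → ℝ} {c : ℝ}

theorem Sm.dil (hf : Sm f) (c : ℝ) : Sm fun x => f (c • x) := hf.comp (contDiff_const_smul c)

theorem pd_dil (hf : Sm f) (c : ℝ) (m : Fin 3) (x : E3) :
    pd m (fun x => f (c • x)) x = c * pd m f (c • x) := by
  have h : HasFDerivAt (fun x : E3 => c • x) (c • ContinuousLinearMap.id ℝ E3) x :=
    (hasFDerivAt_id x).const_smul c
  have h2 := (hf.diffAt (x := c • x)).hasFDerivAt.comp x h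
  rw [pd, show (fun x => f (c • x)) = f ∘ fun x => c • x from rfl, h2.fderiv]
  simp [pd]

theorem integral_dil (f : E3 → ℝ) (hc : 0 < c) : ∫ x, f (c⁻¹ • x) = c ^ 3 * ∫ x, f x := by
  rw [Measure.integral_comp_smul, finrank_euclideanSpace, Fintype.card_fin, smul_eq_mul, inv_pow,
    inv_inv, abs_of_pos (by positivity)]

theorem norm_inv_smul_ge {a : ℝ} (hc : 0 < c) {x : E3} (hx : a * c ≤ ‖x‖) : a ≤ ‖c⁻¹ • x‖ := by
  rw [norm_smul, norm_inv, norm_of_nonneg hc.le, inv_mul_eq_div, le_div_iff₀ hc]; exact hx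

end Dilation

/-- The mollifier at scale `lam`. -/
def moll (η : E3 → ℝ) (lam : ℝ) (x : E3) : ℝ := (lam ^ 3)⁻¹ * η (lam⁻¹ • x)

/-- The component `q j` of the kernel at scale `lam`. -/
def scaleKer (q : Fin 3 → E3 → ℝ) (lam : ℝ) (j : Fin 3) (x : E3) : ℝ :=
  (lam ^ 2)⁻¹ * q j (lam⁻¹ • x)

/-- The sum of the kernels over the scales `ε, 2ε, …, 2^(n-1) ε`. -/
def sumKer (q : Fin 3 → E3 → ℝ) (ε : ℝ) (n : ℕ) (j : Fin 3) (x : E3) : ℝ :=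
  ∑ i ∈ Finset.range n, scaleKer q (2 ^ i * ε) j x

namespace IsDyadicKernel

variable {q : Fin 3 → E3 → ℝ} {η g : E3 → ℝ} {lam ε : ℝ} {n : ℕ} {j m : Fin 3} {x : E3}

theorem sm_moll (h : IsDyadicKernel q η) (lam : ℝ) : Sm (moll η lam) :=
  contDiff_const.mul (h.smooth_eta.dil _)

theorem moll_zero (h : IsDyadicKernel q η) (hl : 0 < lam) (hx : 3 * lam ≤ ‖x‖) :
    moll η lam x = 0 := by rw [moll, h.eta_zero _ (norm_inv_smul_ge hl hx), mul_zero]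

theorem moll_compact (h : IsDyadicKernel q η) (hl : 0 < lam) : HasCompactSupport (moll η lam) :=
  hasCompactSupport_of_norm fun _ hx => h.moll_zero hl hx

theorem moll_nonneg (h : IsDyadicKernel q η) (hl : 0 < lam) (x : E3) : 0 ≤ moll η lam x :=
  mul_nonneg (by positivity) (h.eta_nonneg _)

theorem integral_moll (h : IsDyadicKernel q η) (hl : 0 < lam) : ∫ x, moll η lam x = 1 := by
  simp only [moll]
  rw [integral_const_mul, integral_dil _ hl, h.eta_int, mul_one, inv_mul_cancel₀ (by positivity)]

theorem integral_abs_moll (h : IsDyadicKernel q η) (hl : 0 < lam) : ∫ x, |moll η lam x| = 1 := by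
  simp only [abs_of_nonneg (h.moll_nonneg hl _), h.integral_moll hl]

theorem pd_moll (h : IsDyadicKernel q η) (lam : ℝ) (m : Fin 3) (x : E3) :
    pd m (moll η lam) x = (lam ^ 3)⁻¹ * (lam⁻¹ * pd m η (lam⁻¹ • x)) := by
  unfold moll
  rw [pd_const_mul _ (h.smooth_eta.dil _).diffAt, pd_dil h.smooth_eta]

theorem pd_pd_moll (h : IsDyadicKernel q η) (lam : ℝ) (l m : Fin 3) (x : E3) :
    pd l (pd m (moll η lam)) x = (lam ^ 3)⁻¹ * (lam⁻¹ * (lam⁻¹ * pd l (pd m η) (lam⁻¹ • x))) := by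
  rw [show pd m (moll η lam) = fun x => (lam ^ 3)⁻¹ * (lam⁻¹ * pd m η (lam⁻¹ • x)) from
    funext (h.pd_moll lam m)]
  have s1 : Sm fun x => pd m η (lam⁻¹ • x) := (h.smooth_eta.pd m).dil _
  rw [pd_const_mul _ (Sm.diffAt (contDiff_const.mul s1)), pd_const_mul _ s1.diffAt,
    pd_dil (h.smooth_eta.pd m)]

theorem sm_scaleKer (h : IsDyadicKernel q η) (lam : ℝ) (j : Fin 3) : Sm (scaleKer q lam j) :=
  contDiff_const.mul ((h.smooth_q j).dil _)

theorem scaleKer_zero (h : IsDyadicKernel q η) (hl : 0 < lam) (hx : 3 * lam ≤ ‖x‖) :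
    scaleKer q lam j x = 0 := by rw [scaleKer, h.q_zero _ _ (norm_inv_smul_ge hl hx), mul_zero]

theorem pd_scaleKer (h : IsDyadicKernel q η) (lam : ℝ) (j m : Fin 3) (x : E3) :
    pd m (scaleKer q lam j) x = (lam ^ 3)⁻¹ * pd m (q j) (lam⁻¹ • x) := by
  unfold scaleKer
  rw [pd_const_mul _ ((h.smooth_q j).dil _).diffAt, pd_dil (h.smooth_q j), ← mul_assoc, ← mul_inv]
  ring

theorem div_scaleKer (h : IsDyadicKernel q η) (x : E3) :
    ∑ j, pd j (scaleKer q lam j) x = moll η lam x - moll η (2 * lam) x := by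
  simp only [h.pd_scaleKer]
  rw [← Finset.mul_sum, h.div, moll, moll, smul_smul, ← mul_inv, mul_pow]
  rw [show (2 ^ 3 * lam ^ 3 : ℝ)⁻¹ = (lam ^ 3)⁻¹ / 8 by rw [mul_inv]; ring]
  ring

theorem sm_sumKer (h : IsDyadicKernel q η) (ε : ℝ) (n : ℕ) (j : Fin 3) : Sm (sumKer q ε n j) :=
  ContDiff.sum fun _ _ => h.sm_scaleKer _ j

theorem sumKer_zero (h : IsDyadicKernel q η) (hε : 0 < ε) (hx : 3 * (2 ^ n * ε) ≤ ‖x‖) :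
    sumKer q ε n j x = 0 := by
  refine Finset.sum_eq_zero fun i hi => h.scaleKer_zero (by positivity) (le_trans ?_ hx)
  have : (2 : ℝ) ^ i ≤ 2 ^ n := pow_le_pow_right₀ one_le_two (Finset.mem_range.1 hi).le
  gcongr

theorem sumKer_compact (h : IsDyadicKernel q η) (hε : 0 < ε) (n : ℕ) (j : Fin 3) :
    HasCompactSupport (sumKer q ε n j) := hasCompactSupport_of_norm fun _ hx => h.sumKer_zero hε hx

theorem pd_sumKer (h : IsDyadicKernel q η) (ε : ℝ) (n : ℕ) (j m : Fin 3) (x : E3) :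
    pd m (sumKer q ε n j) x = ∑ i ∈ Finset.range n, pd m (scaleKer q (2 ^ i * ε) j) x := by
  unfold sumKer
  exact pd_sum _ (F := fun i => scaleKer q (2 ^ i * ε) j) fun i _ => (h.sm_scaleKer _ j).diffAt

theorem curl_sumKer (h : IsDyadicKernel q η) (ε : ℝ) (n : ℕ) (j m : Fin 3) (x : E3) :
    pd m (sumKer q ε n j) x = pd j (sumKer q ε n m) x := by
  simp only [h.pd_sumKer, h.pd_scaleKer, h.curl m j]

theorem div_sumKer (h : IsDyadicKernel q η) (ε : ℝ) (n : ℕ) (x : E3) :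
    ∑ j, pd j (sumKer q ε n j) x = moll η ε x - moll η (2 ^ n * ε) x := by
  simp only [h.pd_sumKer]
  rw [Finset.sum_comm]
  simp only [h.div_scaleKer]
  have := Finset.sum_range_sub' (fun i : ℕ => moll η (2 ^ i * ε) x) n
  simp only [pow_succ, pow_zero, one_mul] at this
  rw [← this]
  refine Finset.sum_congr rfl fun i _ => ?_
  rw [← mul_assoc, mul_comm 2]

theorem sumKer_add (ε : ℝ) (n k : ℕ) (j : Fin 3) (x : E3) :
    sumKer q ε (n + k) j x = sumKer q ε n j x + sumKer q (2 ^ n * ε) k j x := by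
  rw [sumKer, Finset.sum_range_add, sumKer, sumKer]
  congr 1
  refine Finset.sum_congr rfl fun i _ => ?_
  rw [pow_add]; congr 1; ring

/-- Uniform bounds for a dyadic kernel. -/
theorem exists_bound (h : IsDyadicKernel q η) : ∃ A : ℝ, 1 ≤ A ∧ (∀ m j, ∫ x, |pd m (q j) x| ≤ A) ∧
    (∀ j, ∫ x, |q j x| ≤ A) ∧ (∀ m x, |pd m η x| ≤ A) ∧ ∀ l m x, |pd l (pd m η) x| ≤ A := by
  have cη : HasCompactSupport η := hasCompactSupport_of_norm h.eta_zero
  choose a ha using fun m => (h.smooth_eta.pd m).cont.bounded_above_of_compact_support (cη.pd m)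
  choose b hb using fun l m =>
    ((h.smooth_eta.pd m).pd l).cont.bounded_above_of_compact_support ((cη.pd m).pd l)
  have ha0 : ∀ m, 0 ≤ a m := fun m => (norm_nonneg _).trans (ha m 0)
  have hb0 : ∀ l m, 0 ≤ b l m := fun l m => (norm_nonneg _).trans (hb l m 0)
  have i1 : ∀ m j, 0 ≤ ∫ x, |pd m (q j) x| := fun m j => integral_nonneg fun x => abs_nonneg _
  have i2 : ∀ j, 0 ≤ ∫ x, |q j x| := fun j => integral_nonneg fun x => abs_nonneg _
  set S1 := ∑ m, ∑ j, ∫ x, |pd m (q j) x| with hS1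
  set S2 := ∑ j, ∫ x, |q j x| with hS2
  set S3 := ∑ m, a m with hS3
  set S4 := ∑ l, ∑ m, b l m with hS4
  have h1 : 0 ≤ S1 := Finset.sum_nonneg fun m _ => Finset.sum_nonneg fun j _ => i1 m j
  have h2 : 0 ≤ S2 := Finset.sum_nonneg fun j _ => i2 j
  have h3 : 0 ≤ S3 := Finset.sum_nonneg fun j _ => ha0 j
  have h4 : 0 ≤ S4 := Finset.sum_nonneg fun m _ => Finset.sum_nonneg fun j _ => hb0 m j
  have two : ∀ (F : Fin 3 → Fin 3 → ℝ), (∀ i j, 0 ≤ F i j) → ∀ i j, F i j ≤ ∑ i, ∑ j, F i j :=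
    fun F hF i j => (Finset.single_le_sum (f := fun j => F i j) (fun j _ => hF i j)
      (Finset.mem_univ j)).trans (Finset.single_le_sum (f := fun i => ∑ j, F i j)
        (fun i _ => Finset.sum_nonneg fun j _ => hF i j) (Finset.mem_univ i))
  refine ⟨1 + S1 + S2 + S3 + S4, by linarith, fun m j => ?_, fun j => ?_, fun m x => ?_,
    fun l m x => ?_⟩
  · have := two _ i1 m j; linarith
  · have := Finset.single_le_sum (f := fun j => ∫ x, |q j x|) (fun j _ => i2 j) (Finset.mem_univ j)
    linarith
  · have := Finset.single_le_sum (f := a) (fun j _ => ha0 j) (Finset.mem_univ m)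
    have := ha m x
    rw [norm_eq_abs] at this; linarith
  · have := two _ hb0 l m
    have := hb l m x
    rw [norm_eq_abs] at this; linarith

theorem integral_abs_sumKer_le (h : IsDyadicKernel q η) {A : ℝ} (hA : ∀ j, ∫ x, |q j x| ≤ A)
    (hε : 0 < ε) (n : ℕ) (j : Fin 3) : ∫ x, |sumKer q ε n j x| ≤ 2 ^ n * ε * A := by
  have hA0 : 0 ≤ A := (integral_nonneg fun x => abs_nonneg _).trans (hA j)
  have hi : ∀ i, Integrable fun x => |scaleKer q (2 ^ i * ε) j x| := fun i =>
    ((h.sm_scaleKer _ j).integrable (hasCompactSupport_of_norm fun _ hx =>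
      h.scaleKer_zero (by positivity) hx)).abs
  calc _ ≤ ∫ x, ∑ i ∈ Finset.range n, |scaleKer q (2 ^ i * ε) j x| :=
        integral_mono ((h.sm_sumKer ε n j).integrable (h.sumKer_compact hε n j)).abs
          (integrable_finsetSum _ fun i _ => hi i) fun x => Finset.abs_sum_le_sum_abs _ _
    _ = ∑ i ∈ Finset.range n, ∫ x, |scaleKer q (2 ^ i * ε) j x| :=
        integral_finsetSum _ fun i _ => hi i
    _ ≤ ∑ i ∈ Finset.range n, 2 ^ i * (ε * A) := by
        refine Finset.sum_le_sum fun i _ => ?_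
        have hl : 0 < 2 ^ i * ε := by positivity
        simp only [scaleKer, abs_mul]
        rw [integral_const_mul, integral_dil (fun x => |q j x|) hl, abs_of_nonneg (by positivity),
          ← mul_assoc, show ((2 ^ i * ε) ^ 2)⁻¹ * (2 ^ i * ε) ^ 3 = 2 ^ i * ε by field_simp, mul_assoc]
        gcongr; exact hA j
    _ ≤ _ := by
        rw [← Finset.sum_mul, mul_assoc]
        gcongr
        have := geom_sum_eq (x := (2 : ℝ)) (by norm_num) n
        rw [this]; norm_num

theorem integral_abs_pd_sumKer_le (h : IsDyadicKernel q η) {A : ℝ}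
    (hA : ∀ m j, ∫ x, |pd m (q j) x| ≤ A) (hε : 0 < ε) (n : ℕ) (j m : Fin 3) :
    ∫ x, |pd m (sumKer q ε n j) x| ≤ n * A := by
  have hi : ∀ i, Integrable fun x => |pd m (scaleKer q (2 ^ i * ε) j) x| := fun i =>
    (((h.sm_scaleKer _ j).pd m).integrable (HasCompactSupport.pd (hasCompactSupport_of_norm fun _ hx =>
      h.scaleKer_zero (by positivity) hx) m)).abs
  calc _ ≤ ∫ x, ∑ i ∈ Finset.range n, |pd m (scaleKer q (2 ^ i * ε) j) x| :=
        integral_mono (((h.sm_sumKer ε n j).pd m).integrable ((h.sumKer_compact hε n j).pd m)).abs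
          (integrable_finsetSum _ fun i _ => hi i) fun x => by
            simp only [h.pd_sumKer]; exact Finset.abs_sum_le_sum_abs _ _
    _ = ∑ i ∈ Finset.range n, ∫ x, |pd m (scaleKer q (2 ^ i * ε) j) x| :=
        integral_finsetSum _ fun i _ => hi i
    _ ≤ ∑ i ∈ Finset.range n, A := by
        refine Finset.sum_le_sum fun i _ => ?_
        have hl : 0 < 2 ^ i * ε := by positivity
        simp only [h.pd_scaleKer, abs_mul]
        rw [integral_const_mul, integral_dil (fun x => |pd m (q j) x|) hl,
          abs_of_nonneg (by positivity), ← mul_assoc, inv_mul_cancel₀ (by positivity), one_mul]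
        exact hA m j
    _ = _ := by simp

/-- The second-order operators built from the dyadic kernels are bounded on `L²`, uniformly in the
number of scales. -/
theorem integral_sq_cv_pd_sumKer_le (h : IsDyadicKernel q η) (hε : 0 < ε) (n : ℕ) (j m : Fin 3)
    (hg : Tame g) : ∫ x, cv (pd m (sumKer q ε n j)) g x ^ 2 ≤ 4 * ∫ x, g x ^ 2 := by
  set V : Fin 3 → E3 → ℝ := fun j => cv (sumKer q ε n j) g with hV
  have sV : ∀ j, Sm (V j) := fun j => (h.sm_sumKer ε n j).cv (h.sumKer_compact hε n j) hg.loc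
  have cV : ∀ j, HasCompactSupport (V j) := fun j => hasCompactSupport_cv (h.sumKer_compact hε n j) hg
  have eV : ∀ m j x, pd m (V j) x = cv (pd m (sumKer q ε n j)) g x := fun m j x =>
    pd_cv (h.sm_sumKer ε n j) (h.sumKer_compact hε n j) hg.loc m
  have curlV : ∀ m j x, pd m (V j) x = pd j (V m) x := fun m j x => by
    rw [eV, eV, show pd m (sumKer q ε n j) = pd j (sumKer q ε n m) from
      funext (h.curl_sumKer ε n j m)]
  have e2 : 0 < 2 ^ n * ε := by positivity
  have divV : ∀ x, ∑ j, pd j (V j) x = cv (moll η ε) g x - cv (moll η (2 ^ n * ε)) g x := fun x => by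
    simp only [eV]
    rw [← cv_sum_left _ (fun j => ((h.sm_sumKer ε n j).pd j).cont)
      (fun j => (h.sumKer_compact hε n j).pd j) hg.loc,
      ← cv_sub_left (h.sm_moll ε).cont (h.moll_compact hε) (h.sm_moll _).cont (h.moll_compact e2)
        hg.loc]
    congr 1; funext y; exact h.div_sumKer ε n y
  have swap : ∀ m j, ∫ x, pd m (V j) x ^ 2 = ∫ x, pd m (V m) x * pd j (V j) x := fun m j => by
    have h1 := integral_parts (sV j) ((sV m).pd j) (cV j) m
    have h2 := integral_parts (sV j) ((sV m).pd m) (cV j) j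
    have h3 : ∀ x, pd m (pd j (V m)) x = pd j (pd m (V m)) x := fun x => pd_comm (sV m) m j x
    simp only [h3] at h1
    calc _ = ∫ x, pd m (V j) x * pd j (V m) x := by
          congr 1; funext x; rw [sq, curlV m j]
      _ = ∫ x, pd j (V j) x * pd m (V m) x := by linarith
      _ = _ := by congr 1; funext x; ring
  have i1 : ∀ m j, Integrable fun x => pd m (V m) x * pd j (V j) x := fun m j =>
    Sm.integrable (ContDiff.mul ((sV m).pd m) ((sV j).pd j)) (((cV m).pd m).mul_right)
  have i2 : ∀ m j, 0 ≤ ∫ x, pd m (V j) x ^ 2 := fun m j => integral_nonneg fun x => sq_nonneg _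
  have t1 := tame_cv (h.sm_moll ε).cont (h.moll_compact hε) hg
  have t2 := tame_cv (h.sm_moll (2 ^ n * ε)).cont (h.moll_compact e2) hg
  have y1 := young_sq (h.sm_moll ε).cont (h.moll_compact hε) hg
  have y2 := young_sq (h.sm_moll (2 ^ n * ε)).cont (h.moll_compact e2) hg
  rw [h.integral_abs_moll hε, one_pow, one_mul] at y1
  rw [h.integral_abs_moll e2, one_pow, one_mul] at y2
  calc _ = ∫ x, pd m (V j) x ^ 2 := by simp only [eV]
    _ ≤ ∑ m, ∑ j, ∫ x, pd m (V j) x ^ 2 :=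
        (Finset.single_le_sum (f := fun j => ∫ x, pd m (V j) x ^ 2) (fun j _ => i2 m j)
          (Finset.mem_univ j)).trans (Finset.single_le_sum
            (f := fun m => ∑ j, ∫ x, pd m (V j) x ^ 2)
            (fun i _ => Finset.sum_nonneg fun j _ => i2 i j) (Finset.mem_univ m))
    _ = ∫ x, (cv (moll η ε) g x - cv (moll η (2 ^ n * ε)) g x) ^ 2 := by
        simp only [swap, ← divV]
        rw [show (fun x => (∑ j, pd j (V j) x) ^ 2) =
          fun x => ∑ m, ∑ j, pd m (V m) x * pd j (V j) x from
            funext fun x => by rw [sq, Finset.sum_mul_sum]]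
        rw [integral_finsetSum _ fun m _ => integrable_finsetSum _ fun j _ => i1 m j]
        exact Finset.sum_congr rfl fun m _ => (integral_finsetSum _ fun j _ => i1 m j).symm
    _ ≤ ∫ x, (2 * cv (moll η ε) g x ^ 2 + 2 * cv (moll η (2 ^ n * ε)) g x ^ 2) := by
        refine integral_mono_of_nonneg (ae_of_all _ fun x => sq_nonneg _)
          ((t1.sq.integrable.const_mul 2).add (t2.sq.integrable.const_mul 2))
          (ae_of_all _ fun x => ?_)
        nlinarith [sq_nonneg (cv (moll η ε) g x + cv (moll η (2 ^ n * ε)) g x)]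
    _ = 2 * (∫ x, cv (moll η ε) g x ^ 2) + 2 * ∫ x, cv (moll η (2 ^ n * ε)) g x ^ 2 := by
        rw [integral_add (t1.sq.integrable.const_mul 2) (t2.sq.integrable.const_mul 2),
          integral_const_mul, integral_const_mul]
    _ ≤ _ := by linarith

end IsDyadicKernel

section Homotopy

variable {g : E3 → ℝ}

/-- Weighted average of `g` along the segment from the origin to `x`. -/
def ray (k : ℕ) (g : E3 → ℝ) (x : E3) : ℝ := ∫ t in (0 : ℝ)..1, t ^ k * g (t • x)

theorem continuous_ray (hg : Continuous g) (k : ℕ) : Continuous (ray k g) := by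
  unfold ray
  apply intervalIntegral.continuous_parametric_intervalIntegral_of_continuous'
  fun_prop

theorem hasFDerivAt_ray (hg : Sm g) (k : ℕ) (x : E3) :
    HasFDerivAt (ray k g) (∫ t in (0 : ℝ)..1, t ^ (k + 1) • fderiv ℝ g (t • x)) x := by
  have hc : Continuous (fderiv ℝ g) := hg.continuous_fderiv (by simp)
  obtain ⟨M, hM⟩ := ((isCompact_closedBall (0 : E3) (‖x‖ + 1)).image hc).isBounded.exists_norm_le
  refine intervalIntegral.hasFDerivAt_integral_of_dominated_of_fderiv_le
    (F := fun x t => t ^ k * g (t • x)) (F' := fun x t => t ^ (k + 1) • fderiv ℝ g (t • x))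
    (bound := fun _ => M) (s := ball x 1) (ball_mem_nhds x one_pos) ?_ ?_ ?_ ?_ ?_ ?_
  · refine Eventually.of_forall fun y => Continuous.aestronglyMeasurable ?_
    have := hg.cont
    fun_prop
  · apply Continuous.intervalIntegrable
    have := hg.cont
    fun_prop
  · refine Continuous.aestronglyMeasurable ?_
    fun_prop
  · refine Eventually.of_forall fun t ht y hy => ?_
    rw [Set.uIoc_of_le zero_le_one] at ht
    have hy' : ‖y‖ ≤ ‖x‖ + 1 := by
      have := norm_sub_norm_le y x
      rw [mem_ball, dist_eq_norm] at hy
      linarith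
    have h1 : ‖fderiv ℝ g (t • y)‖ ≤ M := by
      refine hM _ ⟨t • y, ?_, rfl⟩
      rw [mem_closedBall_zero_iff, norm_smul, Real.norm_eq_abs, abs_of_pos ht.1]
      nlinarith [norm_nonneg y, ht.2]
    rw [norm_smul, norm_pow, Real.norm_eq_abs, abs_of_pos ht.1]
    have h2 : t ^ (k + 1) ≤ 1 := pow_le_one₀ ht.1.le ht.2
    have h3 : 0 ≤ t ^ (k + 1) := by have := ht.1.le; positivity
    nlinarith [norm_nonneg (fderiv ℝ g (t • y))]
  · exact intervalIntegrable_const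
  · refine Eventually.of_forall fun t _ y _ => ?_
    have h1 : HasFDerivAt (fun y : E3 => t • y) (t • ContinuousLinearMap.id ℝ E3) y :=
      (hasFDerivAt_id y).const_smul t
    have h2 := ((hg.diffAt (x := t • y)).hasFDerivAt.comp y h1).const_mul (t ^ k)
    refine h2.congr_fderiv ?_
    ext v
    simp [pow_succ, mul_assoc]

theorem pd_ray (hg : Sm g) (k : ℕ) (m : Fin 3) (x : E3) :
    pd m (ray k g) x = ray (k + 1) (pd m g) x := by
  have hc : Continuous (fderiv ℝ g) := hg.continuous_fderiv (by simp)
  rw [pd, (hasFDerivAt_ray hg k x).fderiv, ContinuousLinearMap.intervalIntegral_apply]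
  · rfl
  · apply Continuous.intervalIntegrable
    fun_prop

theorem fderiv_eq_sum_pd (f : E3 → ℝ) (x : E3) :
    fderiv ℝ f x = ∑ m, pd m f x • (EuclideanSpace.proj m : E3 →L[ℝ] ℝ) := by
  ext v
  have hv : v = ∑ i, v i • ee i := by
    ext j; fin_cases j <;> simp [Fin.sum_univ_three, ee]
  conv_lhs => rw [hv]
  simp [pd, ee, mul_comm]

theorem sm_ray (hg : Sm g) (k : ℕ) : Sm (ray k g) := by
  refine contDiff_infty.2 fun n => ?_
  induction n generalizing k g with
  | zero => exact contDiff_zero.2 (continuous_ray hg.cont k)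
  | succ n ih =>
    push_cast
    refine contDiff_succ_iff_fderiv.2 ⟨fun x => (hasFDerivAt_ray hg k x).differentiableAt,
      by simp, ?_⟩
    have : fderiv ℝ (ray k g) =
        fun x => ∑ m, ray (k + 1) (pd m g) x • (EuclideanSpace.proj m : E3 →L[ℝ] ℝ) := by
      funext x
      rw [fderiv_eq_sum_pd]
      simp_rw [pd_ray hg]
    rw [this]
    exact ContDiff.sum fun m _ => (ih (hg.pd m) _).smul contDiff_const

theorem abs_ray_le (k : ℕ) {x : E3} {M : ℝ} (hM : ∀ y, ‖y‖ ≤ ‖x‖ → |g y| ≤ M) :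
    |ray k g x| ≤ M := by
  have h : ∀ t ∈ Set.uIoc (0 : ℝ) 1, ‖t ^ k * g (t • x)‖ ≤ M := by
    intro t ht
    rw [Set.uIoc_of_le zero_le_one] at ht
    rw [norm_mul, norm_pow, Real.norm_eq_abs, abs_of_pos ht.1, Real.norm_eq_abs]
    have h1 := hM (t • x) (by
      rw [norm_smul, Real.norm_eq_abs, abs_of_pos ht.1]; nlinarith [norm_nonneg x, ht.2])
    have h2 : t ^ k ≤ 1 := pow_le_one₀ ht.1.le ht.2
    have h3 : 0 ≤ t ^ k := by have := ht.1.le; positivity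
    nlinarith [abs_nonneg (g (t • x))]
  simpa [ray] using intervalIntegral.norm_integral_le_of_norm_le_const h

theorem ray_sum {ι : Type*} (t : Finset ι) {G : ι → E3 → ℝ} (hG : ∀ i, Continuous (G i)) (k : ℕ)
    (x : E3) : ∑ i ∈ t, ray k (G i) x = ray k (fun y => ∑ i ∈ t, G i y) x := by
  unfold ray
  simp_rw [Finset.mul_sum]
  rw [intervalIntegral.integral_finsetSum]
  intro i _
  apply Continuous.intervalIntegrable
  have := hG i
  fun_prop

theorem ray_euler (hg : Sm g) (x : E3) :
    2 * ray 1 g x + ∑ j, x j * ray 2 (pd j g) x = g x := by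
  have hcg := hg.cont
  have hcp : ∀ j, Continuous (pd j g) := fun j => (hg.pd j).cont
  have hd : ∀ t : ℝ, HasDerivAt (fun t : ℝ => t ^ 2 * g (t • x))
      (2 * (t ^ 1 * g (t • x)) + ∑ j, x j * (t ^ 2 * pd j g (t • x))) t := by
    intro t
    have h1 : HasDerivAt (fun t : ℝ => t • x) x t := by
      simpa using (hasDerivAt_id t).smul_const x
    have h2 : HasDerivAt (fun t : ℝ => g (t • x)) (fderiv ℝ g (t • x) x) t :=
      (hg.diffAt (x := t • x)).hasFDerivAt.comp_hasDerivAt t h1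
    have h3 := (hasDerivAt_pow 2 t).fun_mul h2
    refine h3.congr_deriv ?_
    rw [fderiv_eq_sum_pd]
    simp [Finset.mul_sum]
    ring_nf
    congr 1
    refine Finset.sum_congr rfl fun j _ => by ring
  have hi := intervalIntegral.integral_eq_sub_of_hasDerivAt (a := 0) (b := 1) (fun t _ => hd t) (by
    apply Continuous.intervalIntegrable
    fun_prop)
  rw [intervalIntegral.integral_add, intervalIntegral.integral_const_mul,
    intervalIntegral.integral_finsetSum] at hi
  · simp_rw [intervalIntegral.integral_const_mul] at hi
    simpa [ray] using hi
  · intro j _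
    apply Continuous.intervalIntegrable
    fun_prop
  · apply Continuous.intervalIntegrable
    fun_prop
  · apply Continuous.intervalIntegrable
    fun_prop

/-- The Poincaré homotopy potential of a vector field. -/
def homPot (e : Fin 3 → E3 → ℝ) (j l : Fin 3) (x : E3) : ℝ :=
  x j * ray 1 (e l) x - x l * ray 1 (e j) x

variable {e : Fin 3 → E3 → ℝ}

theorem sm_homPot (he : ∀ l, Sm (e l)) (j l : Fin 3) : Sm (homPot e j l) :=
  ((sm_coord j).mul (sm_ray (he l) 1)).sub ((sm_coord l).mul (sm_ray (he j) 1))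

theorem pd_homPot (he : ∀ l, Sm (e l)) (j l m : Fin 3) (x : E3) :
    pd m (homPot e j l) x = (if j = m then ray 1 (e l) x else 0) + x j * ray 2 (pd m (e l)) x
      - ((if l = m then ray 1 (e j) x else 0) + x l * ray 2 (pd m (e j)) x) := by
  have h1 : ∀ i, DifferentiableAt ℝ (fun y : E3 => y i) x := fun i => (sm_coord i).diffAt
  have h2 : ∀ i, DifferentiableAt ℝ (ray 1 (e i)) x := fun i => (sm_ray (he i) 1).diffAt
  unfold homPot
  rw [pd_sub (f := fun y => y j * ray 1 (e l) y) (g := fun y => y l * ray 1 (e j) y)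
    ((h1 j).mul (h2 l)) ((h1 l).mul (h2 j)), pd_mul (h1 j) (h2 l), pd_mul (h1 l) (h2 j),
    pd_ray (he l), pd_ray (he j), pd_coord, pd_coord]
  split_ifs <;> simp

theorem div_homPot (he : ∀ l, Sm (e l)) (hdiv : ∀ x, ∑ l, pd l (e l) x = 0) (l : Fin 3) (x : E3) :
    ∑ j, pd j (homPot e j l) x = e l x := by
  have h0 : ∑ j, ray 2 (pd j (e j)) x = 0 := by
    rw [ray_sum _ fun j => ((he j).pd j).cont]
    simp_rw [hdiv]
    simp [ray]
  simp_rw [pd_homPot he]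
  rw [← ray_euler (he l) x]
  simp only [Finset.sum_sub_distrib, Finset.sum_add_distrib, ← Finset.mul_sum, h0]
  simp
  ring

theorem abs_homPot_le {x : E3} {M σ : ℝ} (hx : ‖x‖ ≤ σ) (hM : ∀ l y, ‖y‖ ≤ σ → |e l y| ≤ M)
    (j l : Fin 3) : |homPot e j l x| ≤ 2 * σ * M := by
  have h1 : ∀ l, |ray 1 (e l) x| ≤ M := fun l => abs_ray_le 1 fun y hy => hM l y (hy.trans hx)
  have h2 : ∀ i, |x i| ≤ σ := fun i => (coord_le x i).trans hx
  have h3 : ∀ i l, |x i * ray 1 (e l) x| ≤ σ * M := fun i l => by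
    rw [abs_mul]
    exact mul_le_mul (h2 i) (h1 l) (abs_nonneg _) ((abs_nonneg _).trans (h2 i))
  unfold homPot
  have := abs_sub (x j * ray 1 (e l) x) (x l * ray 1 (e j) x)
  linarith [h3 j l, h3 l j]

theorem abs_pd_homPot_le (he : ∀ l, Sm (e l)) {x : E3} {M M' σ : ℝ} (hx : ‖x‖ ≤ σ)
    (hM : ∀ l y, ‖y‖ ≤ σ → |e l y| ≤ M) (hM' : ∀ m l y, ‖y‖ ≤ σ → |pd m (e l) y| ≤ M')
    (j l m : Fin 3) : |pd m (homPot e j l) x| ≤ 2 * M + 2 * σ * M' := by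
  have hM0 : 0 ≤ M := (abs_nonneg _).trans (hM 0 x hx)
  have h1 : ∀ l, |ray 1 (e l) x| ≤ M := fun l => abs_ray_le 1 fun y hy => hM l y (hy.trans hx)
  have h1' : ∀ m l, |ray 2 (pd m (e l)) x| ≤ M' := fun m l =>
    abs_ray_le 2 fun y hy => hM' m l y (hy.trans hx)
  have h2 : ∀ i, |x i| ≤ σ := fun i => (coord_le x i).trans hx
  have h3 : ∀ i l, |x i * ray 2 (pd m (e l)) x| ≤ σ * M' := fun i l => by
    rw [abs_mul]
    exact mul_le_mul (h2 i) (h1' m l) (abs_nonneg _) ((abs_nonneg _).trans (h2 i))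
  have h4 : ∀ i l, |if i = m then ray 1 (e l) x else 0| ≤ M := fun i l => by
    split_ifs
    · exact h1 l
    · simpa using hM0
  rw [pd_homPot he]
  have a1 := abs_le.1 (h4 j l)
  have a2 := abs_le.1 (h4 l j)
  have a3 := abs_le.1 (h3 j l)
  have a4 := abs_le.1 (h3 l j)
  rw [abs_le]
  constructor <;> linarith

end Homotopy

section Local

variable {k g : E3 → ℝ} {σ a p : ℝ}

theorem integral_indicator_rpow (hp : 0 < p) (g : E3 → ℝ) (r : ℝ) :
    ∫ x, |(ball3 r).indicator g x| ^ p = ∫ x in ball3 r, |g x| ^ p := by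
  rw [← integral_indicator measurableSet_ball3]
  refine integral_congr_ae (Eventually.of_forall fun x => ?_)
  by_cases hx : x ∈ ball3 r <;> simp [hx, zero_rpow hp.ne']

theorem cv_indicator (hk : ∀ y, a ≤ ‖y‖ → k y = 0) {x : E3} (hx : x ∈ ball3 σ) :
    cv k g x = cv k ((ball3 (σ + a)).indicator g) x := by
  refine cv_congr_ball hk fun y hy => ?_
  rw [Set.indicator_of_mem]
  rw [mem_ball3] at hx ⊢
  have := norm_sub_norm_le y x
  linarith

theorem ballInt_cv_rpow_le (hp : 0 < p) (hk : Continuous k) (hc : HasCompactSupport k)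
    (h0 : ∀ y, a ≤ ‖y‖ → k y = 0) (hg : Continuous g) :
    ∫ x in ball3 σ, |cv k g x| ^ p ≤ ∫ x, |cv k ((ball3 (σ + a)).indicator g) x| ^ p := by
  rw [setIntegral_congr_fun (g := fun x => |cv k ((ball3 (σ + a)).indicator g) x| ^ p)
    measurableSet_ball3 fun x hx => congrArg (|·| ^ p) (cv_indicator h0 hx)]
  exact setIntegral_le_integral ((tame_cv hk hc (hg.tame_ball _)).abs_rpow hp).integrable
    (Eventually.of_forall fun x => rpow_nonneg (abs_nonneg _) _)

theorem ballInt_cv_sq_le (hk : Continuous k) (hc : HasCompactSupport k)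
    (h0 : ∀ y, a ≤ ‖y‖ → k y = 0) (hg : Continuous g) :
    ∫ x in ball3 σ, cv k g x ^ 2 ≤ ∫ x, cv k ((ball3 (σ + a)).indicator g) x ^ 2 := by
  simpa [rpow_two, sq_abs] using ballInt_cv_rpow_le two_pos hk hc h0 hg

theorem integral_indicator_sq (g : E3 → ℝ) (r : ℝ) :
    ∫ x, (ball3 r).indicator g x ^ 2 = ∫ x in ball3 r, g x ^ 2 := by
  simpa [rpow_two, sq_abs] using integral_indicator_rpow two_pos g r

theorem abs_cv_le_sup {M : ℝ} (hg : Integrable g) (hM : ∀ y, |k y| ≤ M) (x : E3) :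
    |cv k g x| ≤ M * ∫ y, |g y| := by
  rw [← integral_const_mul]
  refine (Real.norm_eq_abs (cv k g x)).symm.trans_le
    (norm_integral_le_of_norm_le (hg.abs.const_mul M) (Eventually.of_forall fun y => ?_))
  rw [norm_mul, Real.norm_eq_abs, Real.norm_eq_abs]
  exact mul_le_mul_of_nonneg_right (hM _) (abs_nonneg _)

theorem abs_cv_ball_le {M : ℝ} (hM : ∀ y, |k y| ≤ M) (h0 : ∀ y, a ≤ ‖y‖ → k y = 0)
    (hg : Continuous g) {x : E3} (hx : x ∈ ball3 σ) :
    |cv k g x| ≤ M * ∫ y in ball3 (σ + a), |g y| := by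
  rw [cv_indicator h0 hx]
  refine (abs_cv_le_sup (hg.tame_ball _).integrable hM x).trans (le_of_eq ?_)
  simpa using congrArg (M * ·) (integral_indicator_rpow one_pos g (σ + a))

theorem add_rpow_le_two_rpow (hp : 0 ≤ p) (x y : ℝ) :
    |x + y| ^ p ≤ 2 ^ p * (|x| ^ p + |y| ^ p) := by
  have h1 : |x + y| ≤ 2 * max |x| |y| := by
    have := abs_add_le x y
    have := le_max_left |x| |y|
    have := le_max_right |x| |y|
    linarith
  have h2 : (max |x| |y|) ^ p ≤ |x| ^ p + |y| ^ p := by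
    have := rpow_nonneg (abs_nonneg x) p
    have := rpow_nonneg (abs_nonneg y) p
    rcases max_cases |x| |y| with ⟨h, _⟩ | ⟨h, _⟩ <;> rw [h] <;> linarith
  calc |x + y| ^ p ≤ (2 * max |x| |y|) ^ p := rpow_le_rpow (abs_nonneg _) h1 hp
    _ = 2 ^ p * (max |x| |y|) ^ p := mul_rpow zero_le_two ((abs_nonneg x).trans (le_max_left _ _))
    _ ≤ _ := by gcongr

theorem ballInt_add_rpow_le (hp : 0 ≤ p) {f : E3 → ℝ} (hf : Continuous f) (hg : Continuous g) (r : ℝ) :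
    ∫ x in ball3 r, |f x + g x| ^ p ≤
      2 ^ p * ((∫ x in ball3 r, |f x| ^ p) + ∫ x in ball3 r, |g x| ^ p) := by
  have c1 : Continuous fun x => |f x| ^ p := hf.abs.rpow_const fun _ => Or.inr hp
  have c2 : Continuous fun x => |g x| ^ p := hg.abs.rpow_const fun _ => Or.inr hp
  have c3 : Continuous fun x => |f x + g x| ^ p := (hf.add hg).abs.rpow_const fun _ => Or.inr hp
  rw [← ballInt_add c1 c2, ← ballInt_const_mul]
  exact setIntegral_ball_mono c3 (continuous_const.mul (c1.add c2)) fun x _ =>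
    add_rpow_le_two_rpow hp _ _

theorem ballInt_sub_rpow_le (hp : 0 ≤ p) {f : E3 → ℝ} (hf : Continuous f) (hg : Continuous g) (r : ℝ) :
    ∫ x in ball3 r, |f x - g x| ^ p ≤
      2 ^ p * ((∫ x in ball3 r, |f x| ^ p) + ∫ x in ball3 r, |g x| ^ p) := by
  simpa [sub_eq_add_neg] using ballInt_add_rpow_le hp hf hg.neg r

theorem ballInt_sub_sq_le {f : E3 → ℝ} (hf : Continuous f) (hg : Continuous g) (r : ℝ) :
    ∫ x in ball3 r, (f x - g x) ^ 2 ≤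
      4 * ((∫ x in ball3 r, f x ^ 2) + ∫ x in ball3 r, g x ^ 2) := by
  have := ballInt_sub_rpow_le zero_le_two hf hg r
  norm_num [rpow_two, sq_abs] at this
  exact this

theorem ballInt_add_sq_le {f : E3 → ℝ} (hf : Continuous f) (hg : Continuous g) (r : ℝ) :
    ∫ x in ball3 r, (f x + g x) ^ 2 ≤
      4 * ((∫ x in ball3 r, f x ^ 2) + ∫ x in ball3 r, g x ^ 2) := by
  have := ballInt_add_rpow_le zero_le_two hf hg r
  norm_num [rpow_two, sq_abs] at this
  exact this

end Local

namespace IsDyadicKernel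

variable {q : Fin 3 → E3 → ℝ} {η g : E3 → ℝ}

/-- Mollification converges uniformly on balls. -/
theorem eventually_moll_close (h : IsDyadicKernel q η) (hg : Continuous g) (σ : ℝ) {τ : ℝ}
    (hτ : 0 < τ) : ∀ᶠ lam in 𝓝[>] (0 : ℝ), ∀ x, ‖x‖ ≤ σ → |g x - cv (moll η lam) g x| ≤ τ := by
  have huc : UniformContinuousOn g (closedBall (0 : E3) (σ + 3)) :=
    (isCompact_closedBall _ _).uniformContinuousOn_of_continuous hg.continuousOn
  obtain ⟨δ, hδ, hu⟩ := Metric.uniformContinuousOn_iff_le.1 huc τ hτ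
  have hm : 0 < min 1 (δ / 3) := by positivity
  filter_upwards [Ioo_mem_nhdsGT hm] with lam hlam x hx
  have hl : 0 < lam := hlam.1
  have hl1 : lam ≤ 1 := hlam.2.le.trans (min_le_left _ _)
  have hl2 : lam ≤ δ / 3 := hlam.2.le.trans (min_le_right _ _)
  have i1 : Integrable (moll η lam) := (h.sm_moll lam).integrable (h.moll_compact hl)
  have i2 : Integrable fun y => moll η lam y * g (x - y) :=
    ((h.sm_moll lam).cont.mul (hg.comp (by fun_prop))).integrable_of_hasCompactSupport
      (h.moll_compact hl).mul_right
  have e : g x - cv (moll η lam) g x = ∫ y, moll η lam y * (g x - g (x - y)) := by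
    have : ∀ y, moll η lam y * (g x - g (x - y)) = moll η lam y * g x - moll η lam y * g (x - y) :=
      fun y => by ring
    simp_rw [this]
    rw [integral_sub (i1.mul_const _) i2, integral_mul_const, h.integral_moll hl, cv_swap, one_mul]
  rw [e]
  calc |∫ y, moll η lam y * (g x - g (x - y))| ≤ ∫ y, moll η lam y * τ := by
        refine (Real.norm_eq_abs (∫ y, moll η lam y * (g x - g (x - y)))).symm.trans_le
          (norm_integral_le_of_norm_le (i1.mul_const τ) (Eventually.of_forall fun y => ?_))
        rw [norm_mul, Real.norm_eq_abs, abs_of_nonneg (h.moll_nonneg hl y)]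
        rcases lt_or_ge ‖y‖ (3 * lam) with hy | hy
        · refine mul_le_mul_of_nonneg_left ?_ (h.moll_nonneg hl y)
          rw [← dist_eq_norm]
          refine hu x ?_ (x - y) ?_ ?_
          · rw [mem_closedBall_zero_iff]; linarith
          · rw [mem_closedBall_zero_iff]
            have := norm_sub_le x y
            linarith
          · rw [dist_eq_norm, sub_sub_cancel]; linarith
        · rw [h.moll_zero hl hy]; simp
    _ = τ := by rw [integral_mul_const, h.integral_moll hl, one_mul]

end IsDyadicKernel

theorem pd_zero_outside {k : E3 → ℝ} {a b : ℝ} (hk : ∀ y, a ≤ ‖y‖ → k y = 0) (hab : a < b)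
    (i : Fin 3) (y : E3) (hy : b ≤ ‖y‖) : pd i k y = 0 := by
  have : k =ᶠ[𝓝 y] fun _ => 0 := by
    filter_upwards [(isOpen_lt continuous_const continuous_norm).mem_nhds
      (show a < ‖y‖ from hab.trans_le hy)] with z hz using hk z (le_of_lt hz)
  rw [pd_congr_of_eventuallyEq this, pd_const]

section

variable {s K : ℝ} {f : E3 → ℝ} {F : Fin 3 → E3 → ℝ}

theorem cv_hasPot (hf : HasPot s K f F) (c : Fin 3 → ℝ) {k : E3 → ℝ} (hk : Sm k)
    (hc : HasCompactSupport k) (x : E3) :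
    cv k f x = ∑ m, cv (pd m k) (fun y => F m y - c m) x := by
  have hG : ∀ m, Sm fun y => F m y - c m := fun m => (hf.smooth m).sub contDiff_const
  have e : f = fun x => ∑ m, pd m (fun y => F m y - c m) x := by
    funext x
    rw [hf.eq]
    refine Finset.sum_congr rfl fun m _ => ?_
    rw [pd_sub (hf.smooth m).diffAt (by fun_prop), pd_const, sub_zero]
  rw [e, cv_sum_right _ hk.cont hc fun m => ((hG m).pd m).cont.locallyIntegrable]
  exact Finset.sum_congr rfl fun m _ => cv_pd hk hc (hG m) m

end

namespace IsDyadicKernel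

variable {q : Fin 3 → E3 → ℝ} {η f : E3 → ℝ} {s K A r σ d : ℝ} {F : Fin 3 → E3 → ℝ}

theorem ballInt_near_le (h : IsDyadicKernel q η) (hs : 1 ≤ s) (hA : ∀ j, ∫ x, |q j x| ≤ A) {ε : ℝ}
    (hε : 0 < ε) (n : ℕ) (j : Fin 3) (hf : Continuous f) (hd : 3 * (2 ^ n * ε) ≤ d) :
    ∫ x in ball3 σ, |cv (sumKer q ε n j) f x| ^ s ≤
      (2 ^ n * ε * A) ^ s * ∫ x in ball3 (σ + d), |f x| ^ s := by
  have hs0 : 0 < s := by linarith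
  refine (ballInt_cv_rpow_le hs0 (h.sm_sumKer ε n j).cont (h.sumKer_compact hε n j)
    (a := d) (fun y hy => h.sumKer_zero hε (hd.trans hy)) hf).trans ?_
  refine (young hs (h.sm_sumKer ε n j).cont (h.sumKer_compact hε n j) (hf.tame_ball _)).trans ?_
  rw [integral_indicator_rpow hs0]
  refine mul_le_mul_of_nonneg_right (rpow_le_rpow (integral_nonneg fun x => abs_nonneg _)
    (h.integral_abs_sumKer_le hA hε n j) hs0.le)
    (setIntegral_ball_nonneg fun x _ => rpow_nonneg (abs_nonneg _) _)

theorem ballInt_grad_le (h : IsDyadicKernel q η) {ε : ℝ}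
    (hε : 0 < ε) (n : ℕ) (j m : Fin 3) (hf : Continuous f) (hd : 3 * (2 ^ n * ε) < d) :
    ∫ x in ball3 σ, pd m (cv (sumKer q ε n j) f) x ^ 2 ≤ 4 * ∫ x in ball3 (σ + d), f x ^ 2 := by
  have e : ∀ x, pd m (cv (sumKer q ε n j) f) x = cv (pd m (sumKer q ε n j)) f x := fun x =>
    pd_cv (h.sm_sumKer ε n j) (h.sumKer_compact hε n j) hf.locallyIntegrable m
  simp_rw [e]
  refine (ballInt_cv_sq_le ((h.sm_sumKer ε n j).pd m).cont ((h.sumKer_compact hε n j).pd m)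
    (pd_zero_outside (fun y hy => h.sumKer_zero hε hy) hd m) hf).trans ?_
  refine (h.integral_sq_cv_pd_sumKer_le hε n j m (hf.tame_ball _)).trans (le_of_eq ?_)
  rw [integral_indicator_sq]

theorem exists_mid_bound (h : IsDyadicKernel q η) (hs : 3 < s) (hK : 0 ≤ K) (hA1 : 1 ≤ A)
    (hA : ∀ m j, ∫ x, |pd m (q j) x| ≤ A) :
    ∃ C : ℝ, 0 ≤ C ∧ ∀ (f : E3 → ℝ) (F : Fin 3 → E3 → ℝ), HasPot s K f F →
      ∀ (r σ d ε : ℝ) (n : ℕ) (j : Fin 3), 1 < r → 0 < ε → 1 ≤ n → 3 * (2 ^ n * ε) < d → σ + d ≤ 2 * r →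
      ∫ x in ball3 σ, |cv (sumKer q ε n j) f x| ^ s ≤ C * (n : ℝ) ^ (s - 2) * r ^ (2 + s / 3) := by
  have hs0 : 0 < s := by linarith
  have hs2 : 0 < s - 2 := by linarith
  refine ⟨2 ^ s * (2 ^ s * 3) * ((s - 2)⁻¹ * (s * (4 * 4) * (2 * A) ^ (s - 2) * (K * 2 ^ (2 + s / 3)))),
    by positivity, fun f F hf r σ d ε n j hr hε hn hd hσ => ?_⟩
  have hn0 : (0 : ℝ) < n := by exact_mod_cast hn
  choose c hc using fun m => hf.osc m (2 * r) (by linarith)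
  set k := sumKer q ε n j with hk
  have sk : Sm k := h.sm_sumKer ε n j
  have ck : HasCompactSupport k := h.sumKer_compact hε n j
  have hG : ∀ m, Continuous fun y => F m y - c m := fun m => (hf.smooth m).cont.sub continuous_const
  have hcont : ∀ m, Continuous fun x => cv (pd m k) (fun y => F m y - c m) x := fun m =>
    continuous_cv (sk.pd m).cont (ck.pd m) (hG m).locallyIntegrable
  set X := (s - 2)⁻¹ * (s * (4 * 4) * (2 * A) ^ (s - 2) * (K * 2 ^ (2 + s / 3))) *
    (n : ℝ) ^ (s - 2) * r ^ (2 + s / 3) with hX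
  have hX0 : 0 ≤ X := by positivity
  have key : ∀ m, ∫ x in ball3 σ, |cv (pd m k) (fun y => F m y - c m) x| ^ s ≤ X := by
    intro m
    refine (ballInt_cv_rpow_le hs0 (sk.pd m).cont (ck.pd m)
      (pd_zero_outside (fun y hy => h.sumKer_zero hε hy) hd m) (hG m)).trans ?_
    have h1 := integral_cv_rpow_le (sk.pd m).cont (ck.pd m) (A := 4) (M := n * A) (s := s)
      (by norm_num) (by positivity) (by linarith) (h.integral_abs_pd_sumKer_le hA hε n j m)
      (fun g hg => h.integral_sq_cv_pd_sumKer_le hε n j m hg) ((hG m).tame_ball (σ + d))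
    rw [integral_indicator_rpow hs0] at h1
    have c1 : Continuous fun x => |F m x - c m| ^ s := (hG m).abs.rpow_const fun _ => Or.inr hs0.le
    have h2 : ∫ x in ball3 (σ + d), |F m x - c m| ^ s ≤ K * (2 * r) ^ (2 + s / 3) :=
      (setIntegral_ball_mono_set c1 (fun x => rpow_nonneg (abs_nonneg _) _) hσ).trans (hc m)
    have h3 := h1.trans (mul_le_mul_of_nonneg_left h2 (by positivity))
    rw [← le_inv_mul_iff₀ hs2] at h3
    refine h3.trans (le_of_eq ?_)
    rw [hX, show 2 * (n * A) = (2 * A) * (n : ℝ) by ring, mul_rpow (by positivity) hn0.le,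
      mul_rpow (x := 2) (y := r) two_pos.le (by linarith)]
    ring
  simp_rw [cv_hasPot hf c sk ck, Fin.sum_univ_three]
  refine (ballInt_add_rpow_le hs0.le ((hcont 0).add (hcont 1)) (hcont 2) σ).trans ?_
  have h5 := ballInt_add_rpow_le hs0.le (hcont 0) (hcont 1) σ
  have h2s : (1 : ℝ) ≤ 2 ^ s := one_le_rpow one_le_two hs0.le
  have h6 : (∫ x in ball3 σ, |cv (pd 0 k) (fun y => F 0 y - c 0) x +
      cv (pd 1 k) (fun y => F 1 y - c 1) x| ^ s) ≤ 2 ^ s * (X + X) :=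
    h5.trans (mul_le_mul_of_nonneg_left (add_le_add (key 0) (key 1)) (by positivity))
  have h7 := key 2
  calc _ ≤ 2 ^ s * (2 ^ s * (X + X) + X) :=
        mul_le_mul_of_nonneg_left (add_le_add h6 h7) (by positivity)
    _ ≤ 2 ^ s * (2 ^ s * 3) * X := by nlinarith [mul_nonneg (sub_nonneg.2 h2s) hX0, rpow_pos_of_pos two_pos s]
    _ = _ := by rw [hX]; ring

theorem abs_pd_moll_le (h : IsDyadicKernel q η) {lam : ℝ} (hl : 0 < lam)
    (hA : ∀ m x, |pd m η x| ≤ A) (m : Fin 3) (x : E3) : |pd m (moll η lam) x| ≤ A * (lam ^ 4)⁻¹ := by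
  rw [h.pd_moll, abs_mul, abs_mul, abs_of_pos (by positivity : 0 < (lam ^ 3)⁻¹),
    abs_of_pos (by positivity : 0 < lam⁻¹)]
  calc _ ≤ (lam ^ 3)⁻¹ * (lam⁻¹ * A) := by gcongr; exact hA _ _
    _ = _ := by field_simp

theorem abs_pd_pd_moll_le (h : IsDyadicKernel q η) {lam : ℝ} (hl : 0 < lam)
    (hA : ∀ l m x, |pd l (pd m η) x| ≤ A) (l m : Fin 3) (x : E3) :
    |pd l (pd m (moll η lam)) x| ≤ A * (lam ^ 5)⁻¹ := by
  rw [h.pd_pd_moll, abs_mul, abs_mul, abs_mul, abs_of_pos (by positivity : 0 < (lam ^ 3)⁻¹),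
    abs_of_pos (by positivity : 0 < lam⁻¹)]
  calc _ ≤ (lam ^ 3)⁻¹ * (lam⁻¹ * (lam⁻¹ * A)) := by gcongr; exact hA _ _ _
    _ = _ := by field_simp

theorem exists_far_bound (h : IsDyadicKernel q η) (hs : 3 < s) (hK : 0 ≤ K) (hA1 : 1 ≤ A)
    (hA : ∀ m x, |pd m η x| ≤ A) (hA' : ∀ l m x, |pd l (pd m η) x| ≤ A) :
    ∃ C : ℝ, 0 ≤ C ∧ ∀ (f : E3 → ℝ) (F : Fin 3 → E3 → ℝ), HasPot s K f F →
      ∀ (r σ d lam : ℝ), 1 < r → 0 < lam → 3 * lam < d → σ + d ≤ 2 * r → ∀ x ∈ ball3 σ,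
      |cv (moll η lam) f x| ≤ C * (lam ^ 4)⁻¹ * r ^ (10 / 3 - 1 / s) ∧
      ∀ m, |pd m (cv (moll η lam) f) x| ≤ C * (lam ^ 5)⁻¹ * r ^ (10 / 3 - 1 / s) := by
  have hs0 : 0 < s := by linarith
  refine ⟨3 * (A * (K ^ (1 / s) * (volume (ball3 1)).toReal ^ (1 - 1 / s) * 2 ^ (10 / 3 - 1 / s))),
    by positivity, fun f F hf r σ d lam hr hl hd hσ x hx => ?_⟩
  have hr0 : 0 < r := by linarith
  choose c hc using fun m => hf.osc m (2 * r) (by linarith)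
  set J := K ^ (1 / s) * (volume (ball3 1)).toReal ^ (1 - 1 / s) * 2 ^ (10 / 3 - 1 / s) *
    r ^ (10 / 3 - 1 / s) with hJ
  have hG : ∀ m, Continuous fun y => F m y - c m := fun m => (hf.smooth m).cont.sub continuous_const
  have hint : ∀ m, ∫ x in ball3 (σ + d), |F m x - c m| ≤ J := by
    intro m
    have h1 := power_mean_osc one_pos (by linarith) hK (by linarith) (hf.smooth m).cont (hc m)
    simp only [rpow_one] at h1
    refine (setIntegral_ball_mono_set (hG m).abs (fun x => abs_nonneg _) hσ).trans (h1.trans (le_of_eq ?_))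
    rw [hJ, show (3 : ℝ) + 1 / 3 - 1 / s = 10 / 3 - 1 / s by ring, mul_rpow two_pos.le hr0.le]
    ring
  have sk : Sm (moll η lam) := h.sm_moll lam
  have ck : HasCompactSupport (moll η lam) := h.moll_compact hl
  obtain ⟨d', hd1, hd2⟩ := exists_between hd
  have z1 : ∀ m y, d' ≤ ‖y‖ → pd m (moll η lam) y = 0 :=
    pd_zero_outside (fun y hy => h.moll_zero hl hy) hd1
  have z2 : ∀ m y, d ≤ ‖y‖ → pd m (moll η lam) y = 0 := fun m y hy => z1 m y (hd2.le.trans hy)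
  have z3 : ∀ l m y, d ≤ ‖y‖ → pd m (pd l (moll η lam)) y = 0 := fun l => pd_zero_outside (z1 l) hd2
  constructor
  · rw [cv_hasPot hf c sk ck]
    calc _ ≤ ∑ m, |cv (pd m (moll η lam)) (fun y => F m y - c m) x| := Finset.abs_sum_le_sum_abs _ _
      _ ≤ ∑ _m : Fin 3, A * (lam ^ 4)⁻¹ * J := by
          refine Finset.sum_le_sum fun m _ => ?_
          refine (abs_cv_ball_le (h.abs_pd_moll_le hl hA m) (z2 m) (hG m) hx).trans ?_
          gcongr
          exact hint m
      _ = _ := by simp [hJ]; ring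
  · intro l
    rw [pd_cv sk ck hf.sm.cont.locallyIntegrable, cv_hasPot hf c (sk.pd l) (ck.pd l)]
    calc _ ≤ ∑ m, |cv (pd m (pd l (moll η lam))) (fun y => F m y - c m) x| :=
          Finset.abs_sum_le_sum_abs _ _
      _ ≤ ∑ _m : Fin 3, A * (lam ^ 5)⁻¹ * J := by
          refine Finset.sum_le_sum fun m _ => ?_
          refine (abs_cv_ball_le (h.abs_pd_pd_moll_le hl hA' m l) (z3 l m) (hG m) hx).trans ?_
          gcongr
          exact hint m
      _ = _ := by simp [hJ]; ring

end IsDyadicKernel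

theorem ballInt_rpow_le_of_abs_le {f : E3 → ℝ} {p B σ r : ℝ} (hp : 0 < p) (hf : Continuous f)
    (hσ : σ ≤ 2 * r) (hr : 0 < r) (h : ∀ x ∈ ball3 σ, |f x| ≤ B) (hB : 0 ≤ B) :
    ∫ x in ball3 σ, |f x| ^ p ≤ 8 * (volume (ball3 1)).toReal * B ^ p * r ^ 3 := by
  calc ∫ x in ball3 σ, |f x| ^ p ≤ ∫ x in ball3 σ, B ^ p :=
        setIntegral_ball_mono (hf.abs.rpow_const fun _ => Or.inr hp.le) continuous_const
          fun x hx => rpow_le_rpow (abs_nonneg _) (h x (mem_ball3.2 hx)) hp.le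
    _ ≤ ∫ x in ball3 (2 * r), B ^ p :=
        setIntegral_ball_mono_set continuous_const (fun _ => rpow_nonneg hB _) hσ
    _ = _ := by
        rw [setIntegral_const, smul_eq_mul, measureReal_def, volume_ball3 (by positivity)]
        ring

namespace IsDyadicKernel

variable {q : Fin 3 → E3 → ℝ} {η : E3 → ℝ} {s K A : ℝ}

theorem exists_remainder_bound (h : IsDyadicKernel q η) (hs : 3 < s) (hs6 : s ≤ 6) (hK : 0 ≤ K)
    (hA1 : 1 ≤ A) (hA : ∀ m x, |pd m η x| ≤ A) (hA' : ∀ l m x, |pd l (pd m η) x| ≤ A) :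
    ∃ C : ℝ, 0 ≤ C ∧ ∀ (u : Fin 3 → E3 → ℝ) (F : Fin 3 → Fin 3 → E3 → ℝ),
      (∀ l, HasPot s K (u l) (F l)) → ∀ (r σ d tiny : ℝ), 1 < r → 0 < d → d ≤ r → σ + d ≤ 2 * r →
      0 < tiny →
      (∀ l x, ‖x‖ ≤ σ → |u l x - cv (moll η tiny) (u l) x| ≤ r ^ (-5 / 3 - 1 / s)) →
      (∀ m l x, ‖x‖ ≤ σ → |pd m (u l) x - cv (moll η tiny) (pd m (u l)) x| ≤ r ^ (-5 / 3 - 1 / s)) →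
      ∀ e : Fin 3 → E3 → ℝ,
      (∀ l, e l = fun x => u l x - cv (moll η tiny) (u l) x + cv (moll η (d / 4)) (u l) x) →
      (∀ j l, ∫ x in ball3 σ, |homPot e j l x| ^ s ≤ C * (r / d) ^ 24 * r ^ (2 + s / 3)) ∧
      ∀ m j l, ∫ x in ball3 σ, pd m (homPot e j l) x ^ 2 ≤
        C * ((r / d) ^ 10 * r ^ (5 / 3 - 2 / s)) := by
  have hs0 : 0 < s := by linarith
  obtain ⟨C₁, hC₁, hfar⟩ := h.exists_far_bound hs hK hA1 hA hA'
  set C₂ := 1024 * C₁ + 1 with hC₂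
  have hV := (volume_ball3_pos one_pos).le
  refine ⟨8 * (volume (ball3 1)).toReal * (4 * C₂) ^ s +
    8 * (volume (ball3 1)).toReal * (6 * C₂) ^ 2, by positivity, ?_⟩
  intro u F hu r σ d tiny hr hd hdr hσ ht a1 a2 e he
  have hr0 : 0 < r := by linarith
  have hq : 1 ≤ r / d := (one_le_div hd).2 hdr
  have hσr : σ ≤ 2 * r := by linarith
  have smt : ∀ l, Sm (cv (moll η tiny) (u l)) := fun l =>
    (h.sm_moll tiny).cv (h.moll_compact ht) (hu l).sm.cont.locallyIntegrable
  have smb : ∀ l, Sm (cv (moll η (d / 4)) (u l)) := fun l =>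
    (h.sm_moll _).cv (h.moll_compact (by positivity)) (hu l).sm.cont.locallyIntegrable
  have sme : ∀ l, Sm (e l) := fun l => by
    rw [he]; exact ((hu l).sm.sub (smt l)).add (smb l)
  have p1 : r ^ (10 / 3 - 1 / s) = r ^ 4 * r ^ (-2 / 3 - 1 / s) := by
    rw [← rpow_natCast r 4, ← rpow_add hr0]; congr 1; push_cast; ring
  have p2 : r ^ (10 / 3 - 1 / s) = r ^ 5 * r ^ (-5 / 3 - 1 / s) := by
    rw [← rpow_natCast r 5, ← rpow_add hr0]; congr 1; push_cast; ring
  have p3 : r ^ (-5 / 3 - 1 / s) ≤ r ^ (-2 / 3 - 1 / s) :=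
    rpow_le_rpow_of_exponent_le hr.le (by linarith)
  have p4 : r * r ^ (-5 / 3 - 1 / s) = r ^ (-2 / 3 - 1 / s) := by
    nth_rewrite 1 [← rpow_one r]
    rw [← rpow_add hr0]; congr 1; ring
  have p5 : r * r ^ (-2 / 3 - 1 / s) = r ^ (1 / 3 - 1 / s) := by
    nth_rewrite 1 [← rpow_one r]
    rw [← rpow_add hr0]; congr 1; ring
  set M := C₂ * (r / d) ^ 4 * r ^ (-2 / 3 - 1 / s) with hM
  set M' := C₂ * (r / d) ^ 5 * r ^ (-5 / 3 - 1 / s) with hM'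
  have q4 : 1 ≤ (r / d) ^ 4 := one_le_pow₀ hq
  have q5 : (r / d) ^ 4 ≤ (r / d) ^ 5 := pow_le_pow_right₀ hq (by norm_num)
  have g1 : ∀ x ∈ ball3 σ, ∀ l, |e l x| ≤ M := by
    intro x hx l
    have b1 := (hfar (u l) (F l) (hu l) r σ d (d / 4) hr (by positivity) (by linarith) hσ x hx).1
    have b2 := a1 l x (mem_ball3.1 hx).le
    rw [he]
    have b3 := abs_add_le (u l x - cv (moll η tiny) (u l) x) (cv (moll η (d / 4)) (u l) x)
    have b4 : C₁ * ((d / 4) ^ 4)⁻¹ * r ^ (10 / 3 - 1 / s) =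
        256 * C₁ * (r / d) ^ 4 * r ^ (-2 / 3 - 1 / s) := by rw [p1]; field_simp; norm_num
    have b5 : 0 ≤ r ^ (-2 / 3 - 1 / s) := by positivity
    have b6 : r ^ (-2 / 3 - 1 / s) ≤ (r / d) ^ 4 * r ^ (-2 / 3 - 1 / s) := le_mul_of_one_le_left b5 q4
    have b7 : M = 1024 * C₁ * (r / d) ^ 4 * r ^ (-2 / 3 - 1 / s) + (r / d) ^ 4 * r ^ (-2 / 3 - 1 / s) := by
      rw [hM, hC₂]; ring
    have b8 : 0 ≤ C₁ * (r / d) ^ 4 * r ^ (-2 / 3 - 1 / s) := by positivity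
    rw [b4] at b1
    calc _ ≤ _ := b3
      _ ≤ M := by rw [b7]; linarith
  have g2 : ∀ x ∈ ball3 σ, ∀ m l, |pd m (e l) x| ≤ M' := by
    intro x hx m l
    have b1 := (hfar (u l) (F l) (hu l) r σ d (d / 4) hr (by positivity) (by linarith) hσ x hx).2 m
    have b2 := a2 m l x (mem_ball3.1 hx).le
    have b0 : pd m (e l) x = pd m (u l) x - cv (moll η tiny) (pd m (u l)) x
        + pd m (cv (moll η (d / 4)) (u l)) x := by
      rw [he, pd_add (f := fun x => u l x - cv (moll η tiny) (u l) x)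
        (Sm.diffAt ((hu l).sm.sub (smt l))) (smb l).diffAt,
        pd_sub (hu l).sm.diffAt (smt l).diffAt,
        pd_cv_right (h.sm_moll tiny).cont (h.moll_compact ht) (hu l).sm]
    rw [b0]
    have b3 := abs_add_le (pd m (u l) x - cv (moll η tiny) (pd m (u l)) x)
      (pd m (cv (moll η (d / 4)) (u l)) x)
    have b4 : C₁ * ((d / 4) ^ 5)⁻¹ * r ^ (10 / 3 - 1 / s) =
        1024 * C₁ * (r / d) ^ 5 * r ^ (-5 / 3 - 1 / s) := by rw [p2]; field_simp; norm_num
    have b5 : 0 ≤ r ^ (-5 / 3 - 1 / s) := by positivity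
    have b6 : r ^ (-5 / 3 - 1 / s) ≤ (r / d) ^ 5 * r ^ (-5 / 3 - 1 / s) :=
      le_mul_of_one_le_left b5 (q4.trans q5)
    have b7 : M' = 1024 * C₁ * (r / d) ^ 5 * r ^ (-5 / 3 - 1 / s) + (r / d) ^ 5 * r ^ (-5 / 3 - 1 / s) := by
      rw [hM', hC₂]; ring
    rw [b4] at b1
    linarith
  have hM0 : 0 ≤ M := by positivity
  have hM'0 : 0 ≤ M' := by positivity
  have sub : ∀ x ∈ ball3 σ, ∀ y, ‖y‖ ≤ ‖x‖ → y ∈ ball3 σ := fun x hx y hy =>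
    mem_ball3.2 (hy.trans_lt (mem_ball3.1 hx))
  constructor
  · intro j l
    have c1 : ∀ x ∈ ball3 σ, |homPot e j l x| ≤ 4 * C₂ * ((r / d) ^ 4 * r ^ (1 / 3 - 1 / s)) := by
      intro x hx
      refine (abs_homPot_le le_rfl (fun l y hy => g1 y (sub x hx y hy) l) j l).trans ?_
      have hx' : ‖x‖ ≤ 2 * r := (mem_ball3.1 hx).le.trans hσr
      calc 2 * ‖x‖ * M ≤ 2 * (2 * r) * M := by gcongr
        _ = _ := by rw [hM, ← p5]; ring
    refine (ballInt_rpow_le_of_abs_le hs0 (sm_homPot sme j l).cont hσr hr0 c1 (by positivity)).trans ?_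
    rw [mul_rpow (x := 4 * C₂) (by positivity) (by positivity),
      mul_rpow (x := (r / d) ^ 4) (by positivity) (by positivity), ← rpow_mul hr0.le]
    have c2 : ((r / d) ^ 4) ^ s ≤ (r / d) ^ 24 := by
      refine (rpow_le_rpow_of_exponent_le q4 hs6).trans (le_of_eq ?_)
      rw [show (6 : ℝ) = ((6 : ℕ) : ℝ) by norm_num, rpow_natCast]; ring
    have c3 : r ^ ((1 / 3 - 1 / s) * s) * r ^ 3 = r ^ (2 + s / 3) := by
      rw [← rpow_natCast r 3, ← rpow_add hr0]; congr 1; field_simp; push_cast; ring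
    calc _ = 8 * (volume (ball3 1)).toReal * (4 * C₂) ^ s * ((r / d) ^ 4) ^ s *
          (r ^ ((1 / 3 - 1 / s) * s) * r ^ 3) := by ring
      _ ≤ (8 * (volume (ball3 1)).toReal * (4 * C₂) ^ s +
          8 * (volume (ball3 1)).toReal * (6 * C₂) ^ 2) * (r / d) ^ 24 * r ^ (2 + s / 3) := by
          rw [c3]; gcongr
          exact le_add_of_nonneg_right (by positivity)
  · intro m j l
    have c1 : ∀ x ∈ ball3 σ, |pd m (homPot e j l) x| ≤ 6 * C₂ * ((r / d) ^ 5 * r ^ (-2 / 3 - 1 / s)) := by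
      intro x hx
      refine (abs_pd_homPot_le sme le_rfl (fun l y hy => g1 y (sub x hx y hy) l)
        (fun m l y hy => g2 y (sub x hx y hy) m l) j l m).trans ?_
      have hx' : ‖x‖ ≤ 2 * r := (mem_ball3.1 hx).le.trans hσr
      calc 2 * M + 2 * ‖x‖ * M' ≤ 2 * M + 2 * (2 * r) * M' := by gcongr
        _ = 2 * M + 4 * C₂ * (r / d) ^ 5 * r ^ (-2 / 3 - 1 / s) := by rw [hM', ← p4]; ring
        _ ≤ 2 * (C₂ * (r / d) ^ 5 * r ^ (-2 / 3 - 1 / s)) + 4 * C₂ * (r / d) ^ 5 * r ^ (-2 / 3 - 1 / s) := by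
            rw [hM]; gcongr
        _ = _ := by ring
    have c2 := ballInt_rpow_le_of_abs_le two_pos ((sm_homPot sme j l).pd m).cont hσr hr0 c1
      (by positivity)
    simp only [rpow_two, sq_abs] at c2
    refine c2.trans ?_
    have c3 : (r ^ (-2 / 3 - 1 / s)) ^ 2 * r ^ 3 = r ^ (5 / 3 - 2 / s) := by
      rw [← rpow_natCast r 3, ← rpow_natCast, ← rpow_mul hr0.le, ← rpow_add hr0]
      congr 1; push_cast; ring
    calc _ = 8 * (volume (ball3 1)).toReal * (6 * C₂) ^ 2 * ((r / d) ^ 10 *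
          ((r ^ (-2 / 3 - 1 / s)) ^ 2 * r ^ 3)) := by ring
      _ ≤ _ := by
          rw [c3]; gcongr
          exact le_add_of_nonneg_left (by positivity)

end IsDyadicKernel

/-- A divergence free field with controlled potential is itself the divergence of an antisymmetric
matrix field, whose growth is controlled by that of the potential. -/
theorem exists_antisymm_potential {s K : ℝ} (hs : 3 < s) (hs6 : s ≤ 6) (hK : 0 ≤ K) :
    ∃ C : ℝ, 1 ≤ C ∧ ∀ (u : Fin 3 → E3 → ℝ) (F : Fin 3 → Fin 3 → E3 → ℝ),
      (∀ l, HasPot s K (u l) (F l)) → (∀ x, ∑ l, pd l (u l) x = 0) →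
      ∀ (r σ d Y : ℝ) (n : ℕ), 1 < r → 0 < d → d ≤ r → σ + d ≤ 2 * r → 1 ≤ n →
      (∀ l, ∫ x in ball3 (σ + d), u l x ^ 2 ≤ Y) →
      (∀ l, (d / 2 ^ n) ^ s * ∫ x in ball3 (σ + d), |u l x| ^ s ≤ r ^ (2 + s / 3)) →
      ∃ W : Fin 3 → Fin 3 → E3 → ℝ, (∀ j l, Sm (W j l)) ∧ (∀ j l x, W j l x = -W l j x) ∧
        (∀ l x, ∑ j, pd j (W j l) x = u l x) ∧
        (∀ j l, ∫ x in ball3 σ, |W j l x| ^ s ≤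
          C * (n : ℝ) ^ (s - 2) * (r / d) ^ 24 * r ^ (2 + s / 3)) ∧
        ∀ m j l, ∫ x in ball3 σ, pd m (W j l) x ^ 2 ≤
          C * (Y + (r / d) ^ 10 * r ^ (5 / 3 - 2 / s)) := by
  obtain ⟨q, η, h⟩ := exists_dyadicKernel
  obtain ⟨A, hA1, hA2, hA3, hA4, hA5⟩ := h.exists_bound
  obtain ⟨C₁, hC₁, hrem⟩ := h.exists_remainder_bound hs hs6 hK hA1 hA4 hA5
  obtain ⟨C₂, hC₂, hmid⟩ := h.exists_mid_bound hs hK hA1 hA2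
  have hs0 : 0 < s := by linarith
  set C₃ := 2 ^ s * (A ^ s + C₂) with hC₃
  set C₄ := 2 ^ s * (2 ^ s * (C₃ + C₃) + C₁) + (128 + 4 * C₁) + 1 with hC₄
  have hC₃0 : 0 ≤ C₃ := by positivity
  refine ⟨C₄, le_add_of_nonneg_left (by positivity), ?_⟩
  intro u F hu hdiv r σ d Y n hr hd hdr hσ hn hY hsmall
  have hr0 : 0 < r := by linarith
  have hq : 1 ≤ r / d := (one_le_div hd).2 hdr
  have hn1 : (1 : ℝ) ≤ n := by exact_mod_cast hn
  have hns : (1 : ℝ) ≤ (n : ℝ) ^ (s - 2) := one_le_rpow hn1 (by linarith)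
  have hY0 : 0 ≤ Y := (setIntegral_ball_nonneg fun x _ => sq_nonneg _).trans (hY 0)
  have lu : ∀ l, LocallyIntegrable (u l) := fun l => (hu l).sm.cont.locallyIntegrable
  set ε := d / 4 / 2 ^ n with hε
  have hε0 : 0 < ε := by positivity
  have hτ : 0 < r ^ (-5 / 3 - 1 / s) := by positivity
  obtain ⟨N, hN1, hN2⟩ : ∃ N : ℕ,
      (∀ l x, ‖x‖ ≤ σ → |u l x - cv (moll η (ε / 2 ^ N)) (u l) x| ≤ r ^ (-5 / 3 - 1 / s)) ∧
      ∀ m l x, ‖x‖ ≤ σ → |pd m (u l) x - cv (moll η (ε / 2 ^ N)) (pd m (u l)) x| ≤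
        r ^ (-5 / 3 - 1 / s) := by
    have t1 : Tendsto (fun N : ℕ => ε / 2 ^ N) atTop (𝓝[>] 0) := by
      refine tendsto_nhdsWithin_iff.2 ⟨?_, Eventually.of_forall fun N => by
        change 0 < ε / 2 ^ N; positivity⟩
      have := (tendsto_pow_atTop_nhds_zero_of_lt_one (r := (1 / 2 : ℝ)) (by norm_num)
        (by norm_num)).const_mul ε
      simpa [div_eq_mul_inv] using this
    have e1 := eventually_all.2 fun l => h.eventually_moll_close (hu l).sm.cont σ hτ
    have e2 := eventually_all.2 fun m => eventually_all.2 fun l =>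
      h.eventually_moll_close ((hu l).sm.pd m).cont σ hτ
    obtain ⟨N, hN⟩ := (t1.eventually (e1.and e2)).exists
    exact ⟨N, hN.1, hN.2⟩
  set t := ε / 2 ^ N with ht
  have ht0 : 0 < t := by positivity
  have et : 2 ^ N * t = ε := by rw [ht]; field_simp
  have eε : 2 ^ n * ε = d / 4 := by rw [hε]; field_simp
  have eT : 2 ^ (N + n) * t = d / 4 := by rw [pow_add, mul_right_comm, et, mul_comm, eε]
  set k := sumKer q t (N + n) with hk
  have sk : ∀ j, Sm (k j) := h.sm_sumKer t (N + n)
  have ck : ∀ j, HasCompactSupport (k j) := h.sumKer_compact ht0 (N + n)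
  have sV : ∀ j l, Sm (cv (k j) (u l)) := fun j l => (sk j).cv (ck j) (lu l)
  set e : Fin 3 → E3 → ℝ := fun l x =>
    u l x - cv (moll η t) (u l) x + cv (moll η (d / 4)) (u l) x with he
  have smt : ∀ l, Sm (cv (moll η t) (u l)) := fun l => (h.sm_moll t).cv (h.moll_compact ht0) (lu l)
  have hd4 : 0 < d / 4 := by positivity
  have smb : ∀ l, Sm (cv (moll η (d / 4)) (u l)) := fun l =>
    (h.sm_moll _).cv (h.moll_compact hd4) (lu l)
  have sme : ∀ l, Sm (e l) := fun l => ((hu l).sm.sub (smt l)).add (smb l)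
  have divcv : ∀ {m : E3 → ℝ}, Sm m → HasCompactSupport m → ∀ x, ∑ l, pd l (cv m (u l)) x = 0 := by
    intro m hm hcm x
    simp_rw [fun l => pd_cv_right hm.cont hcm (hu l).sm l (x := x)]
    rw [← cv_sum_right _ hm.cont hcm fun l => ((hu l).sm.pd l).cont.locallyIntegrable]
    simp [hdiv, cv]
  have dive : ∀ x, ∑ l, pd l (e l) x = 0 := by
    intro x
    have : ∀ l, pd l (e l) x = pd l (u l) x - pd l (cv (moll η t) (u l)) x
        + pd l (cv (moll η (d / 4)) (u l)) x := fun l => by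
      rw [he]
      rw [pd_add (f := fun x => u l x - cv (moll η t) (u l) x)
        (Sm.diffAt ((hu l).sm.sub (smt l))) (smb l).diffAt, pd_sub (hu l).sm.diffAt (smt l).diffAt]
    simp_rw [this]
    rw [Finset.sum_add_distrib, Finset.sum_sub_distrib, hdiv, divcv (h.sm_moll _) (h.moll_compact ht0),
      divcv (h.sm_moll _) (h.moll_compact hd4)]
    ring
  obtain ⟨hr1, hr2⟩ := hrem u F hu r σ d t hr hd hdr hσ ht0 hN1 hN2 e fun l => rfl
  have hV : ∀ j l, ∫ x in ball3 σ, |cv (k j) (u l) x| ^ s ≤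
      C₃ * ((n : ℝ) ^ (s - 2) * r ^ (2 + s / 3)) := by
    intro j l
    have ek : k j = fun x => sumKer q t N j x + sumKer q ε n j x := by
      funext x; rw [hk, IsDyadicKernel.sumKer_add, et]
    have e1 : ∀ x, cv (k j) (u l) x = cv (sumKer q t N j) (u l) x + cv (sumKer q ε n j) (u l) x :=
      fun x => by
        rw [ek, cv_add_left (h.sm_sumKer t N j).cont (h.sumKer_compact ht0 N j)
          (h.sm_sumKer ε n j).cont (h.sumKer_compact hε0 n j) (lu l)]
    simp_rw [e1]
    refine (ballInt_add_rpow_le hs0.le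
      ((h.sm_sumKer t N j).cv (h.sumKer_compact ht0 N j) (lu l)).cont
      ((h.sm_sumKer ε n j).cv (h.sumKer_compact hε0 n j) (lu l)).cont σ).trans ?_
    have n1 := h.ballInt_near_le (σ := σ) (d := d) (s := s) (by linarith) hA3 ht0 N j (hu l).sm.cont (by
      rw [et, hε]
      have : d / 4 / 2 ^ n ≤ d / 4 := div_le_self hd4.le (one_le_pow₀ one_le_two)
      linarith)
    rw [et, hε] at n1
    have n2 : (d / 4 / 2 ^ n * A) ^ s * ∫ x in ball3 (σ + d), |u l x| ^ s ≤ A ^ s * r ^ (2 + s / 3) := by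
      have : d / 4 / 2 ^ n * A ≤ A * (d / 2 ^ n) := by
        rw [mul_comm]; gcongr; linarith
      have i0 : 0 ≤ ∫ x in ball3 (σ + d), |u l x| ^ s :=
        setIntegral_ball_nonneg fun x _ => rpow_nonneg (abs_nonneg _) _
      calc _ ≤ (A * (d / 2 ^ n)) ^ s * ∫ x in ball3 (σ + d), |u l x| ^ s := by gcongr
        _ = A ^ s * ((d / 2 ^ n) ^ s * ∫ x in ball3 (σ + d), |u l x| ^ s) := by
            rw [mul_rpow (by linarith) (by positivity)]; ring
        _ ≤ _ := by gcongr; exact hsmall l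
    have n3 := hmid (u l) (F l) (hu l) r σ d ε n j hr hε0 hn (by rw [eε]; linarith) hσ
    have n4 : A ^ s * r ^ (2 + s / 3) ≤ A ^ s * ((n : ℝ) ^ (s - 2) * r ^ (2 + s / 3)) := by
      gcongr
      exact le_mul_of_one_le_left (by positivity) hns
    calc _ ≤ 2 ^ s * (A ^ s * ((n : ℝ) ^ (s - 2) * r ^ (2 + s / 3)) +
          C₂ * (n : ℝ) ^ (s - 2) * r ^ (2 + s / 3)) :=
          mul_le_mul_of_nonneg_left (add_le_add (n1.trans (n2.trans n4)) n3) (by positivity)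
      _ = _ := by rw [hC₃]; ring
  have hV' : ∀ m j l, ∫ x in ball3 σ, pd m (cv (k j) (u l)) x ^ 2 ≤ 4 * Y := by
    intro m j l
    refine (h.ballInt_grad_le ht0 (N + n) j m (hu l).sm.cont (d := d) (by rw [eT]; linarith)).trans ?_
    linarith [hY l]
  have sW : ∀ j l, Sm fun x => cv (k j) (u l) x - cv (k l) (u j) x := fun j l => (sV j l).sub (sV l j)
  refine ⟨fun j l x => cv (k j) (u l) x - cv (k l) (u j) x + homPot e j l x,
    fun j l => (sW j l).add (sm_homPot sme j l), fun j l x => by simp only [homPot]; ring, ?_, ?_, ?_⟩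
  · intro l x
    have e1 : ∀ j, pd j (fun x => cv (k j) (u l) x - cv (k l) (u j) x + homPot e j l x) x =
        cv (pd j (k j)) (u l) x - pd j (cv (k l) (u j)) x + pd j (homPot e j l) x := fun j => by
      rw [pd_add (sW j l).diffAt (sm_homPot sme j l).diffAt, pd_sub (sV j l).diffAt (sV l j).diffAt,
        pd_cv (sk j) (ck j) (lu l)]
    simp_rw [e1]
    rw [Finset.sum_add_distrib, Finset.sum_sub_distrib, divcv (sk l) (ck l), div_homPot sme dive,
      ← cv_sum_left _ (fun j => ((sk j).pd j).cont) (fun j => (ck j).pd j) (lu l)]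
    simp_rw [hk, h.div_sumKer, eT]
    rw [cv_sub_left (h.sm_moll _).cont (h.moll_compact ht0) (h.sm_moll _).cont (h.moll_compact hd4) (lu l),
      he]
    ring
  · intro j l
    refine (ballInt_add_rpow_le hs0.le (sW j l).cont (sm_homPot sme j l).cont σ).trans ?_
    have n1 := ballInt_sub_rpow_le hs0.le (sV j l).cont (sV l j).cont σ
    set X := (n : ℝ) ^ (s - 2) * r ^ (2 + s / 3) with hX
    have hX0 : 0 ≤ X := by positivity
    have n2 : (∫ x in ball3 σ, |cv (k j) (u l) x - cv (k l) (u j) x| ^ s) ≤ 2 ^ s * (C₃ * X + C₃ * X) :=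
      n1.trans (mul_le_mul_of_nonneg_left (add_le_add (hV j l) (hV l j)) (by positivity))
    have q24 : 1 ≤ (r / d) ^ 24 := one_le_pow₀ hq
    have n3 : C₁ * (r / d) ^ 24 * r ^ (2 + s / 3) ≤ C₁ * (X * (r / d) ^ 24) := by
      rw [hX, mul_assoc]
      refine mul_le_mul_of_nonneg_left ?_ hC₁
      rw [mul_comm ((r / d) ^ 24)]
      gcongr
      exact le_mul_of_one_le_left (by positivity) hns
    have n4 : X ≤ X * (r / d) ^ 24 := le_mul_of_one_le_right hX0 q24
    calc _ ≤ 2 ^ s * (2 ^ s * (C₃ * X + C₃ * X) + C₁ * (r / d) ^ 24 * r ^ (2 + s / 3)) :=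
          mul_le_mul_of_nonneg_left (add_le_add n2 (hr1 j l)) (by positivity)
      _ ≤ 2 ^ s * (2 ^ s * (C₃ * (X * (r / d) ^ 24) + C₃ * (X * (r / d) ^ 24)) + C₁ * (X * (r / d) ^ 24)) := by
          gcongr
      _ = 2 ^ s * (2 ^ s * (C₃ + C₃) + C₁) * (X * (r / d) ^ 24) := by ring
      _ ≤ C₄ * (X * (r / d) ^ 24) := by
          refine mul_le_mul_of_nonneg_right ?_ (by positivity)
          rw [hC₄]; linarith
      _ = _ := by rw [hX]; ring
  · intro m j l
    have e1 : ∀ x, pd m (fun x => cv (k j) (u l) x - cv (k l) (u j) x + homPot e j l x) x =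
        pd m (cv (k j) (u l)) x - pd m (cv (k l) (u j)) x + pd m (homPot e j l) x := fun x => by
      rw [pd_add (sW j l).diffAt (sm_homPot sme j l).diffAt, pd_sub (sV j l).diffAt (sV l j).diffAt]
    simp_rw [e1]
    refine (ballInt_add_sq_le (((sV j l).pd m).cont.sub ((sV l j).pd m).cont)
      ((sm_homPot sme j l).pd m).cont σ).trans ?_
    have n1 := ballInt_sub_sq_le ((sV j l).pd m).cont ((sV l j).pd m).cont σ
    have n2 := hV' m j l
    have n3 := hV' m l j
    have n4 := hr2 m j l
    set Z := (r / d) ^ 10 * r ^ (5 / 3 - 2 / s) with hZ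
    have hZ0 : 0 ≤ Z := by positivity
    calc _ ≤ 4 * (4 * (4 * Y + 4 * Y) + C₁ * Z) :=
          mul_le_mul_of_nonneg_left (add_le_add (n1.trans (mul_le_mul_of_nonneg_left
            (add_le_add n2 n3) (by norm_num))) n4) (by norm_num)
      _ ≤ (128 + 4 * C₁) * (Y + Z) := by nlinarith
      _ ≤ C₄ * (Y + Z) := by
          refine mul_le_mul_of_nonneg_right ?_ (by positivity)
          have : 0 ≤ 2 ^ s * (2 ^ s * (C₃ + C₃) + C₁) := by positivity
          rw [hC₄]; linarith

/-- A function is the divergence of a smooth compactly supported vector field. -/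
def IsDiv (h : E3 → ℝ) : Prop :=
  ∃ G : Fin 3 → E3 → ℝ, (∀ i, Sm (G i)) ∧ (∀ i, HasCompactSupport (G i)) ∧
    ∀ x, h x = ∑ i, pd i (G i) x

/-- The curl of a triple of scalar functions. -/
def crl (v : Fin 3 → E3 → ℝ) (x : E3) : Fin 3 → ℝ :=
  ![pd 1 (v 2) x - pd 2 (v 1) x, pd 2 (v 0) x - pd 0 (v 2) x, pd 0 (v 1) x - pd 1 (v 0) x]

namespace IsDiv

variable {h h' : E3 → ℝ}

theorem add (hh : IsDiv h) (hh' : IsDiv h') : IsDiv fun x => h x + h' x := by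
  obtain ⟨G, s, c, e⟩ := hh
  obtain ⟨G', s', c', e'⟩ := hh'
  refine ⟨fun i x => G i x + G' i x, fun i => (s i).add (s' i), fun i => (c i).add (c' i), fun x => ?_⟩
  simp only [pd_add (s _).diffAt (s' _).diffAt, Finset.sum_add_distrib, e, e']

theorem const_mul (a : ℝ) (hh : IsDiv h) : IsDiv fun x => a * h x := by
  obtain ⟨G, s, c, e⟩ := hh
  refine ⟨fun i x => a * G i x, fun i => contDiff_const.mul (s i), fun i => (c i).mul_left, fun x => ?_⟩
  simp only [pd_const_mul a (s _).diffAt, e, Finset.mul_sum]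

theorem sum {H : Fin 3 → E3 → ℝ} (hH : ∀ j, IsDiv (H j)) : IsDiv fun x => ∑ j, H j x := by
  simp only [Fin.sum_univ_three]
  exact ((hH 0).add (hH 1)).add (hH 2)

theorem integrable (hh : IsDiv h) : Integrable h := by
  obtain ⟨G, s, c, e⟩ := hh
  rw [funext e]
  exact integrable_finsetSum _ fun i _ => ((s i).pd i).integrable ((c i).pd i)

theorem integral_eq_zero (hh : IsDiv h) : ∫ x, h x = 0 := by
  obtain ⟨G, s, c, e⟩ := hh
  simp_rw [e]
  exact integral_div_eq_zero s c

theorem integral_le {f g : E3 → ℝ} (hh : IsDiv h) (hf : Integrable f) (hg : Integrable g)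
    (hle : ∀ x, f x ≤ h x + g x) : ∫ x, f x ≤ ∫ x, g x := by
  calc ∫ x, f x ≤ ∫ x, (h x + g x) := integral_mono hf (hh.integrable.add hg) hle
    _ = _ := by rw [integral_add hh.integrable hg, hh.integral_eq_zero, zero_add]

end IsDiv

section Identities

variable {f g ψ : E3 → ℝ} {v z : Fin 3 → E3 → ℝ}

theorem isDiv_flux (hg : Sm g) (hv : ∀ i, Sm (v i)) (hψ : Sm ψ) (hc : HasCompactSupport ψ) :
    IsDiv fun x => ψ x * (g x * ∑ i, pd i (v i) x + ∑ i, v i x * pd i g x) +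
      g x * ∑ i, v i x * pd i ψ x := by
  refine ⟨fun i x => ψ x * (g x * v i x), fun i => hψ.mul (hg.mul (hv i)), fun i => hc.mul_right,
    fun x => ?_⟩
  simp only [pd_mul (f := ψ) (g := fun x => g x * v _ x) hψ.diffAt (Sm.diffAt (hg.mul (hv _))),
    pd_mul (f := g) (g := v _) hg.diffAt (hv _).diffAt, Fin.sum_univ_three]
  ring

theorem isDiv_grad (hf : Sm f) (hg : Sm g) (hc : HasCompactSupport g) :
    IsDiv fun x => g x * lap f x + ∑ i, pd i g x * pd i f x := by
  refine ⟨fun i x => g x * pd i f x, fun i => hg.mul (hf.pd i), fun i => hc.mul_right, fun x => ?_⟩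
  simp only [pd_mul (f := g) (g := pd _ f) hg.diffAt (hf.pd _).diffAt, lap, Fin.sum_univ_three]
  ring

theorem isDiv_mul (hf : Sm f) (hz : ∀ i, Sm (z i)) (hc : ∀ i, HasCompactSupport (z i)) :
    IsDiv fun x => (∑ j, pd j f x * z j x) + f x * ∑ j, pd j (z j) x := by
  refine ⟨fun i x => f x * z i x, fun i => hf.mul (hz i), fun i => (hc i).mul_left, fun x => ?_⟩
  simp only [pd_mul (f := f) (g := z _) hf.diffAt (hz _).diffAt, Fin.sum_univ_three]
  ring

theorem isDiv_transport (hf : Sm f) (hv : ∀ i, Sm (v i)) (hd : ∀ x, ∑ i, pd i (v i) x = 0)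
    (hψ : Sm ψ) (hc : HasCompactSupport ψ) :
    IsDiv fun x => ψ x * f x * (-(lap f x) + ∑ i, v i x * pd i f x) -
      (ψ x * ∑ i, pd i f x ^ 2 + ∑ i, f x * pd i f x * pd i ψ x -
        1 / 2 * f x ^ 2 * ∑ i, v i x * pd i ψ x) := by
  have h1 := (isDiv_grad hf (hψ.mul hf) (hc.mul_right)).const_mul (-1)
  have h2 := (isDiv_flux (hf.pow 2) hv hψ hc).const_mul (1 / 2)
  have h := h1.add h2
  convert h using 2 with x
  simp only [hd, pd_mul (f := ψ) (g := f) hψ.diffAt hf.diffAt, pd_sq hf.diffAt, Fin.sum_univ_three]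
  ring

theorem isDiv_curl (hv : ∀ i, Sm (v i)) (hz : ∀ i, Sm (z i)) (hc : ∀ i, HasCompactSupport (z i)) :
    IsDiv fun x => (∑ j, crl v x j * z j x) - ∑ j, v j x * crl z x j := by
  refine ⟨![fun x => v 1 x * z 2 x - v 2 x * z 1 x, fun x => v 2 x * z 0 x - v 0 x * z 2 x,
    fun x => v 0 x * z 1 x - v 1 x * z 0 x], fun i => ?_, fun i => ?_, fun x => ?_⟩
  · fin_cases i <;> exact ((hv _).mul (hz _)).sub ((hv _).mul (hz _))
  · fin_cases i <;> exact (hc _).mul_left.sub (hc _).mul_left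
  · have e : ∀ i j k l m, pd m (fun x => v i x * z j x - v k x * z l x) x =
        (pd m (v i) x * z j x + v i x * pd m (z j) x) - (pd m (v k) x * z l x + v k x * pd m (z l) x) := by
      intro i j k l m
      rw [pd_sub (f := fun x => v i x * z j x) (g := fun x => v k x * z l x)
        (Sm.diffAt ((hv _).mul (hz _))) (Sm.diffAt ((hv _).mul (hz _))),
        pd_mul (hv _).diffAt (hz _).diffAt, pd_mul (hv _).diffAt (hz _).diffAt]
    simp only [Fin.sum_univ_three, crl, Matrix.cons_val_zero, Matrix.cons_val_one, Matrix.cons_val, e]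
    ring

end Identities

/-- The stationary magneto-micropolar equations, written for the components of the fields. -/
structure FieldSol (U W B : Fin 3 → E3 → ℝ) (P : E3 → ℝ) : Prop where
  smU : ∀ j, Sm (U j)
  smW : ∀ j, Sm (W j)
  smB : ∀ j, Sm (B j)
  smP : Sm P
  eqU : ∀ x j, -(lap (U j) x) + ∑ i, U i x * pd i (U j) x + pd j P x =
    crl W x j + ∑ i, B i x * pd i (B j) x
  eqW : ∀ x j, -(lap (W j) x) + ∑ i, U i x * pd i (W j) x =
    pd j (fun y => ∑ i, pd i (W i) y) x + crl U x j - 2 * W j x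
  eqB : ∀ x j, -(lap (B j) x) + ∑ i, U i x * pd i (B j) x = ∑ i, B i x * pd i (U j) x
  divU : ∀ x, ∑ i, pd i (U i) x = 0
  divB : ∀ x, ∑ i, pd i (B i) x = 0

theorem IsMMPSolution.fieldSol {u w b : E3 → E3} {P : E3 → ℝ} (h : IsMMPSolution u w b P) :
    FieldSol (fun j x => u x j) (fun j x => w x j) (fun j x => b x j) P where
  smU := Sm.coord h.smooth_u
  smW := Sm.coord h.smooth_w
  smB := Sm.coord h.smooth_b
  smP := h.smooth_P
  eqU := h.eq_u
  eqW := h.eq_w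
  eqB := h.eq_b
  divU := h.div_u
  divB := h.div_b

namespace FieldSol

variable {U W B : Fin 3 → E3 → ℝ} {P ψ : E3 → ℝ}

/-- The local energy balance, up to a divergence. -/
theorem isDiv_energy (h : FieldSol U W B P) (hψ : Sm ψ) (hc : HasCompactSupport ψ) :
    IsDiv fun x =>
      ψ x * ((∑ j, ∑ i, pd i (U j) x ^ 2) + (∑ j, ∑ i, pd i (W j) x ^ 2) +
        (∑ j, ∑ i, pd i (B j) x ^ 2) + (∑ i, pd i (W i) x) ^ 2 + 2 * (∑ j, W j x ^ 2) -
        2 * ∑ j, W j x * crl U x j) +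
      ((∑ j, ∑ i, U j x * pd i (U j) x * pd i ψ x) + (∑ j, ∑ i, W j x * pd i (W j) x * pd i ψ x) +
        (∑ j, ∑ i, B j x * pd i (B j) x * pd i ψ x) -
        1 / 2 * ((∑ j, U j x ^ 2) + (∑ j, W j x ^ 2) + ∑ j, B j x ^ 2) * (∑ i, U i x * pd i ψ x) -
        P x * (∑ i, U i x * pd i ψ x) + (∑ i, pd i (W i) x) * (∑ i, W i x * pd i ψ x) +
        (∑ j, U j x * B j x) * (∑ i, B i x * pd i ψ x) -
        (W 0 x * (pd 1 ψ x * U 2 x - pd 2 ψ x * U 1 x) +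
          W 1 x * (pd 2 ψ x * U 0 x - pd 0 ψ x * U 2 x) +
          W 2 x * (pd 0 ψ x * U 1 x - pd 1 ψ x * U 0 x))) := by
  have sδ : Sm fun y => ∑ i, pd i (W i) y := ContDiff.sum fun i _ => (h.smW i).pd i
  have sUB : Sm fun y => ∑ j, U j y * B j y := ContDiff.sum fun i _ => (h.smU i).mul (h.smB i)
  have sψU : ∀ j, Sm fun y => ψ y * U j y := fun j => hψ.mul (h.smU j)
  have n1 := IsDiv.sum fun j => isDiv_transport (h.smU j) h.smU h.divU hψ hc
  have n2 := IsDiv.sum fun j => isDiv_transport (h.smW j) h.smU h.divU hψ hc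
  have n3 := IsDiv.sum fun j => isDiv_transport (h.smB j) h.smU h.divU hψ hc
  have n4 := isDiv_flux h.smP h.smU hψ hc
  have n5 := isDiv_flux sδ h.smW hψ hc
  have n6 := isDiv_flux sUB h.smB hψ hc
  have n7 := isDiv_curl h.smW sψU fun j => hc.mul_right
  have n := ((((n1.add n2).add (n3.add n4)).const_mul (-1)).add (n5.add n6)).add n7
  convert n using 2 with x
  have e1 : ∀ i, pd i (fun y => ∑ j, U j y * B j y) x =
      ∑ j, (pd i (U j) x * B j x + U j x * pd i (B j) x) := fun i => by
    rw [pd_sum (F := fun j y => U j y * B j y) _ fun j _ => Sm.diffAt ((h.smU j).mul (h.smB j))]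
    exact Finset.sum_congr rfl fun j _ => pd_mul (h.smU j).diffAt (h.smB j).diffAt
  have e2 : ∀ i j, pd i (fun y => ψ y * U j y) x = pd i ψ x * U j x + ψ x * pd i (U j) x :=
    fun i j => pd_mul hψ.diffAt (h.smU j).diffAt
  have hU := h.eqU x
  have hW := h.eqW x
  have hB := h.eqB x
  have dU := h.divU x
  have dB := h.divB x
  have kU : ∀ j, -(lap (U j) x) + ∑ i, U i x * pd i (U j) x =
      crl W x j + (∑ i, B i x * pd i (B j) x) - pd j P x := fun j => by linarith [hU j]
  simp only [kU, hW, hB, e1, dU, dB]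
  simp only [Fin.sum_univ_three, crl, Matrix.cons_val_zero, Matrix.cons_val_one, Matrix.cons_val, e2]
  ring

/-- The Jacobian term of a divergence-free field is a divergence, up to a boundary term. -/
theorem isDiv_jacobian (hU : ∀ j, Sm (U j)) (dU : ∀ x, ∑ i, pd i (U i) x = 0) (hψ : Sm ψ)
    (hc : HasCompactSupport ψ) :
    IsDiv fun x => ψ x * (∑ i, ∑ j, pd i (U j) x * pd j (U i) x) +
      ∑ i, (∑ j, U j x * pd j (U i) x) * pd i ψ x := by
  have s : ∀ i, Sm fun y => ∑ j, U j y * pd j (U i) y := fun i =>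
    ContDiff.sum fun j _ => (hU j).mul ((hU i).pd j)
  have n := isDiv_flux (g := fun _ => (1 : ℝ)) contDiff_const s hψ hc
  convert n using 2 with x
  have e1 : ∀ i, pd i (fun y => ∑ j, U j y * pd j (U i) y) x =
      ∑ j, (pd i (U j) x * pd j (U i) x + U j x * pd j (pd i (U i)) x) := fun i => by
    rw [pd_sum (F := fun j y => U j y * pd j (U i) y) _ fun j _ => Sm.diffAt ((hU j).mul ((hU i).pd j))]
    refine Finset.sum_congr rfl fun j _ => ?_
    rw [pd_mul (f := U j) (g := pd j (U i)) (hU j).diffAt ((hU i).pd j).diffAt, pd_comm (hU i) i j]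
  have e2 : ∀ j, ∑ i, pd j (pd i (U i)) x = 0 := fun j => by
    rw [← pd_sum (F := fun i => pd i (U i)) _ fun i _ => ((hU i).pd i).diffAt]
    simp only [dU, pd_const]
  have e20 := e2 0
  have e21 := e2 1
  have e22 := e2 2
  simp only [e1, pd_const]
  simp only [Fin.sum_univ_three] at *
  linear_combination -ψ x * (U 0 x * e20 + U 1 x * e21 + U 2 x * e22)

/-- The pressure flux tested against a compactly supported field `z`. -/
theorem isDiv_pressure (h : FieldSol U W B P) {z : Fin 3 → E3 → ℝ} (hz : ∀ j, Sm (z j))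
    (hc : ∀ j, HasCompactSupport (z j)) :
    IsDiv fun x => P x * (∑ j, pd j (z j) x) - ((∑ j, ∑ i, pd i (z j) x * pd i (U j) x) +
      (∑ j, z j x * ∑ i, U i x * pd i (U j) x) - (∑ j, z j x * ∑ i, B i x * pd i (B j) x) -
      ∑ j, W j x * crl z x j) := by
  have n1 := isDiv_mul h.smP hz hc
  have n2 := IsDiv.sum fun j => isDiv_grad (h.smU j) (hz j) (hc j)
  have n3 := isDiv_curl h.smW hz hc
  have n := n1.add ((n2.add n3).const_mul (-1))
  convert n using 2 with x
  have hU := h.eqU x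
  have kU : ∀ j, pd j P x = crl W x j + (∑ i, B i x * pd i (B j) x) + lap (U j) x -
      ∑ i, U i x * pd i (U j) x := fun j => by linarith [hU j]
  simp only [kU]
  simp only [Fin.sum_univ_three]
  ring

end FieldSol

section AbsBounds

variable {x y z X Y Z : ℝ}

theorem abs_mul_le_mul (hx : |x| ≤ X) (hy : |y| ≤ Y) : |x * y| ≤ X * Y := by
  rw [abs_mul]; exact mul_le_mul hx hy (abs_nonneg _) ((abs_nonneg _).trans hx)

theorem abs_sum_three_le {f : Fin 3 → ℝ} {c : ℝ} (h : ∀ i, |f i| ≤ c) : |∑ i, f i| ≤ 3 * c := by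
  refine (Finset.abs_sum_le_sum_abs _ _).trans ((Finset.sum_le_sum fun i _ => h i).trans_eq ?_)
  simp

theorem le_sum_three {f : Fin 3 → ℝ} (h : ∀ i, 0 ≤ f i) (i : Fin 3) : f i ≤ ∑ i, f i :=
  Finset.single_le_sum (fun i _ => h i) (Finset.mem_univ i)

end AbsBounds

namespace FieldSol

variable {U W B : Fin 3 → E3 → ℝ} {P ψ ζ : E3 → ℝ} {V : Fin 3 → Fin 3 → E3 → ℝ}

/-- The pointwise estimate of all boundary terms of the energy balance. -/
theorem abs_boundary_le {U W B p : Fin 3 → ℝ} {DU DW DB Dz : Fin 3 → Fin 3 → ℝ} {z c : Fin 3 → ℝ}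
    {S G a T R : ℝ} (hU : ∀ j, |U j| ≤ S) (hW : ∀ j, |W j| ≤ S) (hB : ∀ j, |B j| ≤ S)
    (hWG : ∀ j, |W j| ≤ G) (hDU : ∀ i j, |DU i j| ≤ G) (hDW : ∀ i j, |DW i j| ≤ G)
    (hDB : ∀ i j, |DB i j| ≤ G) (hp : ∀ i, |p i| ≤ a) (hz : ∀ j, |z j| ≤ T)
    (hDz : ∀ i j, |Dz i j| ≤ R) (hc : ∀ j, |c j| ≤ 2 * R) :
    -((∑ j, ∑ i, U j * DU i j * p i) + (∑ j, ∑ i, W j * DW i j * p i) +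
        (∑ j, ∑ i, B j * DB i j * p i) -
        1 / 2 * ((∑ j, U j ^ 2) + (∑ j, W j ^ 2) + ∑ j, B j ^ 2) * (∑ i, U i * p i) +
        (∑ i, DW i i) * (∑ i, W i * p i) + (∑ j, U j * B j) * (∑ i, B i * p i) -
        (W 0 * (p 1 * U 2 - p 2 * U 1) + W 1 * (p 2 * U 0 - p 0 * U 2) +
          W 2 * (p 0 * U 1 - p 1 * U 0))) +
      3 / 4 * (∑ i, (∑ j, U j * DU j i) * p i) +
      ((∑ j, ∑ i, Dz i j * DU i j) + (∑ j, z j * ∑ i, U i * DU i j) -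
        (∑ j, z j * ∑ i, B i * DB i j) - ∑ j, W j * c j) ≤
      100 * (a * S * G + a * S ^ 3 + R * G + T * G * S) := by
  have adv : ∀ {f : Fin 3 → ℝ} {D : Fin 3 → Fin 3 → ℝ}, (∀ j, |f j| ≤ S) → (∀ i j, |D i j| ≤ G) →
      |∑ j, ∑ i, f j * D i j * p i| ≤ 3 * (3 * (S * G * a)) := fun hf hD =>
    abs_sum_three_le fun j => abs_sum_three_le fun i =>
      abs_mul_le_mul (abs_mul_le_mul (hf j) (hD i j)) (hp i)
  have sq : ∀ {f : Fin 3 → ℝ}, (∀ j, |f j| ≤ S) → |∑ j, f j ^ 2| ≤ 3 * (S * S) := fun hf =>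
    abs_sum_three_le fun j => by rw [pow_two]; exact abs_mul_le_mul (hf j) (hf j)
  have fp : ∀ {f : Fin 3 → ℝ}, (∀ j, |f j| ≤ S) → |∑ i, f i * p i| ≤ 3 * (S * a) := fun hf =>
    abs_sum_three_le fun i => abs_mul_le_mul (hf i) (hp i)
  have cr : ∀ i j k l m, |W i * (p j * U k - p l * U m)| ≤ G * (a * S + a * S) := fun i j k l m =>
    abs_mul_le_mul (hWG i) ((abs_sub _ _).trans (add_le_add (abs_mul_le_mul (hp j) (hU k))
      (abs_mul_le_mul (hp l) (hU m))))
  have t1 := neg_le_of_abs_le (adv hU hDU)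
  have t2 := neg_le_of_abs_le (adv hW hDW)
  have t3 := neg_le_of_abs_le (adv hB hDB)
  have t4 := le_of_abs_le (abs_mul_le_mul (abs_mul_le_mul (x := 1 / 2) (X := 1 / 2) (by norm_num)
    ((abs_add_three _ _ _).trans (add_le_add (add_le_add (sq hU) (sq hW)) (sq hB)))) (fp hU))
  have t5 := neg_le_of_abs_le (abs_mul_le_mul (abs_sum_three_le fun i => hDW i i) (fp hW))
  have t6 := neg_le_of_abs_le (abs_mul_le_mul
    (abs_sum_three_le fun j => abs_mul_le_mul (hU j) (hB j)) (fp hB))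
  have t7 := le_of_abs_le (cr 0 1 2 2 1)
  have t8 := le_of_abs_le (cr 1 2 0 0 2)
  have t9 := le_of_abs_le (cr 2 0 1 1 0)
  have t10 := le_of_abs_le (abs_sum_three_le fun i => abs_mul_le_mul
    (abs_sum_three_le fun j => abs_mul_le_mul (hU j) (hDU j i)) (hp i))
  have t11 := le_of_abs_le (abs_sum_three_le fun j => abs_sum_three_le fun i =>
    abs_mul_le_mul (hDz i j) (hDU i j))
  have t12 := le_of_abs_le (abs_sum_three_le fun j => abs_mul_le_mul (hz j)
    (abs_sum_three_le fun i => abs_mul_le_mul (hU i) (hDU i j)))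
  have t13 := neg_le_of_abs_le (abs_sum_three_le fun j => abs_mul_le_mul (hz j)
    (abs_sum_three_le fun i => abs_mul_le_mul (hB i) (hDB i j)))
  have t14 := neg_le_of_abs_le (abs_sum_three_le fun j => abs_mul_le_mul (hWG j) (hc j))
  have S0 := (abs_nonneg _).trans (hU 0)
  have G0 := (abs_nonneg _).trans (hWG 0)
  have a0 := (abs_nonneg _).trans (hp 0)
  have T0 := (abs_nonneg _).trans (hz 0)
  have R0 := (abs_nonneg _).trans (hDz 0 0)
  have p1 : 0 ≤ a * S * G := by positivity
  have p2 : 0 ≤ a * S ^ 3 := by positivity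
  have p3 : 0 ≤ R * G := by positivity
  have p4 : 0 ≤ T * G * S := by positivity
  linarith

/-- The sum of the absolute values of all fields. -/
def size (U W B : Fin 3 → E3 → ℝ) (x : E3) : ℝ := ∑ j, (|U j x| + |W j x| + |B j x|)

/-- The sum of the absolute values of all first derivatives, and of `W`. -/
def gsize (U W B : Fin 3 → E3 → ℝ) (x : E3) : ℝ :=
  (∑ j, ∑ i, (|pd i (U j) x| + |pd i (W j) x| + |pd i (B j) x|)) + ∑ j, |W j x|

/-- The sum of the absolute values of a matrix field. -/
def msize (V : Fin 3 → Fin 3 → E3 → ℝ) (x : E3) : ℝ := ∑ j, ∑ l, |V j l x|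

/-- The sum of the absolute values of the first derivatives of a matrix field. -/
def dmsize (V : Fin 3 → Fin 3 → E3 → ℝ) (x : E3) : ℝ := ∑ m, ∑ j, ∑ l, |pd m (V j l) x|

/-- A lower bound of the energy density. -/
def dens (U W B : Fin 3 → E3 → ℝ) (x : E3) : ℝ :=
  1 / 4 * (∑ j, ∑ i, pd i (U j) x ^ 2) + (∑ j, ∑ i, pd i (W j) x ^ 2) +
    (∑ j, ∑ i, pd i (B j) x ^ 2) + 2 / 3 * ∑ j, W j x ^ 2

theorem size_nonneg (x : E3) : 0 ≤ size U W B x := Finset.sum_nonneg fun _ _ => by positivity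

theorem gsize_nonneg (x : E3) : 0 ≤ gsize U W B x :=
  add_nonneg (Finset.sum_nonneg fun _ _ => Finset.sum_nonneg fun _ _ => by positivity)
    (Finset.sum_nonneg fun _ _ => abs_nonneg _)

theorem msize_nonneg (x : E3) : 0 ≤ msize V x :=
  Finset.sum_nonneg fun _ _ => Finset.sum_nonneg fun _ _ => abs_nonneg _

theorem dmsize_nonneg (x : E3) : 0 ≤ dmsize V x :=
  Finset.sum_nonneg fun _ _ => Finset.sum_nonneg fun _ _ => Finset.sum_nonneg fun _ _ => abs_nonneg _

theorem le_size (j : Fin 3) (x : E3) : |U j x| + |W j x| + |B j x| ≤ size U W B x :=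
  le_sum_three (f := fun j => |U j x| + |W j x| + |B j x|) (fun _ => by positivity) j

theorem le_gsize (i j : Fin 3) (x : E3) :
    |pd i (U j) x| + |pd i (W j) x| + |pd i (B j) x| ≤ gsize U W B x := by
  have h1 := le_sum_three (f := fun i => |pd i (U j) x| + |pd i (W j) x| + |pd i (B j) x|)
    (fun _ => by positivity) i
  have h2 := le_sum_three (f := fun j => ∑ i, (|pd i (U j) x| + |pd i (W j) x| + |pd i (B j) x|))
    (fun _ => Finset.sum_nonneg fun _ _ => by positivity) j
  have h3 : 0 ≤ ∑ j, |W j x| := Finset.sum_nonneg fun _ _ => abs_nonneg _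
  unfold gsize; linarith

theorem le_gsize' (j : Fin 3) (x : E3) : |W j x| ≤ gsize U W B x := by
  have h1 := le_sum_three (f := fun j => |W j x|) (fun _ => abs_nonneg _) j
  have h2 : 0 ≤ ∑ j, ∑ i, (|pd i (U j) x| + |pd i (W j) x| + |pd i (B j) x|) :=
    Finset.sum_nonneg fun _ _ => Finset.sum_nonneg fun _ _ => by positivity
  unfold gsize; linarith

theorem sum_abs_le_msize (j : Fin 3) (x : E3) : ∑ l, |V j l x| ≤ msize V x :=
  le_sum_three (f := fun j => ∑ l, |V j l x|) (fun _ => Finset.sum_nonneg fun _ _ => abs_nonneg _) j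

theorem sum_abs_le_dmsize (m j : Fin 3) (x : E3) : ∑ l, |pd m (V j l) x| ≤ dmsize V x :=
  (le_sum_three (f := fun j => ∑ l, |pd m (V j l) x|)
    (fun _ => Finset.sum_nonneg fun _ _ => abs_nonneg _) j).trans
  (le_sum_three (f := fun m => ∑ j, ∑ l, |pd m (V j l) x|)
    (fun _ => Finset.sum_nonneg fun _ _ => Finset.sum_nonneg fun _ _ => abs_nonneg _) m)

theorem abs_sum_mul_le {f g : Fin 3 → ℝ} {c F : ℝ} (hg : ∀ l, |g l| ≤ c) (hf : ∑ l, |f l| ≤ F) :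
    |∑ l, f l * g l| ≤ c * F := by
  have hc := (abs_nonneg _).trans (hg 0)
  calc _ ≤ ∑ l, |f l * g l| := Finset.abs_sum_le_sum_abs _ _
    _ ≤ ∑ l, c * |f l| := Finset.sum_le_sum fun l _ => by
        rw [abs_mul, mul_comm c]; exact mul_le_mul_of_nonneg_left (hg l) (abs_nonneg _)
    _ = c * ∑ l, |f l| := by rw [Finset.mul_sum]
    _ ≤ _ := mul_le_mul_of_nonneg_left hf hc

theorem dens_le {U W B : Fin 3 → E3 → ℝ} (x : E3) : dens U W B x ≤
    (∑ j, ∑ i, pd i (U j) x ^ 2) + (∑ j, ∑ i, pd i (W j) x ^ 2) +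
        (∑ j, ∑ i, pd i (B j) x ^ 2) + (∑ i, pd i (W i) x) ^ 2 + 2 * (∑ j, W j x ^ 2) -
        2 * (∑ j, W j x * crl U x j) - 3 / 4 * ∑ i, ∑ j, pd i (U j) x * pd j (U i) x := by
  unfold dens crl
  simp only [Fin.sum_univ_three, Matrix.cons_val_zero, Matrix.cons_val_one, Matrix.cons_val]
  nlinarith [sq_nonneg (3 / 4 * (pd 1 (U 2) x - pd 2 (U 1) x) - W 0 x),
    sq_nonneg (3 / 4 * (pd 2 (U 0) x - pd 0 (U 2) x) - W 1 x),
    sq_nonneg (3 / 4 * (pd 0 (U 1) x - pd 1 (U 0) x) - W 2 x),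
    sq_nonneg (pd 0 (W 0) x + pd 1 (W 1) x + pd 2 (W 2) x)]

/-- The integrand dominating the boundary terms of the localized energy balance. -/
def bdry (U W B : Fin 3 → E3 → ℝ) (V : Fin 3 → Fin 3 → E3 → ℝ) (ζ : E3 → ℝ) (a a' : ℝ) (x : E3) : ℝ :=
  a * (size U W B x * (ζ x * gsize U W B x)) + a * (ζ x * size U W B x) ^ 3 +
    (a * dmsize V x + a' * msize V x) * (ζ x * gsize U W B x) +
    a * (msize V x * (ζ x * gsize U W B x) * (ζ x * size U W B x))

theorem continuous_size (hU : ∀ j, Sm (U j)) (hW : ∀ j, Sm (W j)) (hB : ∀ j, Sm (B j)) :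
    Continuous (size U W B) :=
  continuous_finsetSum _ fun j _ => (((hU j).cont.abs).add ((hW j).cont.abs)).add ((hB j).cont.abs)

theorem continuous_gsize (hU : ∀ j, Sm (U j)) (hW : ∀ j, Sm (W j)) (hB : ∀ j, Sm (B j)) :
    Continuous (gsize U W B) :=
  (continuous_finsetSum _ fun j _ => continuous_finsetSum _ fun i _ =>
    ((((hU j).pd i).cont.abs).add (((hW j).pd i).cont.abs)).add (((hB j).pd i).cont.abs)).add
  (continuous_finsetSum _ fun j _ => (hW j).cont.abs)

theorem continuous_msize (hV : ∀ j l, Sm (V j l)) : Continuous (msize V) :=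
  continuous_finsetSum _ fun j _ => continuous_finsetSum _ fun l _ => (hV j l).cont.abs

theorem continuous_dmsize (hV : ∀ j l, Sm (V j l)) : Continuous (dmsize V) :=
  continuous_finsetSum _ fun m _ => continuous_finsetSum _ fun j _ => continuous_finsetSum _ fun l _ =>
    ((hV j l).pd m).cont.abs

theorem continuous_dens (hU : ∀ j, Sm (U j)) (hW : ∀ j, Sm (W j)) (hB : ∀ j, Sm (B j)) :
    Continuous (dens U W B) := by
  have g : ∀ {f : Fin 3 → E3 → ℝ}, (∀ j, Sm (f j)) →
      Continuous fun x => ∑ j, ∑ i, pd i (f j) x ^ 2 := fun hf =>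
    continuous_finsetSum _ fun j _ => continuous_finsetSum _ fun i _ => (((hf j).pd i).cont).pow 2
  have w : Continuous fun x => ∑ j, W j x ^ 2 := continuous_finsetSum _ fun j _ => (hW j).cont.pow 2
  exact (((continuous_const.mul (g hU)).add (g hW)).add (g hB)).add (continuous_const.mul w)

theorem integral_dens_le (h : FieldSol U W B P) (hV : ∀ j l, Sm (V j l))
    (hVa : ∀ j l x, V j l x = -V l j x) (hVU : ∀ l x, ∑ j, pd j (V j l) x = U l x)
    (hψ : Sm ψ) (hψc : HasCompactSupport ψ) (hψ0 : ∀ x, 0 ≤ ψ x) (hζ : Continuous ζ)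
    (hζc : HasCompactSupport ζ) (hζ0 : ∀ x, 0 ≤ ζ x) {a a' : ℝ} (ha : ∀ i x, |pd i ψ x| ≤ a)
    (ha' : ∀ i j x, |pd i (pd j ψ) x| ≤ a')
    (hζψ : ∀ x, ζ x = 1 ∨ (∀ i, pd i ψ x = 0) ∧ ∀ i j, pd i (pd j ψ) x = 0) :
    ∫ x, ψ x * dens U W B x ≤ 100 * ∫ x, bdry U W B V ζ a a' x := by
  set z : Fin 3 → E3 → ℝ := fun j x => ∑ l, V j l x * pd l ψ x with hz
  have sz : ∀ j, Sm (z j) := fun j => ContDiff.sum fun l _ => (hV j l).mul (hψ.pd l)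
  have cz : ∀ j, HasCompactSupport (z j) := fun j => by
    have e : z j = fun x => V j 0 x * pd 0 ψ x + V j 1 x * pd 1 ψ x + V j 2 x * pd 2 ψ x := by
      funext x; simp only [hz, Fin.sum_univ_three]
    rw [e]
    exact ((hψc.pd 0).mul_left.add (hψc.pd 1).mul_left).add (hψc.pd 2).mul_left
  have dz : ∀ i j x, pd i (z j) x =
      ∑ l, (pd i (V j l) x * pd l ψ x + V j l x * pd i (pd l ψ) x) := fun i j x => by
    rw [hz, pd_sum (F := fun l y => V j l y * pd l ψ y) _ fun l _ =>
      Sm.diffAt ((hV j l).mul (hψ.pd l))]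
    exact Finset.sum_congr rfl fun l _ => pd_mul (hV j l).diffAt (hψ.pd l).diffAt
  have divz : ∀ x, ∑ j, pd j (z j) x = ∑ l, U l x * pd l ψ x := fun x => by
    simp only [dz, ← hVU]
    have c01 := pd_comm hψ 0 1 x
    have c02 := pd_comm hψ 0 2 x
    have c12 := pd_comm hψ 1 2 x
    have v01 := hVa 0 1 x
    have v02 := hVa 0 2 x
    have v12 := hVa 1 2 x
    have v0 : V 0 0 x = 0 := by linarith [hVa 0 0 x]
    have v1 : V 1 1 x = 0 := by linarith [hVa 1 1 x]
    have v2 : V 2 2 x = 0 := by linarith [hVa 2 2 x]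
    simp only [Fin.sum_univ_three, v0, v1, v2, v01, v02, v12, c01, c02, c12]
    ring
  have hN := ((h.isDiv_energy hψ hψc).add
    ((isDiv_jacobian h.smU h.divU hψ hψc).const_mul (-(3 / 4)))).add (h.isDiv_pressure sz cz)
  have cS := continuous_size h.smU h.smW h.smB
  have cG := continuous_gsize h.smU h.smW h.smB
  have cV := continuous_msize hV
  have cDV := continuous_dmsize hV
  have cQ : Continuous (bdry U W B V ζ a a') :=
    (((continuous_const.mul (cS.mul (hζ.mul cG))).add (continuous_const.mul ((hζ.mul cS).pow 3))).add
      (((continuous_const.mul cDV).add (continuous_const.mul cV)).mul (hζ.mul cG))).add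
      (continuous_const.mul ((cV.mul (hζ.mul cG)).mul (hζ.mul cS)))
  have kQ : HasCompactSupport (bdry U W B V ζ a a') := hζc.mono' fun x hx => by
    refine subset_tsupport _ fun hx0 => hx ?_
    simp only [bdry, hx0]; ring
  have iQ : Integrable (bdry U W B V ζ a a') := cQ.integrable_of_hasCompactSupport kQ
  have iψ : Integrable fun x => ψ x * dens U W B x :=
    (hψ.cont.mul (continuous_dens h.smU h.smW h.smB)).integrable_of_hasCompactSupport hψc.mul_right
  rw [← integral_const_mul]
  refine hN.integral_le iψ (iQ.const_mul 100) fun x => ?_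
  have hd := mul_le_mul_of_nonneg_left (dens_le (U := U) (W := W) (B := B) x) (hψ0 x)
  have S0 := size_nonneg (U := U) (W := W) (B := B) x
  have G0 := gsize_nonneg (U := U) (W := W) (B := B) x
  have V0 := msize_nonneg (V := V) x
  have DV0 := dmsize_nonneg (V := V) x
  have ζ0 := hζ0 x
  have a0 : 0 ≤ a := (abs_nonneg _).trans (ha 0 x)
  have a'0 : 0 ≤ a' := (abs_nonneg _).trans (ha' 0 0 x)
  obtain ⟨c, T, R, hp, hzT, hDz, hb⟩ : ∃ c T R : ℝ, (∀ i, |pd i ψ x| ≤ c) ∧ (∀ j, |z j x| ≤ T) ∧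
      (∀ i j, |pd i (z j) x| ≤ R) ∧
      c * size U W B x * gsize U W B x + c * size U W B x ^ 3 + R * gsize U W B x +
        T * gsize U W B x * size U W B x ≤ bdry U W B V ζ a a' x := by
    rcases hζψ x with h1 | ⟨h1, h2⟩
    · refine ⟨a, a * msize V x, a * dmsize V x + a' * msize V x, fun i => ha i x, fun j =>
        abs_sum_mul_le (fun l => ha l x) (sum_abs_le_msize j x), fun i j => ?_, le_of_eq ?_⟩
      · rw [dz, Finset.sum_add_distrib]
        exact (abs_add_le _ _).trans (add_le_add
          (abs_sum_mul_le (fun l => ha l x) (sum_abs_le_dmsize i j x))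
          (abs_sum_mul_le (fun l => ha' i l x) (sum_abs_le_msize j x)))
      · rw [bdry, h1]; ring
    · refine ⟨0, 0, 0, fun i => by simp [h1], fun j => by simp [hz, h1], fun i j => by
        simp [dz, h1, h2], ?_⟩
      rw [bdry]
      simp only [zero_mul, add_zero]
      positivity
  have hS := le_size (U := U) (W := W) (B := B) (x := x)
  have hG := le_gsize (U := U) (W := W) (B := B) (x := x)
  have hcrl : ∀ j, |crl z x j| ≤ 2 * R := by
    have e : ∀ i j k l, |pd i (z j) x - pd k (z l) x| ≤ 2 * R := fun i j k l =>
      (abs_sub _ _).trans (by linarith [hDz i j, hDz k l])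
    intro j
    fin_cases j
    · exact e 1 2 2 1
    · exact e 2 0 0 2
    · exact e 0 1 1 0
  have hb' := abs_boundary_le (U := fun j => U j x) (W := fun j => W j x) (B := fun j => B j x)
    (p := fun i => pd i ψ x) (DU := fun i j => pd i (U j) x) (DW := fun i j => pd i (W j) x)
    (DB := fun i j => pd i (B j) x) (Dz := fun i j => pd i (z j) x) (z := fun j => z j x)
    (c := crl z x) (S := size U W B x) (G := gsize U W B x) (a := c) (T := T) (R := R)
    (fun j => by linarith [hS j, abs_nonneg (W j x), abs_nonneg (B j x)])
    (fun j => by linarith [hS j, abs_nonneg (U j x), abs_nonneg (B j x)])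
    (fun j => by linarith [hS j, abs_nonneg (W j x), abs_nonneg (U j x)])
    (fun j => le_gsize' j x)
    (fun i j => by linarith [hG i j, abs_nonneg (pd i (W j) x), abs_nonneg (pd i (B j) x)])
    (fun i j => by linarith [hG i j, abs_nonneg (pd i (U j) x), abs_nonneg (pd i (B j) x)])
    (fun i j => by linarith [hG i j, abs_nonneg (pd i (W j) x), abs_nonneg (pd i (U j) x)])
    hp hzT hDz hcrl
  simp only [divz]
  have hb2 := hb'.trans (mul_le_mul_of_nonneg_left hb (by norm_num))
  linear_combination hd + hb2

end FieldSol

theorem add_three_rpow_le {a b c p : ℝ} (ha : 0 ≤ a) (hb : 0 ≤ b) (hc : 0 ≤ c) (hp : 0 ≤ p) :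
    (a + b + c) ^ p ≤ 3 ^ p * (a ^ p + b ^ p + c ^ p) := by
  have key : ∀ m, 0 ≤ m → a ≤ m → b ≤ m → c ≤ m → m ^ p ≤ a ^ p + b ^ p + c ^ p →
      (a + b + c) ^ p ≤ 3 ^ p * (a ^ p + b ^ p + c ^ p) := fun m h0 h1 h2 h3 h4 => by
    calc (a + b + c) ^ p ≤ (3 * m) ^ p := rpow_le_rpow (by positivity) (by linarith) hp
      _ = 3 ^ p * m ^ p := mul_rpow (by norm_num) h0
      _ ≤ _ := by gcongr
  have pa := rpow_nonneg ha p
  have pb := rpow_nonneg hb p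
  have pc := rpow_nonneg hc p
  rcases le_total a b with h1 | h1 <;> rcases le_total b c with h2 | h2 <;>
    rcases le_total a c with h3 | h3
  all_goals first
    | exact key c hc (by linarith) (by linarith) (by linarith) (by linarith)
    | exact key b hb (by linarith) (by linarith) (by linarith) (by linarith)
    | exact key a ha (by linarith) (by linarith) (by linarith) (by linarith)

section SumBounds

variable {r p M : ℝ}

theorem ballInt_add_three_le {f g h : E3 → ℝ} (hf : Continuous f) (hg : Continuous g)
    (hh : Continuous h) (f0 : ∀ x, 0 ≤ f x) (g0 : ∀ x, 0 ≤ g x) (h0 : ∀ x, 0 ≤ h x) (hp : 0 < p)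
    (bf : ∫ x in ball3 r, f x ^ p ≤ M) (bg : ∫ x in ball3 r, g x ^ p ≤ M)
    (bh : ∫ x in ball3 r, h x ^ p ≤ M) :
    ∫ x in ball3 r, (f x + g x + h x) ^ p ≤ 3 ^ (p + 1) * M := by
  have cf : Continuous fun x => f x ^ p := hf.rpow_const fun _ => .inr hp.le
  have cg : Continuous fun x => g x ^ p := hg.rpow_const fun _ => .inr hp.le
  have ch : Continuous fun x => h x ^ p := hh.rpow_const fun _ => .inr hp.le
  have cs : Continuous fun x => (f x + g x + h x) ^ p :=
    ((hf.add hg).add hh).rpow_const fun _ => .inr hp.le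
  calc _ ≤ ∫ x in ball3 r, 3 ^ p * (f x ^ p + g x ^ p + h x ^ p) :=
        setIntegral_ball_mono cs (continuous_const.mul ((cf.add cg).add ch)) fun x _ =>
          add_three_rpow_le (f0 x) (g0 x) (h0 x) hp.le
    _ = 3 ^ p * ((∫ x in ball3 r, f x ^ p) + (∫ x in ball3 r, g x ^ p) + ∫ x in ball3 r, h x ^ p) := by
        rw [ballInt_const_mul, ballInt_add (f := fun x => f x ^ p + g x ^ p) (cf.add cg) ch,
          ballInt_add cf cg]
    _ ≤ 3 ^ p * (M + M + M) := by gcongr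
    _ = _ := by rw [rpow_add (by norm_num), rpow_one]; ring

theorem ballInt_sum_three_le {f : Fin 3 → E3 → ℝ} (hf : ∀ j, Continuous (f j))
    (f0 : ∀ j x, 0 ≤ f j x) (hp : 0 < p) (b : ∀ j, ∫ x in ball3 r, f j x ^ p ≤ M) :
    ∫ x in ball3 r, (∑ j, f j x) ^ p ≤ 3 ^ (p + 1) * M := by
  simp only [Fin.sum_univ_three]
  exact ballInt_add_three_le (hf 0) (hf 1) (hf 2) (f0 0) (f0 1) (f0 2) hp (b 0) (b 1) (b 2)

namespace FieldSol

variable {U W B : Fin 3 → E3 → ℝ} {V : Fin 3 → Fin 3 → E3 → ℝ}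

theorem ballInt_size_le (hU : ∀ j, Continuous (U j)) (hW : ∀ j, Continuous (W j))
    (hB : ∀ j, Continuous (B j)) (hp : 0 < p) (bU : ∀ j, ∫ x in ball3 r, |U j x| ^ p ≤ M)
    (bW : ∀ j, ∫ x in ball3 r, |W j x| ^ p ≤ M) (bB : ∀ j, ∫ x in ball3 r, |B j x| ^ p ≤ M) :
    ∫ x in ball3 r, size U W B x ^ p ≤ 3 ^ (p + 1) * (3 ^ (p + 1) * M) :=
  ballInt_sum_three_le (f := fun j x => |U j x| + |W j x| + |B j x|)
    (fun j => ((hU j).abs.add (hW j).abs).add (hB j).abs) (fun _ _ => by positivity) hp fun j =>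
      ballInt_add_three_le (hU j).abs (hW j).abs (hB j).abs (fun _ => abs_nonneg _)
        (fun _ => abs_nonneg _) (fun _ => abs_nonneg _) hp (bU j) (bW j) (bB j)

theorem ballInt_msize_le (hV : ∀ j l, Continuous (V j l)) (hp : 0 < p)
    (b : ∀ j l, ∫ x in ball3 r, |V j l x| ^ p ≤ M) :
    ∫ x in ball3 r, msize V x ^ p ≤ 3 ^ (p + 1) * (3 ^ (p + 1) * M) :=
  ballInt_sum_three_le (f := fun j x => ∑ l, |V j l x|)
    (fun j => continuous_finsetSum _ fun l _ => (hV j l).abs)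
    (fun _ _ => Finset.sum_nonneg fun _ _ => abs_nonneg _) hp fun j =>
      ballInt_sum_three_le (f := fun l x => |V j l x|) (fun l => (hV j l).abs)
        (fun _ _ => abs_nonneg _) hp (b j)

theorem ballInt_dmsize_le (hV : ∀ j l, Sm (V j l)) (hp : 0 < p)
    (b : ∀ m j l, ∫ x in ball3 r, |pd m (V j l) x| ^ p ≤ M) :
    ∫ x in ball3 r, dmsize V x ^ p ≤ 3 ^ (p + 1) * (3 ^ (p + 1) * (3 ^ (p + 1) * M)) :=
  ballInt_sum_three_le (f := fun m => msize (fun j l => pd m (V j l)))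
    (fun m => continuous_msize fun j l => (hV j l).pd m) (fun _ _ => msize_nonneg _) hp fun m =>
      ballInt_msize_le (fun j l => ((hV j l).pd m).cont) hp (b m)

theorem size_mul {ζ : E3 → ℝ} (hζ : ∀ x, 0 ≤ ζ x) (x : E3) :
    ζ x * size U W B x =
      size (fun j x => ζ x * U j x) (fun j x => ζ x * W j x) (fun j x => ζ x * B j x) x := by
  simp only [size, abs_mul, abs_of_nonneg (hζ x), Finset.mul_sum, mul_add]

theorem dens_nonneg (x : E3) : 0 ≤ dens U W B x := by
  unfold dens
  have g : ∀ f : Fin 3 → E3 → ℝ, 0 ≤ ∑ j, ∑ i, pd i (f j) x ^ 2 := fun f =>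
    Finset.sum_nonneg fun _ _ => Finset.sum_nonneg fun _ _ => sq_nonneg _
  have w : 0 ≤ ∑ j, W j x ^ 2 := Finset.sum_nonneg fun _ _ => sq_nonneg _
  have := g U
  have := g W
  have := g B
  positivity

theorem sq_le_dens (i j : Fin 3) (x : E3) : pd i (U j) x ^ 2 ≤ 4 * dens U W B x ∧
    pd i (W j) x ^ 2 ≤ 4 * dens U W B x ∧ pd i (B j) x ^ 2 ≤ 4 * dens U W B x ∧
    W j x ^ 2 ≤ 4 * dens U W B x := by
  unfold dens
  have g : ∀ f : Fin 3 → E3 → ℝ, pd i (f j) x ^ 2 ≤ ∑ j, ∑ i, pd i (f j) x ^ 2 := fun f =>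
    (le_sum_three (f := fun i => pd i (f j) x ^ 2) (fun _ => sq_nonneg _) i).trans
      (le_sum_three (f := fun j => ∑ i, pd i (f j) x ^ 2)
        (fun _ => Finset.sum_nonneg fun _ _ => sq_nonneg _) j)
  have w := le_sum_three (f := fun j => W j x ^ 2) (fun _ => sq_nonneg _) j
  have gU := g U
  have gW := g W
  have gB := g B
  have := sq_nonneg (pd i (U j) x)
  have := sq_nonneg (pd i (W j) x)
  have := sq_nonneg (pd i (B j) x)
  have := sq_nonneg (W j x)
  refine ⟨?_, ?_, ?_, ?_⟩ <;> linarith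

theorem gsize_sq_le (x : E3) : gsize U W B x ^ 2 ≤ 10000 * dens U W B x := by
  set m := √(4 * dens U W B x) with hm
  have hs := fun i j => sq_le_dens (U := U) (W := W) (B := B) i j x
  have b1 : ∀ i j, |pd i (U j) x| ≤ m := fun i j => abs_le_sqrt (hs i j).1
  have b2 : ∀ i j, |pd i (W j) x| ≤ m := fun i j => abs_le_sqrt (hs i j).2.1
  have b3 : ∀ i j, |pd i (B j) x| ≤ m := fun i j => abs_le_sqrt (hs i j).2.2.1
  have b4 : ∀ j, |W j x| ≤ m := fun j => abs_le_sqrt (hs 0 j).2.2.2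
  have h1 : gsize U W B x ≤ 30 * m := by
    unfold gsize
    simp only [Fin.sum_univ_three]
    linarith [b1 0 0, b1 0 1, b1 0 2, b1 1 0, b1 1 1, b1 1 2, b1 2 0, b1 2 1, b1 2 2,
      b2 0 0, b2 0 1, b2 0 2, b2 1 0, b2 1 1, b2 1 2, b2 2 0, b2 2 1, b2 2 2,
      b3 0 0, b3 0 1, b3 0 2, b3 1 0, b3 1 1, b3 1 2, b3 2 0, b3 2 1, b3 2 2, b4 0, b4 1, b4 2]
  have h2 := pow_le_pow_left₀ (gsize_nonneg (U := U) (W := W) (B := B) x) h1 2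
  have d0 := dens_nonneg (U := U) (W := W) (B := B) x
  rw [mul_pow, sq_sqrt (by positivity)] at h2
  linarith

end FieldSol

end SumBounds

theorem exists_local_bounds {s K C₀ : ℝ} (hs : 3 < s) (hs6 : s ≤ 6) (hK : 0 ≤ K) :
    ∃ C : ℝ, 1 ≤ C ∧ ∀ f F, HasPot s K f F → ∀ e : E3 → ℝ, Continuous e → (∀ x, 0 ≤ e x) →
      (∀ i x, pd i f x ^ 2 ≤ 4 * e x) → ∀ r ρ d : ℝ, 1 < r → 0 < ρ → 0 < d → d ≤ r →
      ρ + 10 * d ≤ 2 * r →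
      (∫ x in ball3 (ρ + 9 * d), f x ^ 2 ≤ C * (r / d) ^ 4 * d ^ 2 *
        (r ^ (-1 / 3 : ℝ) * (1 + ∫ x in ball3 (ρ + 10 * d), e x) ^ (1 / 2 : ℝ))) ∧
      ∀ ζ : E3 → ℝ, Sm ζ → (∀ x, 0 ≤ ζ x) → (∀ x, ζ x ≤ 1) → (∀ x i, |pd i ζ x| ≤ C₀ / d) →
      ∀ b T : ℝ, b ≤ ρ + 9 * d → (∀ x, b ≤ ‖x‖ → ζ x = 0) → (∀ x i, b ≤ ‖x‖ → pd i ζ x = 0) →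
      ∫ x in ball3 b, ζ x ^ 2 * e x ≤ T →
      r ^ (-1 / 3 : ℝ) * (1 + ∫ x in ball3 (ρ + 10 * d), e x) ^ (1 / 2 : ℝ) ≤ T →
      (∫ x in ball3 b, (ζ x * f x) ^ 6 ≤ C * (r / d) ^ 12 * T ^ 3) ∧
      ∫ x in ball3 b, |ζ x * f x| ^ 3 ≤ C * r * (r / d) ^ 4 * T ^ (9 / (s + 6)) := by
  obtain ⟨C₁, hC₁, H₁⟩ := exists_l2_bound hs hs6 hK
  obtain ⟨C₂, hC₂, H₂⟩ := exists_cubic_bound (C₀ := C₀) hs hs6 hK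
  refine ⟨64 * C₂ * C₁ ^ 3, ?_, fun f F hf e ce e0 hfe r ρ d hr hρ hd hdr hρd => ?_⟩
  · have := one_le_pow₀ (n := 3) hC₁
    nlinarith
  have hr0 : 0 < r := by linarith
  have hq : 1 ≤ r / d := (one_le_div hd).2 hdr
  set E := ∫ x in ball3 (ρ + 10 * d), e x with hE
  have hE0 : 0 ≤ E := setIntegral_ball_nonneg fun x _ => e0 x
  have smf := hf.sm
  set Y := r ^ (-1 / 3 : ℝ) * (1 + E) ^ (1 / 2 : ℝ) with hY
  have hY0 : 0 ≤ Y := by positivity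
  have c3 : C₁ ≤ C₁ ^ 3 := le_self_pow₀ hC₁ (by norm_num)
  have l2 : ∫ x in ball3 (ρ + 9 * d), f x ^ 2 ≤ 4 * C₁ * (r / d) ^ 4 * d ^ 2 * Y := by
    have h := H₁ f F hf r (ρ + 9 * d) (ρ + 10 * d) (4 * E) hr (by positivity) (by linarith) hρd
      (by linarith) (by positivity) fun i => by
        rw [hE, ← ballInt_const_mul]
        exact setIntegral_ball_mono ((smf.pd i).cont.pow 2) (continuous_const.mul ce)
          fun x _ => hfe i x
    refine h.trans ?_
    have e1 : (1 + 4 * E) ^ (1 / 2 : ℝ) ≤ 4 * (1 + E) ^ (1 / 2 : ℝ) := by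
      calc (1 + 4 * E) ^ (1 / 2 : ℝ) ≤ (4 ^ 2 * (1 + E)) ^ (1 / 2 : ℝ) := by
            gcongr; linarith
        _ = _ := by
            rw [mul_rpow (by norm_num) (by positivity), sq_rpow_half, abs_of_pos (by norm_num)]
    have e2 : r ^ (5 / 3 : ℝ) = r ^ 2 * r ^ (-1 / 3 : ℝ) := by
      rw [← rpow_natCast r 2, ← rpow_add hr0]; norm_num
    have e3 : r ^ 2 = (r / d) ^ 2 * d ^ 2 := by rw [div_pow]; field_simp
    rw [show ρ + 10 * d - (ρ + 9 * d) = d by ring, e2, e3]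
    calc C₁ * (r / d) ^ 2 * ((r / d) ^ 2 * d ^ 2 * r ^ (-1 / 3 : ℝ)) * (1 + 4 * E) ^ (1 / 2 : ℝ) ≤
          C₁ * (r / d) ^ 2 * ((r / d) ^ 2 * d ^ 2 * r ^ (-1 / 3 : ℝ)) *
            (4 * (1 + E) ^ (1 / 2 : ℝ)) := mul_le_mul_of_nonneg_left e1 (by positivity)
      _ = _ := by rw [hY]; ring
  constructor
  · refine l2.trans ?_
    have : 4 * C₁ ≤ 64 * C₂ * C₁ ^ 3 := by nlinarith
    gcongr
  intro ζ hζ ζ0 ζ1 hpd b T hb hζb hpb hT hYT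
  have hT0 : 0 ≤ T := hY0.trans hYT
  set T₁ := 4 * C₁ * (r / d) ^ 4 * T with hT₁
  have q4 := one_le_pow₀ (n := 4) hq
  have h1 : 4 * T ≤ T₁ := by
    rw [hT₁]
    have : 1 ≤ C₁ * (r / d) ^ 4 := one_le_mul_of_one_le_of_one_le hC₁ q4
    nlinarith
  obtain ⟨a1, a2⟩ := H₂ f F hf ζ hζ ζ0 ζ1 r d b T₁ hr hd (by linarith) (by positivity) hpd hζb hpb
    (fun i => by
      refine le_trans ?_ h1
      refine le_trans ?_ (mul_le_mul_of_nonneg_left hT (by norm_num : (0 : ℝ) ≤ 4))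
      rw [← ballInt_const_mul]
      refine setIntegral_ball_mono ((hζ.cont.mul (smf.pd i).cont).pow 2)
        (continuous_const.mul ((hζ.cont.pow 2).mul ce)) fun x _ => ?_
      nlinarith [mul_le_mul_of_nonneg_left (hfe i x) (sq_nonneg (ζ x))])
    ((setIntegral_ball_mono_set (smf.cont.pow 2) (fun _ => sq_nonneg _) hb).trans (l2.trans (by
      rw [hT₁]
      calc 4 * C₁ * (r / d) ^ 4 * d ^ 2 * Y ≤ 4 * C₁ * (r / d) ^ 4 * d ^ 2 * T := by gcongr
        _ = _ := by ring)))
  have θ1 : 9 / (s + 6) ≤ 1 := (div_le_one (by linarith)).2 (by linarith)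
  have θ0 : 0 ≤ 9 / (s + 6) := by positivity
  refine ⟨a1.trans (le_of_eq ?_), a2.trans ?_⟩
  · rw [hT₁]; ring
  · have h4 : (4 * C₁ * (r / d) ^ 4) ^ (9 / (s + 6)) ≤ 4 * C₁ * (r / d) ^ 4 :=
      rpow_le_self_of_one_le (by nlinarith) θ1
    rw [hT₁, mul_rpow (by positivity) hT0]
    calc C₂ * r * ((4 * C₁ * (r / d) ^ 4) ^ (9 / (s + 6)) * T ^ (9 / (s + 6))) ≤
          C₂ * r * (4 * C₁ * (r / d) ^ 4 * T ^ (9 / (s + 6))) := by gcongr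
      _ = 4 * C₂ * C₁ * (r * (r / d) ^ 4 * T ^ (9 / (s + 6))) := by ring
      _ ≤ 64 * C₂ * C₁ ^ 3 * (r * (r / d) ^ 4 * T ^ (9 / (s + 6))) := by
          gcongr; norm_num
      _ = _ := by ring

theorem rpow_half_mul_le {X Z w : ℝ} (hX : 0 ≤ X) (hZ : 0 ≤ Z) (hw : 0 ≤ w) (h : X * Z ≤ w ^ 2) :
    X ^ (1 / 2 : ℝ) * Z ^ (1 / 2 : ℝ) ≤ w := by
  rw [← mul_rpow hX hZ]
  refine (rpow_le_rpow (by positivity) h (by norm_num)).trans_eq ?_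
  rw [sq_rpow_half, abs_of_nonneg hw]

namespace FieldSol

theorem integral_bdry_le {U W B : Fin 3 → E3 → ℝ} {V : Fin 3 → Fin 3 → E3 → ℝ} {ζ : E3 → ℝ}
    {s a a' b X₁ X₃ X₆ Y₁ Y₂ Z D : ℝ} (hs : 3 < s) (hs6 : s ≤ 6) (hU : ∀ j, Sm (U j))
    (hW : ∀ j, Sm (W j)) (hB : ∀ j, Sm (B j)) (hV : ∀ j l, Sm (V j l)) (hζ : Continuous ζ)
    (ζ0 : ∀ x, 0 ≤ ζ x) (hζb : ∀ x, b ≤ ‖x‖ → ζ x = 0) (ha : 0 ≤ a) (ha' : 0 ≤ a')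
    (h1 : ∫ x in ball3 b, size U W B x ^ 2 ≤ X₁) (h3 : ∫ x in ball3 b, (ζ x * size U W B x) ^ 3 ≤ X₃)
    (h6 : ∫ x in ball3 b, (ζ x * size U W B x) ^ 6 ≤ X₆) (hD : ∫ x in ball3 b, (ζ x * gsize U W B x) ^ 2 ≤ D)
    (hY₁ : ∫ x in ball3 b, msize V x ^ 2 ≤ Y₁) (hY₂ : ∫ x in ball3 b, dmsize V x ^ 2 ≤ Y₂)
    (hZ : ∫ x in ball3 b, msize V x ^ s ≤ Z) :
    ∫ x, bdry U W B V ζ a a' x ≤ a * (X₁ ^ (1 / 2 : ℝ) * D ^ (1 / 2 : ℝ)) + a * X₃ +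
      (a * (Y₂ ^ (1 / 2 : ℝ) * D ^ (1 / 2 : ℝ)) + a' * (Y₁ ^ (1 / 2 : ℝ) * D ^ (1 / 2 : ℝ))) +
      a * (Z ^ (1 / s) * D ^ (1 / 2 : ℝ) * X₃ ^ (2 / 3 - 2 / s) * X₆ ^ (1 / s - 1 / 6)) := by
  have cS := continuous_size hU hW hB
  have cG : Continuous fun x => ζ x * gsize U W B x := hζ.mul (continuous_gsize hU hW hB)
  have cH : Continuous fun x => ζ x * size U W B x := hζ.mul cS
  have cV := continuous_msize hV
  have cDV := continuous_dmsize hV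
  have S0 := size_nonneg (U := U) (W := W) (B := B)
  have G0 := fun x => mul_nonneg (ζ0 x) (gsize_nonneg (U := U) (W := W) (B := B) x)
  have H0 := fun x => mul_nonneg (ζ0 x) (S0 x)
  have V0 := msize_nonneg (V := V)
  have DV0 := dmsize_nonneg (V := V)
  have s0 : 0 < s := by linarith
  have i1 : 0 ≤ 2 / 3 - 2 / s := by
    rw [sub_nonneg, div_le_div_iff₀ s0 (by norm_num)]; linarith
  have i2 : 0 ≤ 1 / s - 1 / 6 := by
    rw [sub_nonneg]; exact one_div_le_one_div_of_le s0 hs6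
  have cs : ∀ {f : E3 → ℝ} {X : ℝ}, Continuous f → (∀ x, 0 ≤ f x) → (∫ x in ball3 b, f x ^ 2) ≤ X →
      ∫ x in ball3 b, f x * (ζ x * gsize U W B x) ≤ X ^ (1 / 2 : ℝ) * D ^ (1 / 2 : ℝ) := by
    intro f X cf f0 hX
    have h := cauchy_schwarz_ball cf cG b
    simp only [abs_of_nonneg (f0 _), abs_of_nonneg (G0 _)] at h
    refine h.trans ?_
    have n1 : 0 ≤ ∫ x in ball3 b, f x ^ 2 := setIntegral_ball_nonneg fun _ _ => sq_nonneg _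
    have n2 : 0 ≤ ∫ x in ball3 b, (ζ x * gsize U W B x) ^ 2 :=
      setIntegral_ball_nonneg fun _ _ => sq_nonneg _
    exact mul_le_mul (rpow_le_rpow n1 hX (by norm_num)) (rpow_le_rpow n2 hD (by norm_num))
      (by positivity) (rpow_nonneg (n1.trans hX) _)
  have k1 := cs cS S0 h1
  have k2 := cs cDV DV0 hY₂
  have k3 := cs cV V0 hY₁
  have k4 : ∫ x in ball3 b, msize V x * (ζ x * gsize U W B x) * (ζ x * size U W B x) ≤
      Z ^ (1 / s) * D ^ (1 / 2 : ℝ) * X₃ ^ (2 / 3 - 2 / s) * X₆ ^ (1 / s - 1 / 6) := by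
    have h := trilinear_ball hs hs6 cV cG cH b
    simp only [abs_of_nonneg (V0 _), abs_of_nonneg (G0 _), abs_of_nonneg (H0 _)] at h
    refine h.trans ?_
    have n1 : 0 ≤ ∫ x in ball3 b, msize V x ^ s :=
      setIntegral_ball_nonneg fun x _ => rpow_nonneg (V0 x) _
    have n2 : 0 ≤ ∫ x in ball3 b, (ζ x * gsize U W B x) ^ 2 :=
      setIntegral_ball_nonneg fun _ _ => sq_nonneg _
    have n3 : 0 ≤ ∫ x in ball3 b, (ζ x * size U W B x) ^ 3 :=
      setIntegral_ball_nonneg fun x _ => pow_nonneg (H0 x) _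
    have n4 : 0 ≤ ∫ x in ball3 b, (ζ x * size U W B x) ^ 6 :=
      setIntegral_ball_nonneg fun x _ => pow_nonneg (H0 x) _
    have m1 := rpow_le_rpow n1 hZ (by positivity : 0 ≤ 1 / s)
    have m2 := rpow_le_rpow n2 hD (by norm_num : (0 : ℝ) ≤ 1 / 2)
    have m3 := rpow_le_rpow n3 h3 i1
    have m4 := rpow_le_rpow n4 h6 i2
    have z0 := rpow_nonneg (n1.trans hZ) (1 / s)
    have z1 := rpow_nonneg (n2.trans hD) (1 / 2)
    have z2 := rpow_nonneg (n3.trans h3) (2 / 3 - 2 / s)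
    exact mul_le_mul (mul_le_mul (mul_le_mul m1 m2 (by positivity) z0) m3 (by positivity)
      (by positivity)) m4 (by positivity) (by positivity)
  have e0 : ∫ x, bdry U W B V ζ a a' x = ∫ x in ball3 b, bdry U W B V ζ a a' x :=
    integral_eq_ball fun x hx => by simp only [bdry, hζb x hx]; ring
  have c1 : Continuous fun x => size U W B x * (ζ x * gsize U W B x) := cS.mul cG
  have c2 : Continuous fun x => (ζ x * size U W B x) ^ 3 := cH.pow 3
  have c3 : Continuous fun x => dmsize V x * (ζ x * gsize U W B x) := cDV.mul cG
  have c4 : Continuous fun x => msize V x * (ζ x * gsize U W B x) := cV.mul cG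
  have c5 : Continuous fun x => msize V x * (ζ x * gsize U W B x) * (ζ x * size U W B x) := c4.mul cH
  have d1 : Continuous fun x => a * (size U W B x * (ζ x * gsize U W B x)) := continuous_const.mul c1
  have d2 : Continuous fun x => a * (ζ x * size U W B x) ^ 3 := continuous_const.mul c2
  have d3 : Continuous fun x => a * (dmsize V x * (ζ x * gsize U W B x)) := continuous_const.mul c3
  have d4 : Continuous fun x => a' * (msize V x * (ζ x * gsize U W B x)) := continuous_const.mul c4
  have d5 : Continuous fun x => a * (msize V x * (ζ x * gsize U W B x) * (ζ x * size U W B x)) :=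
    continuous_const.mul c5
  have e1 : ∀ x, bdry U W B V ζ a a' x = a * (size U W B x * (ζ x * gsize U W B x)) +
      a * (ζ x * size U W B x) ^ 3 + a * (dmsize V x * (ζ x * gsize U W B x)) +
      a' * (msize V x * (ζ x * gsize U W B x)) +
      a * (msize V x * (ζ x * gsize U W B x) * (ζ x * size U W B x)) := fun x => by
    rw [bdry]; ring
  have d12 : Continuous fun x => a * (size U W B x * (ζ x * gsize U W B x)) +
      a * (ζ x * size U W B x) ^ 3 := d1.add d2
  have d123 : Continuous fun x => a * (size U W B x * (ζ x * gsize U W B x)) +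
      a * (ζ x * size U W B x) ^ 3 +
      a * (dmsize V x * (ζ x * gsize U W B x)) := d12.add d3
  have d1234 : Continuous fun x => a * (size U W B x * (ζ x * gsize U W B x)) +
      a * (ζ x * size U W B x) ^ 3 +
      a * (dmsize V x * (ζ x * gsize U W B x)) +
      a' * (msize V x * (ζ x * gsize U W B x)) := d123.add d4
  simp_rw [e0, e1]
  rw [ballInt_add d1234 d5, ballInt_add d123 d4, ballInt_add d12 d3, ballInt_add d1 d2]
  simp only [ballInt_const_mul]
  have l1 := mul_le_mul_of_nonneg_left k1 ha
  have l2 := mul_le_mul_of_nonneg_left h3 ha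
  have l3 := mul_le_mul_of_nonneg_left k2 ha
  have l4 := mul_le_mul_of_nonneg_left k3 ha'
  have l5 := mul_le_mul_of_nonneg_left k4 ha
  linarith

end FieldSol

theorem abs_rpow_le_sq_add_pow_six {s : ℝ} (hs : 2 ≤ s) (hs6 : s ≤ 6) (x : ℝ) :
    |x| ^ s ≤ x ^ 2 + x ^ 6 := by
  rw [← sq_abs, ← Even.pow_abs (by decide : Even 6) x]
  rcases le_total |x| 1 with h | h
  · rcases (abs_nonneg x).eq_or_lt with h0 | h0
    · rw [← h0, zero_rpow (by linarith)]; positivity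
    · have := rpow_le_rpow_of_exponent_ge h0 h hs
      rw [rpow_ofNat] at this
      linarith [pow_nonneg (abs_nonneg x) 6]
  · have := rpow_le_rpow_of_exponent_le h hs6
    rw [rpow_ofNat] at this
    linarith [pow_nonneg (abs_nonneg x) 2]

theorem exists_rescaled_bound {s K : ℝ} (hs : 3 < s) (hs6 : s ≤ 6) (hK : 0 ≤ K) :
    ∃ C : ℝ, 1 ≤ C ∧ ∀ f F, HasPot s K f F → ∀ e : E3 → ℝ, Continuous e → (∀ x, 0 ≤ e x) →
      (∀ i x, pd i f x ^ 2 ≤ 4 * e x) → ∀ (r ρ d : ℝ) (n : ℕ), 1 < r → 0 < ρ → 0 < d → d ≤ r →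
      ρ + 10 * d ≤ 2 * r → C * (r / d) ^ 4 * (r * (1 + ∫ x in ball3 (ρ + 10 * d), e x)) ≤ 2 ^ n →
      (d / 2 ^ n) ^ s * ∫ x in ball3 (ρ + 7 * d), |f x| ^ s ≤ r ^ (2 + s / 3) := by
  obtain ⟨C₁, hC₁, hcut⟩ := exists_cut
  obtain ⟨C₂, hC₂, H⟩ := exists_local_bounds (C₀ := C₁) hs hs6 hK
  refine ⟨2 * C₂, by linarith, fun f F hf e ce e0 hfe r ρ d n hr hρ hd hdr hρd hn => ?_⟩
  obtain ⟨a1, a2⟩ := H f F hf e ce e0 hfe r ρ d hr hρ hd hdr hρd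
  obtain ⟨χ, hχ⟩ := hcut (ρ + 7 * d) (ρ + 8 * d) (by positivity) (by linarith)
  set E := ∫ x in ball3 (ρ + 10 * d), e x with hE
  have hE0 : 0 ≤ E := setIntegral_ball_nonneg fun x _ => e0 x
  have hr0 : 0 < r := by linarith
  have hq : 1 ≤ r / d := (one_le_div hd).2 hdr
  have cf := hf.sm.cont
  have hY : r ^ (-1 / 3 : ℝ) * (1 + E) ^ (1 / 2 : ℝ) ≤ 1 + E := by
    have h1 : r ^ (-1 / 3 : ℝ) ≤ 1 := rpow_le_one_of_one_le_of_nonpos hr.le (by norm_num)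
    have h2 : (1 + E) ^ (1 / 2 : ℝ) ≤ 1 + E := rpow_le_self_of_one_le (by linarith) (by norm_num)
    calc _ ≤ 1 * (1 + E) := mul_le_mul h1 h2 (by positivity) (by norm_num)
      _ = _ := one_mul _
  obtain ⟨b6, -⟩ := a2 χ hχ.smooth hχ.nonneg hχ.le_one
    (fun x i => by
      have := hχ.pd_le x i
      rwa [show ρ + 8 * d - (ρ + 7 * d) = d by ring] at this) (ρ + 8 * d) (1 + E) (by linarith)
    hχ.eq_zero hχ.pd_out (by
      have h1 : ∫ x in ball3 (ρ + 8 * d), χ x ^ 2 * e x ≤ ∫ x in ball3 (ρ + 8 * d), e x :=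
        setIntegral_ball_mono ((hχ.smooth.cont.pow 2).mul ce) ce fun x _ =>
          mul_le_of_le_one_left (e0 x) (pow_le_one₀ (hχ.nonneg x) (hχ.le_one x))
      have h2 := setIntegral_ball_mono_set ce e0 (show ρ + 8 * d ≤ ρ + 10 * d by linarith)
      linarith) hY
  have c6 : ∫ x in ball3 (ρ + 7 * d), f x ^ 6 ≤ C₂ * (r / d) ^ 12 * (1 + E) ^ 3 := by
    refine le_trans ?_ b6
    have c : Continuous fun x => (χ x * f x) ^ 6 := (hχ.smooth.cont.mul cf).pow 6
    refine le_trans (setIntegral_ball_mono (cf.pow 6) c fun x hx => ?_)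
      (setIntegral_ball_mono_set c (fun x => Even.pow_nonneg (by decide) _) (by linarith))
    rw [hχ.eq_one x hx.le, one_mul]
  have c2 : ∫ x in ball3 (ρ + 7 * d), f x ^ 2 ≤ C₂ * (r / d) ^ 12 * r ^ 2 * (1 + E) ^ 3 := by
    refine (setIntegral_ball_mono_set (cf.pow 2) (fun x => sq_nonneg _)
      (show ρ + 7 * d ≤ ρ + 9 * d by linarith)).trans (a1.trans ?_)
    have h1 : (r / d) ^ 4 ≤ (r / d) ^ 12 := pow_le_pow_right₀ hq (by norm_num)
    have h2 : 1 + E ≤ (1 + E) ^ 3 := le_self_pow₀ (by linarith) (by norm_num)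
    gcongr
    exact hY.trans h2
  have cs : ∫ x in ball3 (ρ + 7 * d), |f x| ^ s ≤ 2 * C₂ * (r / d) ^ 12 * r ^ 2 * (1 + E) ^ 3 := by
    refine (setIntegral_ball_mono (cf.abs.rpow_const fun _ => .inr (by linarith))
      ((cf.pow 2).add (cf.pow 6)) fun x _ =>
        abs_rpow_le_sq_add_pow_six (by linarith) hs6 (f x)).trans ?_
    have h := ballInt_add (f := fun x => f x ^ 2) (g := fun x => f x ^ 6) (cf.pow 2) (cf.pow 6)
      (ρ + 7 * d)
    refine h.le.trans ?_
    have h1 : C₂ * (r / d) ^ 12 * (1 + E) ^ 3 ≤ C₂ * (r / d) ^ 12 * (1 + E) ^ 3 * r ^ 2 :=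
      le_mul_of_one_le_right (by positivity) (one_le_pow₀ hr.le)
    nlinarith
  set G := 2 * C₂ * (r / d) ^ 4 * (1 + E) with hG
  have hG1 : 1 ≤ G := one_le_mul_of_one_le_of_one_le
    (one_le_mul_of_one_le_of_one_le (by linarith) (one_le_pow₀ hq)) (by linarith)
  have hdn : d / 2 ^ n ≤ G⁻¹ := by
    rw [div_le_iff₀ (by positivity), inv_mul_eq_div, le_div_iff₀ (by positivity)]
    calc d * G ≤ r * G := by gcongr
      _ = 2 * C₂ * (r / d) ^ 4 * (r * (1 + E)) := by rw [hG]; ring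
      _ ≤ _ := hn
  have hds : (d / 2 ^ n) ^ s ≤ (G ^ 3)⁻¹ := by
    calc (d / 2 ^ n) ^ s ≤ (G⁻¹) ^ s := rpow_le_rpow (by positivity) hdn (by linarith)
      _ ≤ (G⁻¹) ^ (3 : ℝ) := rpow_le_rpow_of_exponent_ge (by positivity) (inv_le_one_of_one_le₀ hG1)
          hs.le
      _ = _ := by rw [rpow_ofNat, inv_pow]
  have n0 : 0 ≤ ∫ x in ball3 (ρ + 7 * d), |f x| ^ s := setIntegral_ball_nonneg fun _ _ => by positivity
  calc (d / 2 ^ n) ^ s * ∫ x in ball3 (ρ + 7 * d), |f x| ^ s ≤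
        (G ^ 3)⁻¹ * (2 * C₂ * (r / d) ^ 12 * r ^ 2 * (1 + E) ^ 3) :=
        mul_le_mul hds cs n0 (by positivity)
    _ ≤ (G ^ 3)⁻¹ * (G ^ 3 * r ^ 2) := by
        refine mul_le_mul_of_nonneg_left ?_ (by positivity)
        rw [hG]
        calc 2 * C₂ * (r / d) ^ 12 * r ^ 2 * (1 + E) ^ 3 ≤
              (2 * C₂) ^ 3 * (r / d) ^ 12 * r ^ 2 * (1 + E) ^ 3 := by
              gcongr
              exact le_self_pow₀ (by linarith) (by norm_num)
          _ = _ := by ring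
    _ = r ^ 2 := by field_simp
    _ ≤ r ^ (2 + s / 3) := by
        rw [← rpow_natCast]
        exact rpow_le_rpow_of_exponent_le hr.le (by push_cast; linarith)

theorem trilinear_scaling {C n q r T s : ℝ} (hs : 0 < s) (hC : 0 < C) (hn : 0 < n) (hq : 0 < q)
    (hr : 0 < r) (hT : 0 < T) :
    (C * n ^ (s - 2) * q ^ 24 * r ^ (2 + s / 3)) ^ (1 / s) * (C * T) ^ (1 / 2 : ℝ) *
      (C * r * q ^ 4 * T ^ (9 / (s + 6))) ^ (2 / 3 - 2 / s) *
      (C * q ^ 12 * T ^ 3) ^ (1 / s - 1 / 6) =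
    C * n ^ ((s - 2) / s) * r * q ^ (28 / s + 2 / 3) * T ^ (9 / (s + 6)) := by
  rw [← exp_log hC, ← exp_log hn, ← exp_log hq, ← exp_log hr, ← exp_log hT]
  simp only [← exp_nat_mul, ← exp_mul, ← exp_add]
  congr 1
  field_simp
  push_cast
  ring

/-- The combination of all the scaled bounds entering the local energy inequality. -/
theorem boundary_terms_le {C n r d s D Y T : ℝ} (hs : 3 < s) (hC : 1 ≤ C) (hn : 1 ≤ n)
    (hr : 1 < r) (hd : 0 < d) (hdr : d ≤ r) (hD : 0 ≤ D) (hDT : D ≤ T) (hY : 0 < Y) (hYT : Y ≤ T)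
    (hDY : D * Y ≤ (T ^ (9 / (s + 6))) ^ 2) :
    C / d * ((C * (r / d) ^ 4 * d ^ 2 * Y) ^ (1 / 2 : ℝ) * (C * D) ^ (1 / 2 : ℝ)) +
      C / d * (C * r * (r / d) ^ 4 * T ^ (9 / (s + 6))) +
      (C / d * ((C * (r / d) ^ 12 * d ^ 2 * Y) ^ (1 / 2 : ℝ) * (C * D) ^ (1 / 2 : ℝ)) +
        C / d ^ 2 * ((C * (n ^ ((s - 2) / s)) ^ 2 * (r / d) ^ 20 * d ^ 4 * Y) ^ (1 / 2 : ℝ) *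
          (C * D) ^ (1 / 2 : ℝ))) +
      C / d * ((C * n ^ (s - 2) * (r / d) ^ 24 * r ^ (2 + s / 3)) ^ (1 / s) * (C * D) ^ (1 / 2 : ℝ) *
        (C * r * (r / d) ^ 4 * T ^ (9 / (s + 6))) ^ (2 / 3 - 2 / s) *
        (C * (r / d) ^ 12 * T ^ 3) ^ (1 / s - 1 / 6)) ≤
    5 * C ^ 2 * n ^ ((s - 2) / s) * (r / d) ^ 13 * T ^ (9 / (s + 6)) := by
  have s0 : 0 < s := by linarith
  have hT : 0 < T := hY.trans_le hYT
  have hr0 : 0 < r := by linarith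
  have hq : 1 ≤ r / d := (one_le_div hd).2 hdr
  have hN : 1 ≤ n ^ ((s - 2) / s) := one_le_rpow hn (div_nonneg (by linarith) s0.le)
  have tri := trilinear_scaling (C := C) (n := n) (q := r / d) (r := r) (T := T) s0 (by linarith)
    (by linarith) (by positivity) hr0 hT
  set q := r / d with hqd
  set N := n ^ ((s - 2) / s) with hNd
  set τ := T ^ (9 / (s + 6)) with hτ
  have τ0 : 0 < τ := by positivity
  have rq : r = q * d := by rw [hqd]; field_simp
  have pw : ∀ k : ℕ, k ≤ 13 → q ^ k ≤ N * q ^ 13 := fun k hk =>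
    (pow_le_pow_right₀ hq hk).trans (le_mul_of_one_le_left (by positivity) hN)
  have half : ∀ A w : ℝ, 0 ≤ A → 0 ≤ w → A = w ^ 2 →
      (C * A * Y) ^ (1 / 2 : ℝ) * (C * D) ^ (1 / 2 : ℝ) ≤ C * w * τ := fun A w hA hw h =>
    rpow_half_mul_le (by positivity) (by positivity) (by positivity) (by
      rw [h]
      calc C * w ^ 2 * Y * (C * D) = (C * w) ^ 2 * (D * Y) := by ring
        _ ≤ (C * w) ^ 2 * τ ^ 2 := by gcongr
        _ = _ := by ring)
  have base : ∀ k : ℕ, k ≤ 13 → C * C * q ^ k * τ ≤ C ^ 2 * N * q ^ 13 * τ := fun k hk => by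
    have := pw k hk
    calc C * C * q ^ k * τ ≤ C * C * (N * q ^ 13) * τ := by gcongr
      _ = _ := by ring
  have t1 : C / d * ((C * q ^ 4 * d ^ 2 * Y) ^ (1 / 2 : ℝ) * (C * D) ^ (1 / 2 : ℝ)) ≤
      C ^ 2 * N * q ^ 13 * τ := by
    refine le_trans ?_ (base 2 (by norm_num))
    have h := half (q ^ 4 * d ^ 2) (q ^ 2 * d) (by positivity) (by positivity) (by ring)
    rw [← mul_assoc] at h
    calc _ ≤ C / d * (C * (q ^ 2 * d) * τ) := by gcongr
      _ = _ := by field_simp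
  have t2 : C / d * (C * r * q ^ 4 * τ) ≤ C ^ 2 * N * q ^ 13 * τ := by
    refine le_trans (le_of_eq ?_) (base 5 (by norm_num))
    rw [rq]; field_simp
  have t3 : C / d * ((C * q ^ 12 * d ^ 2 * Y) ^ (1 / 2 : ℝ) * (C * D) ^ (1 / 2 : ℝ)) ≤
      C ^ 2 * N * q ^ 13 * τ := by
    refine le_trans ?_ (base 6 (by norm_num))
    have h := half (q ^ 12 * d ^ 2) (q ^ 6 * d) (by positivity) (by positivity) (by ring)
    rw [← mul_assoc] at h
    calc _ ≤ C / d * (C * (q ^ 6 * d) * τ) := by gcongr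
      _ = _ := by field_simp
  have t4 : C / d ^ 2 * ((C * N ^ 2 * q ^ 20 * d ^ 4 * Y) ^ (1 / 2 : ℝ) * (C * D) ^ (1 / 2 : ℝ)) ≤
      C ^ 2 * N * q ^ 13 * τ := by
    have h := half (N ^ 2 * q ^ 20 * d ^ 4) (N * q ^ 10 * d ^ 2) (by positivity) (by positivity)
      (by ring)
    rw [show C * (N ^ 2 * q ^ 20 * d ^ 4) * Y = C * N ^ 2 * q ^ 20 * d ^ 4 * Y by ring] at h
    have p := pow_le_pow_right₀ hq (show 10 ≤ 13 by norm_num)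
    calc _ ≤ C / d ^ 2 * (C * (N * q ^ 10 * d ^ 2) * τ) := by gcongr
      _ = C ^ 2 * N * q ^ 10 * τ := by field_simp
      _ ≤ _ := by gcongr
  have t5 : C / d * ((C * n ^ (s - 2) * q ^ 24 * r ^ (2 + s / 3)) ^ (1 / s) * (C * D) ^ (1 / 2 : ℝ) *
        (C * r * q ^ 4 * τ) ^ (2 / 3 - 2 / s) * (C * q ^ 12 * T ^ 3) ^ (1 / s - 1 / 6)) ≤
      C ^ 2 * N * q ^ 13 * τ := by
    have e : q ^ (28 / s + 2 / 3) ≤ q ^ 10 := by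
      rw [← rpow_natCast]
      refine rpow_le_rpow_of_exponent_le hq ?_
      have : 28 / s ≤ 28 / 3 := by gcongr
      push_cast; linarith
    have p := pow_le_pow_right₀ hq (show 11 ≤ 13 by norm_num)
    have dD : (C * D) ^ (1 / 2 : ℝ) ≤ (C * T) ^ (1 / 2 : ℝ) := by gcongr
    calc _ ≤ C / d * ((C * n ^ (s - 2) * q ^ 24 * r ^ (2 + s / 3)) ^ (1 / s) *
          (C * T) ^ (1 / 2 : ℝ) *
          (C * r * q ^ 4 * τ) ^ (2 / 3 - 2 / s) * (C * q ^ 12 * T ^ 3) ^ (1 / s - 1 / 6)) := by gcongr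
      _ = C / d * (C * N * r * q ^ (28 / s + 2 / 3) * τ) := by rw [tri]
      _ ≤ C / d * (C * N * r * q ^ 10 * τ) := by gcongr
      _ = C ^ 2 * N * q ^ 11 * τ := by rw [rq]; field_simp
      _ ≤ _ := by gcongr
  linarith

open FieldSol in
theorem exists_potential_bounds {s K : ℝ} (hs : 3 < s) (hs6 : s ≤ 6) (hK : 0 ≤ K) :
    ∃ C : ℝ, 1 ≤ C ∧ ∀ (u : Fin 3 → E3 → ℝ) (F : Fin 3 → Fin 3 → E3 → ℝ),
      (∀ l, HasPot s K (u l) (F l)) → (∀ x, ∑ l, pd l (u l) x = 0) →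
      ∀ e : E3 → ℝ, Continuous e → (∀ x, 0 ≤ e x) → (∀ i l x, pd i (u l) x ^ 2 ≤ 4 * e x) →
      ∀ (r ρ d Y : ℝ) (n : ℕ), 1 < r → 0 < ρ → 0 < d → d ≤ r → ρ + 10 * d ≤ 2 * r → 1 ≤ n →
      C * (r / d) ^ 4 * (r * (1 + ∫ x in ball3 (ρ + 10 * d), e x)) ≤ 2 ^ n →
      Y = r ^ (-1 / 3 : ℝ) * (1 + ∫ x in ball3 (ρ + 10 * d), e x) ^ (1 / 2 : ℝ) →
      ∃ V : Fin 3 → Fin 3 → E3 → ℝ, (∀ j l, Sm (V j l)) ∧ (∀ j l x, V j l x = -V l j x) ∧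
        (∀ l x, ∑ j, pd j (V j l) x = u l x) ∧
        (∫ x in ball3 (ρ + 6 * d), msize V x ^ 2 ≤
          C * ((n : ℝ) ^ ((s - 2) / s)) ^ 2 * (r / d) ^ 20 * d ^ 4 * Y) ∧
        (∫ x in ball3 (ρ + 6 * d), dmsize V x ^ 2 ≤ C * (r / d) ^ 12 * d ^ 2 * Y) ∧
        ∫ x in ball3 (ρ + 6 * d), msize V x ^ s ≤
          C * (n : ℝ) ^ (s - 2) * (r / d) ^ 24 * r ^ (2 + s / 3) := by
  obtain ⟨C₁, hC₁, H₁⟩ := exists_antisymm_potential hs hs6 hK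
  obtain ⟨C₂, hC₂, H₂⟩ := exists_rescaled_bound hs hs6 hK
  obtain ⟨C₃, hC₃, H₃⟩ := exists_local_bounds (C₀ := 0) hs hs6 hK
  set v := (volume (ball3 1)).toReal with hv
  have s0 : 0 < s := by linarith
  have v0 : 0 ≤ v := ENNReal.toReal_nonneg
  set A := (3 : ℝ) ^ (s + 1) * (3 ^ (s + 1) * C₁) with hA
  have h3 : (1 : ℝ) ≤ 3 ^ (s + 1) := one_le_rpow (by norm_num) (by linarith)
  have hA1 : 1 ≤ A := one_le_mul_of_one_le_of_one_le h3 (one_le_mul_of_one_le_of_one_le h3 hC₁)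
  set A₂ := (27 * (27 * (27 * (C₁ * (C₃ + 1)))) : ℝ) with hA₂
  refine ⟨C₂ + A * (1 + 8 * v) + A₂, by nlinarith [show 0 ≤ A₂ by positivity],
    fun u F hu hdiv e ce e0 hue r ρ d Y n hr hρ hd hdr hρd hn hbig hY => ?_⟩
  set E := ∫ x in ball3 (ρ + 10 * d), e x with hE
  have hE0 : 0 ≤ E := setIntegral_ball_nonneg fun x _ => e0 x
  have hr0 : 0 < r := by linarith
  have hq : 1 ≤ r / d := (one_le_div hd).2 hdr
  have hn1 : (1 : ℝ) ≤ n := by exact_mod_cast hn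
  have hYr : r ^ (-1 / 3 : ℝ) ≤ Y := by
    rw [hY]
    exact le_mul_of_one_le_right (by positivity) (one_le_rpow (by linarith) (by norm_num))
  have hY0 : 0 ≤ Y := le_trans (by positivity) hYr
  have cA : A * (1 + 8 * v) ≤ C₂ + A * (1 + 8 * v) + A₂ := by
    have : 0 ≤ A₂ := by positivity
    linarith
  have cA₂ : A₂ ≤ C₂ + A * (1 + 8 * v) + A₂ := by
    have : 0 ≤ A * (1 + 8 * v) := by positivity
    linarith
  have cA' : A ≤ C₂ + A * (1 + 8 * v) + A₂ := le_trans (by nlinarith) cA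
  have cC₂ : C₂ ≤ C₂ + A * (1 + 8 * v) + A₂ := by
    have : 0 ≤ A * (1 + 8 * v) := by positivity
    have : 0 ≤ A₂ := by positivity
    linarith
  set C := C₂ + A * (1 + 8 * v) + A₂ with hC
  obtain ⟨V, sV, aV, dV, bV, bDV⟩ := H₁ u F hu hdiv r (ρ + 6 * d) d
    (C₃ * (r / d) ^ 4 * d ^ 2 * Y) n hr hd hdr (by linarith) hn
    (fun l => by
      have h := (H₃ (u l) (F l) (hu l) e ce e0 (fun i => hue i l) r ρ d hr hρ hd hdr hρd).1
      rw [← hE, ← hY] at h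
      exact (setIntegral_ball_mono_set ((hu l).sm.cont.pow 2) (fun _ => sq_nonneg _)
        (by linarith)).trans h)
    (fun l => by
      have h := H₂ (u l) (F l) (hu l) e ce e0 (fun i => hue i l) r ρ d n hr hρ hd hdr hρd
        (le_trans (by gcongr) hbig)
      rwa [show ρ + 6 * d + d = ρ + 7 * d by ring])
  have hZ : ∫ x in ball3 (ρ + 6 * d), msize V x ^ s ≤
      A * (n : ℝ) ^ (s - 2) * (r / d) ^ 24 * r ^ (2 + s / 3) := by
    refine (ballInt_msize_le (fun j l => (sV j l).cont) s0 bV).trans_eq ?_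
    rw [hA]; ring
  refine ⟨V, sV, aV, dV, ?_, ?_, hZ.trans (by gcongr)⟩
  · have cm := continuous_msize sV
    have h := power_mean_ball (s := s) (t := 2) (by norm_num) (by linarith) cm
      (show 0 ≤ ρ + 6 * d by positivity)
    simp only [abs_of_nonneg (msize_nonneg (V := V) _), rpow_ofNat] at h
    have z0 : 0 ≤ ∫ x in ball3 (ρ + 6 * d), msize V x ^ s :=
      setIntegral_ball_nonneg fun x _ => rpow_nonneg (msize_nonneg x) _
    have p1 : 2 / s ≤ 1 := (div_le_one s0).2 (by linarith)
    have p2 : 0 ≤ 1 - 2 / s := by linarith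
    have h1 := rpow_le_rpow z0 hZ (by positivity : 0 ≤ 2 / s)
    have h2 : (v * (ρ + 6 * d) ^ 3) ^ (1 - 2 / s) ≤ (1 + 8 * v) * r ^ (3 - 6 / s) := by
      calc (v * (ρ + 6 * d) ^ 3) ^ (1 - 2 / s) ≤ ((1 + 8 * v) * r ^ 3) ^ (1 - 2 / s) := by
            refine rpow_le_rpow (by positivity) ?_ p2
            have : (ρ + 6 * d) ^ 3 ≤ (2 * r) ^ 3 := by gcongr; linarith
            calc v * (ρ + 6 * d) ^ 3 ≤ v * (2 * r) ^ 3 := by gcongr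
              _ ≤ _ := by nlinarith [pow_pos hr0 3]
        _ = (1 + 8 * v) ^ (1 - 2 / s) * r ^ (3 - 6 / s) := by
            rw [mul_rpow (by positivity) (by positivity), ← rpow_natCast r 3, ← rpow_mul hr0.le]
            congr 2; push_cast; ring
        _ ≤ _ := by
            gcongr
            exact rpow_le_self_of_one_le (by linarith) (by linarith [show 0 ≤ 2 / s by positivity])
    have h3 : (A * (n : ℝ) ^ (s - 2) * (r / d) ^ 24 * r ^ (2 + s / 3)) ^ (2 / s) ≤
        A * ((n : ℝ) ^ ((s - 2) / s)) ^ 2 * (r / d) ^ 16 * r ^ (4 / s + 2 / 3) := by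
      rw [mul_rpow (by positivity) (by positivity), mul_rpow (by positivity) (by positivity),
        mul_rpow (by positivity) (by positivity)]
      have e1 : ((n : ℝ) ^ (s - 2)) ^ (2 / s) = ((n : ℝ) ^ ((s - 2) / s)) ^ 2 := by
        rw [← rpow_mul (by positivity), ← rpow_natCast, ← rpow_mul (by positivity)]
        congr 1; push_cast; ring
      have e2 : (r ^ (2 + s / 3)) ^ (2 / s) = r ^ (4 / s + 2 / 3) := by
        rw [← rpow_mul hr0.le]; congr 1; field_simp; ring
      have e3 : ((r / d) ^ 24) ^ (2 / s) ≤ (r / d) ^ 16 := by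
        rw [← rpow_natCast, ← rpow_natCast, ← rpow_mul (by positivity)]
        refine rpow_le_rpow_of_exponent_le hq ?_
        have : 2 / s ≤ 2 / 3 := by gcongr
        push_cast; linarith
      have e4 : A ^ (2 / s) ≤ A := rpow_le_self_of_one_le hA1 p1
      rw [e1, e2]
      gcongr
    have h4 : r ^ (4 / s + 2 / 3) * r ^ (3 - 6 / s) ≤ (r / d) ^ 4 * d ^ 4 * Y := by
      have : (r / d) ^ 4 * d ^ 4 = r ^ (4 : ℝ) := by
        rw [rpow_ofNat, div_pow]; field_simp
      rw [this]
      calc r ^ (4 / s + 2 / 3) * r ^ (3 - 6 / s) = r ^ (4 : ℝ) * r ^ (-1 / 3 - 2 / s) := by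
            rw [← rpow_add hr0, ← rpow_add hr0]; congr 1; ring
        _ ≤ r ^ (4 : ℝ) * r ^ (-1 / 3 : ℝ) := by
            gcongr
            · exact hr.le
            · linarith [show 0 ≤ 2 / s by positivity]
        _ ≤ _ := by gcongr
    calc ∫ x in ball3 (ρ + 6 * d), msize V x ^ 2 ≤ _ := h
      _ ≤ (A * ((n : ℝ) ^ ((s - 2) / s)) ^ 2 * (r / d) ^ 16 * r ^ (4 / s + 2 / 3)) *
          ((1 + 8 * v) * r ^ (3 - 6 / s)) :=
          mul_le_mul (h1.trans h3) h2 (by positivity) (by positivity)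
      _ = A * (1 + 8 * v) * ((n : ℝ) ^ ((s - 2) / s)) ^ 2 * (r / d) ^ 16 *
          (r ^ (4 / s + 2 / 3) * r ^ (3 - 6 / s)) := by ring
      _ ≤ C * ((n : ℝ) ^ ((s - 2) / s)) ^ 2 * (r / d) ^ 16 * ((r / d) ^ 4 * d ^ 4 * Y) := by gcongr
      _ = _ := by ring
  · have h1 : C₁ * (C₃ * (r / d) ^ 4 * d ^ 2 * Y + (r / d) ^ 10 * r ^ (5 / 3 - 2 / s)) ≤
        C₁ * (C₃ + 1) * (r / d) ^ 12 * d ^ 2 * Y := by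
      have e1 : r ^ (5 / 3 - 2 / s) ≤ (r / d) ^ 2 * d ^ 2 * Y := by
        have : (r / d) ^ 2 * d ^ 2 = r ^ (2 : ℝ) := by
          rw [rpow_ofNat, div_pow]; field_simp
        rw [this]
        calc r ^ (5 / 3 - 2 / s) ≤ r ^ (2 + -1 / 3 : ℝ) := by
              refine rpow_le_rpow_of_exponent_le hr.le ?_
              linarith [show 0 ≤ 2 / s by positivity]
          _ = r ^ (2 : ℝ) * r ^ (-1 / 3 : ℝ) := rpow_add hr0 _ _
          _ ≤ _ := by gcongr
      have e2 : (r / d) ^ 4 ≤ (r / d) ^ 12 := pow_le_pow_right₀ hq (by norm_num)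
      calc _ ≤ C₁ * (C₃ * (r / d) ^ 12 * d ^ 2 * Y + (r / d) ^ 10 * ((r / d) ^ 2 * d ^ 2 * Y)) := by
            gcongr
        _ = _ := by ring
    have h2 := ballInt_dmsize_le (r := ρ + 6 * d) (p := 2)
      (M := C₁ * (C₃ + 1) * (r / d) ^ 12 * d ^ 2 * Y) sV (by norm_num) fun m j l => by
        simp only [rpow_ofNat, sq_abs]
        exact (bDV m j l).trans h1
    simp only [rpow_ofNat] at h2
    refine h2.trans ?_
    have : (3 : ℝ) ^ ((2 : ℝ) + 1) = 27 := by
      rw [show (2 : ℝ) + 1 = ((3 : ℕ) : ℝ) by norm_num, rpow_natCast]; norm_num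
    rw [this]
    calc _ = A₂ * (r / d) ^ 12 * d ^ 2 * Y := by rw [hA₂]; ring
      _ ≤ _ := by gcongr

theorem IsCut.annular {C a b a' b' d : ℝ} {ψ φ : E3 → ℝ} (hψ : IsCut C a b ψ) (hφ : IsCut C a' b' φ)
    (hC : 0 ≤ C) (hd : 0 < d) (hab : b - a = d) (hab' : b' - a' = d) (x : E3) (i : Fin 3) :
    |pd i (fun y => φ y * (1 - ψ y)) x| ≤ 2 * C / d := by
  have s1 : Sm fun y => 1 - ψ y := contDiff_const.sub hψ.smooth
  have e : pd i (fun y => 1 - ψ y) x = - pd i ψ x := by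
    have := pd_add (i := i) (x := x) (f := fun _ => (1 : ℝ)) (g := fun y => (-1) * ψ y)
      (differentiableAt_const _) (Sm.diffAt (contDiff_const.mul hψ.smooth))
    have h2 := pd_const_mul (i := i) (x := x) (-1) (f := ψ) hψ.smooth.diffAt
    rw [h2, pd_const] at this
    rw [show (fun y => 1 - ψ y) = fun y => 1 + (-1) * ψ y by funext y; ring, this]; ring
  rw [pd_mul (f := φ) (g := fun y => 1 - ψ y) hφ.smooth.diffAt s1.diffAt, e]
  have h1 := hψ.pd_le x i
  have h2 := hφ.pd_le x i
  rw [hab] at h1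
  rw [hab'] at h2
  have n1 := hψ.nonneg x
  have n2 := hψ.le_one x
  have n3 := hφ.nonneg x
  have n4 := hφ.le_one x
  have c0 : 0 ≤ C / d := by positivity
  refine (abs_add_le _ _).trans ?_
  rw [abs_mul, abs_mul, abs_neg, abs_of_nonneg n3, abs_of_nonneg (sub_nonneg.2 n2)]
  have l1 : |pd i φ x| * (1 - ψ x) ≤ C / d * 1 :=
    mul_le_mul h2 (by linarith) (by linarith) c0
  have l2 : φ x * |pd i ψ x| ≤ 1 * (C / d) := mul_le_mul n4 h1 (abs_nonneg _) (by norm_num)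
  calc _ ≤ C / d + C / d := by linarith
    _ = _ := by ring

theorem ballInt_annulus_le {e g : E3 → ℝ} {ρ b R : ℝ} (ce : Continuous e) (cg : Continuous g)
    (g0 : ∀ x, 0 ≤ g x) (hge : ∀ x, g x ≤ e x) (hg : ∀ x, ‖x‖ < ρ → g x = 0) (hρ : ρ ≤ R)
    (hb : b ≤ R) : ∫ x in ball3 b, g x ≤ (∫ x in ball3 R, e x) - ∫ x in ball3 ρ, e x := by
  have c : Continuous fun x => e x + (-1) * g x := ce.add (continuous_const.mul cg)
  have h1 := setIntegral_ball_mono_set c (fun x => by linarith [hge x]) hρ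
  have h2 : ∫ x in ball3 ρ, e x ≤ ∫ x in ball3 ρ, (e x + (-1) * g x) :=
    setIntegral_ball_mono ce c fun x hx => by rw [hg x hx]; linarith
  have h3 := ballInt_add ce (g := fun x => (-1) * g x) (continuous_const.mul cg) R
  rw [ballInt_const_mul] at h3
  have h4 := setIntegral_ball_mono_set cg g0 hb
  linarith

theorem scaled_product_le {s r D E : ℝ} (hs : 3 < s) (hs6 : s ≤ 6) (hr : 1 < r) (hD : 0 ≤ D)
    (hE : 0 ≤ E) :
    D * (r ^ (-1 / 3 : ℝ) * (1 + E) ^ (1 / 2 : ℝ)) ≤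
      ((D + r ^ (-1 / 3 : ℝ) * (1 + E)) ^ (9 / (s + 6))) ^ 2 := by
  have hr0 : 0 < r := by linarith
  set X := r ^ (-1 / 3 : ℝ) * (1 + E) with hX
  have hX0 : 0 < X := by positivity
  have s6 : 0 < s + 6 := by linarith
  have θ1 : 3 / 4 ≤ 9 / (s + 6) := by rw [div_le_div_iff₀ (by norm_num) s6]; linarith
  have θ2 : 9 / (s + 6) ≤ 1 := (div_le_one s6).2 (by linarith)
  set θ := 9 / (s + 6)
  have h1 : r ^ (-1 / 3 : ℝ) * (1 + E) ^ (1 / 2 : ℝ) ≤ X ^ (2 * θ - 1) := by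
    rw [hX, mul_rpow (by positivity) (by positivity), ← rpow_mul hr0.le]
    refine mul_le_mul (rpow_le_rpow_of_exponent_le hr.le (by linarith))
      (rpow_le_rpow_of_exponent_le (by linarith) (by linarith)) (by positivity) (by positivity)
  have h2 : X ^ (2 * θ - 1) ≤ (D + X) ^ (2 * θ - 1) :=
    rpow_le_rpow hX0.le (by linarith) (by linarith)
  have hT : 0 < D + X := by linarith
  calc _ ≤ (D + X) * (D + X) ^ (2 * θ - 1) :=
        mul_le_mul (by linarith) (h1.trans h2) (by positivity) hT.le
    _ = _ := by
        rw [← rpow_natCast, ← rpow_mul hT.le]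
        nth_rw 1 [← rpow_one (D + X)]
        rw [← rpow_add hT]; congr 1; push_cast; ring

namespace FieldSol

variable {U W B : Fin 3 → E3 → ℝ} {P : E3 → ℝ}

/-- The energy of the fields in a ball. -/
def energy (U W B : Fin 3 → E3 → ℝ) (r : ℝ) : ℝ := ∫ x in ball3 r, dens U W B x

theorem continuous_dens' (h : FieldSol U W B P) : Continuous (dens U W B) :=
  continuous_dens h.smU h.smW h.smB

theorem energy_nonneg (r : ℝ) : 0 ≤ energy U W B r :=
  setIntegral_ball_nonneg fun x _ => dens_nonneg x

theorem energy_mono (h : FieldSol U W B P) : Monotone (energy U W B) := fun _ _ hr =>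
  setIntegral_ball_mono_set h.continuous_dens' dens_nonneg hr

set_option maxHeartbeats 1000000 in
theorem exists_energy_bound {s K : ℝ} (hs : 3 < s) (hs6 : s ≤ 6) (hK : 0 ≤ K) (h : FieldSol U W B P)
    {FU FW FB : Fin 3 → Fin 3 → E3 → ℝ} (hU : ∀ j, HasPot s K (U j) (FU j))
    (hW : ∀ j, HasPot s K (W j) (FW j)) (hB : ∀ j, HasPot s K (B j) (FB j)) :
    ∃ C : ℝ, 1 ≤ C ∧ ∀ (r ρ d : ℝ) (n : ℕ), 1 < r → 0 < ρ → 0 < d → d ≤ r → ρ + 10 * d ≤ 2 * r →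
      1 ≤ n → C * (r / d) ^ 4 * (r * (1 + energy U W B (ρ + 10 * d))) ≤ 2 ^ n →
      energy U W B ρ ≤ C * (n : ℝ) ^ ((s - 2) / s) * (r / d) ^ 13 *
        (energy U W B (ρ + 10 * d) - energy U W B ρ +
          r ^ (-1 / 3 : ℝ) * (1 + energy U W B (ρ + 10 * d))) ^ (9 / (s + 6)) := by
  obtain ⟨C₁, hC₁, hcut⟩ := exists_cut
  obtain ⟨C₂, hC₂, hloc⟩ := exists_local_bounds (C₀ := 2 * C₁) hs hs6 hK
  obtain ⟨C₃, hC₃, hpot⟩ := exists_potential_bounds hs hs6 hK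
  set C := C₁ + 3 ^ 14 * C₂ + C₃ + 10000 with hC
  have hCC : C ≤ 500 * C ^ 2 := by nlinarith
  refine ⟨500 * C ^ 2, by nlinarith, fun r ρ d n hr hρ hd hdr hρd hn hbig => ?_⟩
  set E := energy U W B (ρ + 10 * d) with hE
  have hE0 : 0 ≤ E := energy_nonneg _
  have hr0 : 0 < r := by linarith
  have hq : 1 ≤ r / d := (one_le_div hd).2 hdr
  have hn1 : (1 : ℝ) ≤ n := by exact_mod_cast hn
  have ce := h.continuous_dens'
  have e0 := dens_nonneg (U := U) (W := W) (B := B)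
  set D := E - energy U W B ρ with hD
  have hD0 : 0 ≤ D := sub_nonneg.2 (h.energy_mono (by linarith))
  set X := r ^ (-1 / 3 : ℝ) * (1 + E) with hX
  have hX0 : 0 < X := by positivity
  set Y := r ^ (-1 / 3 : ℝ) * (1 + E) ^ (1 / 2 : ℝ) with hY
  have hY0 : 0 < Y := by positivity
  have hYX : Y ≤ X := by
    have : (1 + E) ^ (1 / 2 : ℝ) ≤ 1 + E := rpow_le_self_of_one_le (by linarith) (by norm_num)
    rw [hY, hX]; gcongr
  obtain ⟨V, sV, aV, dV, bV, bDV, bVs⟩ := hpot U FU hU h.divU (dens U W B) ce e0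
    (fun i l x => (sq_le_dens i l x).1) r ρ d Y n hr hρ hd hdr hρd hn
    (le_trans (by
      have : C₃ ≤ 500 * C ^ 2 := by nlinarith
      change C₃ * (r / d) ^ 4 * (r * (1 + E)) ≤ _
      gcongr) hbig) hY
  obtain ⟨ψ, hψ⟩ := hcut (ρ + 3 * d) (ρ + 4 * d) (by positivity) (by linarith)
  obtain ⟨ψi, hψi⟩ := hcut (ρ + d) (ρ + 2 * d) (by positivity) (by linarith)
  obtain ⟨ψo, hψo⟩ := hcut (ρ + 5 * d) (ρ + 6 * d) (by positivity) (by linarith)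
  set ζ : E3 → ℝ := fun y => ψo y * (1 - ψi y) with hζ
  have sζ : Sm ζ := hψo.smooth.mul (contDiff_const.sub hψi.smooth)
  have cζ := sζ.cont
  have ζ0 : ∀ x, 0 ≤ ζ x := fun x => mul_nonneg (hψo.nonneg x) (sub_nonneg.2 (hψi.le_one x))
  have ζ1 : ∀ x, ζ x ≤ 1 := fun x =>
    mul_le_one₀ (hψo.le_one x) (sub_nonneg.2 (hψi.le_one x)) (by linarith [hψi.nonneg x])
  have ζb : ∀ x, ρ + 6 * d ≤ ‖x‖ → ζ x = 0 := fun x hx => by simp only [hζ, hψo.eq_zero x hx, zero_mul]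
  have ζpd : ∀ x i, |pd i ζ x| ≤ 2 * C₁ / d := fun x i =>
    hψi.annular hψo (by linarith) hd (by ring) (by ring) x i
  have ζpb : ∀ x i, ρ + 6 * d ≤ ‖x‖ → pd i ζ x = 0 := fun x i hx => by
    rw [hζ, pd_mul (f := ψo) (g := fun y => 1 - ψi y) hψo.smooth.diffAt
      (Sm.diffAt (contDiff_const.sub hψi.smooth)), hψo.eq_zero x hx, hψo.pd_out x i hx]; ring
  have hζD : ∫ x in ball3 (ρ + 6 * d), ζ x ^ 2 * dens U W B x ≤ D :=
    ballInt_annulus_le ce ((cζ.pow 2).mul ce) (fun x => mul_nonneg (sq_nonneg _) (e0 x))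
      (fun x => mul_le_of_le_one_left (e0 x) (pow_le_one₀ (ζ0 x) (ζ1 x)))
      (fun x hx => by simp only [hζ, hψi.eq_one x (by linarith)]; ring) (by linarith) (by linarith)
  set T := D + X with hT
  have hYT : Y ≤ T := by linarith
  have hDT : D ≤ T := by linarith
  have T0 : 0 < T := by linarith
  have loc : ∀ f F, HasPot s K f F → (∀ i x, pd i f x ^ 2 ≤ 4 * dens U W B x) →
      (∫ x in ball3 (ρ + 6 * d), f x ^ 2 ≤ C₂ * (r / d) ^ 4 * d ^ 2 * Y) ∧
      (∫ x in ball3 (ρ + 6 * d), (ζ x * f x) ^ 6 ≤ C₂ * (r / d) ^ 12 * T ^ 3) ∧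
      ∫ x in ball3 (ρ + 6 * d), |ζ x * f x| ^ 3 ≤
        C₂ * r * (r / d) ^ 4 * T ^ (9 / (s + 6)) := fun f F hf hfe => by
    obtain ⟨l1, l2⟩ := hloc f F hf (dens U W B) ce e0 hfe r ρ d hr hρ hd hdr hρd
    exact ⟨(setIntegral_ball_mono_set (hf.sm.cont.pow 2) (fun _ => sq_nonneg _)
      (by linarith)).trans l1, l2 ζ sζ ζ0 ζ1 ζpd (ρ + 6 * d) T (by linarith) ζb ζpb
        (hζD.trans hDT) hYT⟩
  have lU := fun j => loc (U j) _ (hU j) fun i x => (sq_le_dens i j x).1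
  have lW := fun j => loc (W j) _ (hW j) fun i x => (sq_le_dens i j x).2.1
  have lB := fun j => loc (B j) _ (hB j) fun i x => (sq_le_dens i j x).2.2.1
  have cU := fun j => (h.smU j).cont
  have cW := fun j => (h.smW j).cont
  have cB := fun j => (h.smB j).cont
  have cζU : ∀ j, Continuous fun x => ζ x * U j x := fun j => cζ.mul (cU j)
  have cζW : ∀ j, Continuous fun x => ζ x * W j x := fun j => cζ.mul (cW j)
  have cζB : ∀ j, Continuous fun x => ζ x * B j x := fun j => cζ.mul (cB j)
  have hCC₂ : 3 ^ 14 * C₂ ≤ C := by linarith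
  have three : ∀ k : ℕ, (3 : ℝ) ^ ((k : ℝ) + 1) = 3 ^ (k + 1) := fun k => by
    rw [← Nat.cast_succ, rpow_natCast]
  have b1 : ∫ x in ball3 (ρ + 6 * d), size U W B x ^ 2 ≤ C * (r / d) ^ 4 * d ^ 2 * Y := by
    have := ballInt_size_le (r := ρ + 6 * d) (p := (2 : ℕ)) (M := C₂ * (r / d) ^ 4 * d ^ 2 * Y)
      cU cW cB (by norm_num)
      (fun j => by simpa only [rpow_natCast, sq_abs] using (lU j).1)
      (fun j => by simpa only [rpow_natCast, sq_abs] using (lW j).1)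
      (fun j => by simpa only [rpow_natCast, sq_abs] using (lB j).1)
    simp only [rpow_natCast, three] at this
    calc _ ≤ _ := this
      _ = 3 ^ 6 * C₂ * (r / d) ^ 4 * d ^ 2 * Y := by ring
      _ ≤ _ := by gcongr; linarith
  have b3 : ∫ x in ball3 (ρ + 6 * d), (ζ x * size U W B x) ^ 3 ≤
      C * r * (r / d) ^ 4 * T ^ (9 / (s + 6)) := by
    have := ballInt_size_le (r := ρ + 6 * d) (p := (3 : ℕ))
      (M := C₂ * r * (r / d) ^ 4 * T ^ (9 / (s + 6)))
      cζU cζW cζB (by norm_num)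
      (fun j => by simpa only [rpow_natCast] using (lU j).2.2)
      (fun j => by simpa only [rpow_natCast] using (lW j).2.2)
      (fun j => by simpa only [rpow_natCast] using (lB j).2.2)
    simp only [rpow_natCast, three] at this
    simp only [size_mul ζ0]
    calc _ ≤ _ := this
      _ = 3 ^ 8 * C₂ * r * (r / d) ^ 4 * T ^ (9 / (s + 6)) := by ring
      _ ≤ _ := by gcongr; linarith
  have b6 : ∫ x in ball3 (ρ + 6 * d), (ζ x * size U W B x) ^ 6 ≤ C * (r / d) ^ 12 * T ^ 3 := by
    have := ballInt_size_le (r := ρ + 6 * d) (p := (6 : ℕ)) (M := C₂ * (r / d) ^ 12 * T ^ 3)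
      cζU cζW cζB (by norm_num)
      (fun j => by
        simpa only [rpow_natCast, Even.pow_abs (by decide : Even 6)] using (lU j).2.1)
      (fun j => by
        simpa only [rpow_natCast, Even.pow_abs (by decide : Even 6)] using (lW j).2.1)
      (fun j => by
        simpa only [rpow_natCast, Even.pow_abs (by decide : Even 6)] using (lB j).2.1)
    simp only [rpow_natCast, three] at this
    simp only [size_mul ζ0]
    calc _ ≤ _ := this
      _ = 3 ^ 14 * C₂ * (r / d) ^ 12 * T ^ 3 := by ring
      _ ≤ _ := by gcongr
  have bD : ∫ x in ball3 (ρ + 6 * d), (ζ x * gsize U W B x) ^ 2 ≤ C * D := by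
    have c1 : Continuous fun x => (ζ x * gsize U W B x) ^ 2 :=
      (cζ.mul (continuous_gsize h.smU h.smW h.smB)).pow 2
    have c2 : Continuous fun x => 10000 * (ζ x ^ 2 * dens U W B x) :=
      continuous_const.mul ((cζ.pow 2).mul ce)
    refine (setIntegral_ball_mono c1 c2 fun x _ => ?_).trans ?_
    · rw [mul_pow]
      calc _ ≤ ζ x ^ 2 * (10000 * dens U W B x) :=
            mul_le_mul_of_nonneg_left (gsize_sq_le x) (sq_nonneg (ζ x))
        _ = _ := by ring
    · rw [ballInt_const_mul]
      have : 10000 ≤ C := by linarith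
      calc _ ≤ 10000 * D := mul_le_mul_of_nonneg_left hζD (by norm_num)
        _ ≤ _ := by gcongr
  have hC₃C : C₃ ≤ C := by linarith
  have hCd : C₁ / d ≤ C / d := by gcongr; linarith
  have hCd' : C₁ / d ^ 2 ≤ C / d ^ 2 := by gcongr; linarith
  have main := h.integral_dens_le sV aV dV hψ.smooth hψ.compact hψ.nonneg cζ
    (hasCompactSupport_of_norm ζb) ζ0 (a := C / d) (a' := C / d ^ 2)
    (fun i x => le_trans (by
      have := hψ.pd_le x i
      rwa [show ρ + 4 * d - (ρ + 3 * d) = d by ring] at this) hCd)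
    (fun i j x => le_trans (by
      have := hψ.pdd_le x i j
      rwa [show ρ + 4 * d - (ρ + 3 * d) = d by ring] at this) hCd')
    (fun x => by
      rcases le_total ‖x‖ (ρ + 3 * d) with h1 | h1
      · exact .inr ⟨fun i => hψ.pd_in x i h1, fun i j => hψ.pdd_in x i j h1⟩
      rcases le_total (ρ + 4 * d) ‖x‖ with h2 | h2
      · exact .inr ⟨fun i => hψ.pd_out x i h2, fun i j => hψ.pdd_out x i j h2⟩
      refine .inl ?_
      simp only [hζ, hψo.eq_one x (by linarith), hψi.eq_zero x (by linarith)]; ring)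
  have hb := integral_bdry_le (a := C / d) (a' := C / d ^ 2) hs hs6 h.smU h.smW h.smB sV cζ ζ0 ζb
    (by positivity) (by positivity) b1 b3 b6 bD
    (Y₁ := C * ((n : ℝ) ^ ((s - 2) / s)) ^ 2 * (r / d) ^ 20 * d ^ 4 * Y)
    (Y₂ := C * (r / d) ^ 12 * d ^ 2 * Y)
    (Z := C * (n : ℝ) ^ (s - 2) * (r / d) ^ 24 * r ^ (2 + s / 3))
    (bV.trans (by gcongr)) (bDV.trans (by gcongr)) (bVs.trans (by gcongr))
  have fin := boundary_terms_le (C := C) (n := n) (r := r) (d := d) (s := s) (D := D) (Y := Y)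
    (T := T) hs (by linarith) hn1 hr hd hdr hD0 hDT hY0 hYT (scaled_product_le hs hs6 hr hD0 hE0)
  have low : energy U W B ρ ≤ ∫ x, ψ x * dens U W B x := by
    have c1 : Continuous fun x => ψ x * dens U W B x := hψ.smooth.cont.mul ce
    rw [integral_eq_ball (r := ρ + 4 * d) fun x hx => by rw [hψ.eq_zero x hx, zero_mul]]
    refine le_trans (setIntegral_ball_mono ce c1 fun x hx => ?_) (setIntegral_ball_mono_set c1
      (fun x => mul_nonneg (hψ.nonneg x) (e0 x)) (show ρ ≤ ρ + 4 * d by linarith))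
    rw [hψ.eq_one x (by linarith), one_mul]
  have := hb.trans fin
  linarith

end FieldSol

theorem le_of_iterated_affine_bound {g : ℕ → ℝ} {b c θ M : ℝ} (hθ0 : 0 ≤ θ) (hθ1 : θ < 1)
    (hM : ∀ i, g i ≤ M) (hb : 0 ≤ b) (hc : 0 ≤ c) (h : ∀ i, g i ≤ b + c * (i + 1) + θ * g (i + 1)) :
    g 0 ≤ (b + c + θ * (c / (1 - θ))) / (1 - θ) := by
  have h1 : 0 < 1 - θ := by linarith
  set a := c / (1 - θ) with ha
  set A := (b + c + θ * a) / (1 - θ) with hA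
  have ea : a = c + θ * a := by rw [ha]; field_simp; ring
  have eA : A = b + c + θ * a + θ * A := by rw [hA]; field_simp; ring
  have a0 : 0 ≤ a := by positivity
  have A0 : 0 ≤ A := by positivity
  have step : ∀ k, g 0 - A ≤ θ ^ k * (g k - A - a * k) := fun k => by
    induction k with
    | zero => simp
    | succ k ih =>
      refine ih.trans ?_
      rw [pow_succ, mul_assoc]
      refine mul_le_mul_of_nonneg_left ?_ (by positivity)
      have := h k
      push_cast
      nlinarith
  have lim : Tendsto (fun k : ℕ => θ ^ k * M) atTop (𝓝 0) := by
    simpa using (tendsto_pow_atTop_nhds_zero_of_lt_one hθ0 hθ1).mul_const M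
  have := ge_of_tendsto' lim (b := g 0 - A) fun k => (step k).trans (by
    refine mul_le_mul_of_nonneg_left ?_ (by positivity)
    have := hM k
    have : 0 ≤ a * k := by positivity
    linarith)
  linarith

/-- A sequence whose increments dominate a superlinear power of it, divided by the index, cannot grow
polynomially. -/
theorem false_of_superlinear_growth {F : ℕ → ℝ} {φ c p A : ℝ} {M k₀ : ℕ} (hφ : 0 < φ) (hc : 0 < c)
    (hp : 1 < p) (hF : ∀ k ≥ k₀, φ ≤ F k) (hA : ∀ k ≥ k₀, F k ≤ A * ((k : ℝ) + 1) ^ M)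
    (h : ∀ k ≥ k₀, c * F k ^ p ≤ ((k : ℝ) + 1) * (F (k + 1) - F k)) : False := by
  set S : ℕ → ℝ := fun k => ∑ j ∈ Finset.range k, 1 / ((j : ℝ) + 1) with hS
  have hlow : ∀ k ≥ k₀, F k₀ - c * φ ^ p * S k₀ ≤ F k - c * φ ^ p * S k := fun k hk => by
    induction k, hk using Nat.le_induction with
    | base => exact le_rfl
    | succ k hk ih =>
      refine ih.trans ?_
      simp only [hS, Finset.sum_range_succ]
      have h1 : c * φ ^ p ≤ ((k : ℝ) + 1) * (F (k + 1) - F k) := le_trans (by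
        have := hF k hk
        gcongr) (h k hk)
      have h2 : c * φ ^ p * (1 / ((k : ℝ) + 1)) ≤ F (k + 1) - F k := by
        rw [mul_one_div, div_le_iff₀ (by positivity)]; linarith
      linarith
  have hinf : Tendsto F atTop atTop := by
    have t1 : Tendsto (fun k => c * φ ^ p * S k + (F k₀ - c * φ ^ p * S k₀)) atTop atTop :=
      tendsto_atTop_add_const_right _ _
        (tendsto_sum_range_one_div_nat_succ_atTop.const_mul_atTop (by positivity))
    refine tendsto_atTop_mono' _ ?_ t1
    filter_upwards [eventually_ge_atTop k₀] with k hk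
    linarith [hlow k hk]
  have hinf' : Tendsto (fun k => c * F k ^ (p - 1)) atTop atTop :=
    ((tendsto_rpow_atTop (by linarith)).comp hinf).const_mul_atTop hc
  obtain ⟨k₁, hk₁⟩ := eventually_atTop.1 ((hinf'.eventually_ge_atTop ((2 : ℝ) ^ (M + 1))).and
    (eventually_ge_atTop k₀))
  have ratio : ∀ k ≥ k₁, F k₁ / ((k₁ : ℝ) + 1) ^ (M + 1) ≤ F k / ((k : ℝ) + 1) ^ (M + 1) := fun k hk => by
    induction k, hk using Nat.le_induction with
    | base => exact le_rfl
    | succ k hk ih =>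
      refine ih.trans ?_
      obtain ⟨h1, h2⟩ := hk₁ k hk
      have Fk : 0 < F k := hφ.trans_le (hF k h2)
      have h3 := h k h2
      have h4 : (2 : ℝ) ^ (M + 1) * F k ≤ c * F k ^ p := by
        calc (2 : ℝ) ^ (M + 1) * F k ≤ c * F k ^ (p - 1) * F k := by gcongr
          _ = _ := by rw [mul_assoc, ← rpow_add_one Fk.ne', sub_add_cancel]
      have bern : ∀ (N : ℕ) (x : ℝ), 0 ≤ x → x ≤ 1 → (1 + x) ^ N ≤ 1 + (2 ^ N - 1) * x :=
        fun N x x0 x1 => by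
        induction N with
        | zero => simp
        | succ N ih =>
          have h2 : (0 : ℝ) ≤ 2 ^ N - 1 := sub_nonneg.2 (one_le_pow₀ (by norm_num))
          calc (1 + x) ^ (N + 1) ≤ (1 + (2 ^ N - 1) * x) * (1 + x) := by
                rw [pow_succ]; gcongr
            _ = 1 + 2 ^ N * x + (2 ^ N - 1) * x * x := by ring
            _ ≤ 1 + 2 ^ N * x + (2 ^ N - 1) * x * 1 := by gcongr
            _ = _ := by ring
      have kp : (0 : ℝ) < (k : ℝ) + 1 := by positivity
      have hb := bern (M + 1) (1 / ((k : ℝ) + 1)) (by positivity)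
        ((div_le_one kp).2 (by linarith [Nat.cast_nonneg (α := ℝ) k]))
      replace hb : (1 + 1 / ((k : ℝ) + 1)) ^ (M + 1) ≤ 1 + 2 ^ (M + 1) * (1 / ((k : ℝ) + 1)) :=
        hb.trans (by gcongr; linarith)
      have e1 : 1 + 1 / ((k : ℝ) + 1) = ((k : ℝ) + 1 + 1) / ((k : ℝ) + 1) := by field_simp
      rw [e1, div_pow, div_le_iff₀ (by positivity)] at hb
      push_cast
      rw [div_le_div_iff₀ (by positivity) (by positivity)]
      have h5 : F k * (1 + 2 ^ (M + 1) * (1 / ((k : ℝ) + 1))) ≤ F (k + 1) := by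
        have : 2 ^ (M + 1) * F k / ((k : ℝ) + 1) ≤ F (k + 1) - F k := by
          rw [div_le_iff₀ kp]; linarith
        calc _ = F k + 2 ^ (M + 1) * F k / ((k : ℝ) + 1) := by ring
          _ ≤ _ := by linarith
      calc F k * ((k : ℝ) + 1 + 1) ^ (M + 1) ≤
            F k * ((1 + 2 ^ (M + 1) * (1 / ((k : ℝ) + 1))) * ((k : ℝ) + 1) ^ (M + 1)) := by gcongr
        _ = F k * (1 + 2 ^ (M + 1) * (1 / ((k : ℝ) + 1))) * ((k : ℝ) + 1) ^ (M + 1) := by ring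
        _ ≤ _ := by gcongr
  have hk₁₀ := (hk₁ k₁ le_rfl).2
  set c₁ := F k₁ / ((k₁ : ℝ) + 1) ^ (M + 1) with hc₁
  have c₁0 : 0 < c₁ := div_pos (hφ.trans_le (hF k₁ hk₁₀)) (by positivity)
  obtain ⟨N, hN⟩ := exists_nat_gt (A / c₁)
  have hm := ratio (max N k₁) (le_max_right _ _)
  have hA' := hA (max N k₁) (hk₁₀.trans (le_max_right _ _))
  set m := max N k₁ with hmd
  rw [le_div_iff₀ (by positivity), pow_succ] at hm
  have hNm : (N : ℝ) ≤ m := by exact_mod_cast le_max_left N k₁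
  rw [div_lt_iff₀ c₁0] at hN
  have hpos : 0 < ((m : ℝ) + 1) ^ M := by positivity
  have : c₁ * ((m : ℝ) + 1) ≤ A := le_of_mul_le_mul_right (by linarith) hpos
  nlinarith

section Growth

variable {E : ℝ → ℝ} {C α θ : ℝ}

/-- The form of the local energy inequality: `n` is the number of dyadic scales that are used. -/
def GrowthIneq (E : ℝ → ℝ) (C α θ : ℝ) : Prop :=
  ∀ (r ρ d : ℝ) (n : ℕ), 1 < r → 0 < ρ → 0 < d → d ≤ r → ρ + 10 * d ≤ 2 * r → 1 ≤ n →
    C * (r / d) ^ 4 * (r * (1 + E (ρ + 10 * d))) ≤ 2 ^ n →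
    E ρ ≤ C * (n : ℝ) ^ α * (r / d) ^ 13 *
      (E (ρ + 10 * d) - E ρ + r ^ (-1 / 3 : ℝ) * (1 + E (ρ + 10 * d))) ^ θ

theorem exists_nat_two_pow {x : ℝ} (hx : 1 ≤ x) : ∃ n : ℕ, 1 ≤ n ∧ x ≤ 2 ^ n ∧ n ≤ 2 + 2 * log x := by
  have hl := log_nonneg hx
  refine ⟨⌈2 * log x⌉₊ + 1, Nat.le_add_left _ _, ?_, ?_⟩
  · rw [← log_le_log_iff (by linarith) (by positivity), log_pow]
    have h1 := Nat.le_ceil (2 * log x)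
    have h2 := log_two_gt_d9
    push_cast
    nlinarith
  · have := Nat.ceil_lt_add_one (show 0 ≤ 2 * log x by positivity)
    push_cast; linarith

theorem GrowthIneq.log_le (H : GrowthIneq E C α θ) (hE : Monotone E) (E0 : ∀ r, 0 ≤ E r)
    (hC : 1 ≤ C) (hα1 : α ≤ 1) (hθ0 : 0 ≤ θ) (hθ1 : θ ≤ 1) {r ρ d G : ℝ} (hr : 1 < r)
    (hρ : 0 < ρ) (hd : 0 < d) (hdr : d ≤ r) (hρd : ρ + 10 * d ≤ 2 * r) (hG : E (ρ + 10 * d) ≤ G) :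
    log (1 + E ρ) ≤ log (3 * C) + log (2 + 2 * (log C + 4 * log (r / d) + log r + log (1 + G))) +
      13 * log (r / d) + θ * log (1 + E (ρ + 10 * d)) := by
  have r0 : 0 < r := by linarith
  have hq : 1 ≤ r / d := (one_le_div hd).2 hdr
  set R := ρ + 10 * d with hR
  have ER := E0 R
  set q := r / d with hqd
  obtain ⟨n, hn1, hn2, hn3⟩ := exists_nat_two_pow (x := C * q ^ 4 * (r * (1 + G)))
    (one_le_mul_of_one_le_of_one_le (one_le_mul_of_one_le_of_one_le hC (one_le_pow₀ hq))
      (one_le_mul_of_one_le_of_one_le hr.le (by linarith)))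
  have G0 : 0 < 1 + G := by linarith
  have h := H r ρ d n hr hρ hd hdr hρd hn1 (le_trans (by rw [← hR, ← hqd]; gcongr) hn2)
  rw [← hR, ← hqd] at h
  have n1 : (1 : ℝ) ≤ n := by exact_mod_cast hn1
  have el : log (C * q ^ 4 * (r * (1 + G))) = log C + 4 * log q + log r + log (1 + G) := by
    rw [log_mul (by positivity) (by positivity), log_mul (by positivity) (by positivity),
      log_mul (by positivity) (by positivity), log_pow]
    push_cast; ring
  rw [el] at hn3
  have mono := hE (show ρ ≤ R by linarith)
  have hr13 : r ^ (-1 / 3 : ℝ) ≤ 1 := rpow_le_one_of_one_le_of_nonpos hr.le (by norm_num)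
  have hrp : 0 < r ^ (-1 / 3 : ℝ) := by positivity
  have hT : (E R - E ρ + r ^ (-1 / 3 : ℝ) * (1 + E R)) ^ θ ≤ 2 * (1 + E R) ^ θ := by
    calc _ ≤ (2 * (1 + E R)) ^ θ := by
          refine rpow_le_rpow (add_nonneg (by linarith) (by positivity)) ?_ hθ0
          nlinarith [E0 ρ, mul_le_mul_of_nonneg_right hr13 (show 0 ≤ 1 + E R by linarith)]
      _ = 2 ^ θ * (1 + E R) ^ θ := mul_rpow (by norm_num) (by linarith)
      _ ≤ _ := by
          gcongr
          exact rpow_le_self_of_one_le (by norm_num) hθ1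
  have hna : (n : ℝ) ^ α ≤ n := rpow_le_self_of_one_le n1 hα1
  have p1 : 1 ≤ C * n * q ^ 13 * (1 + E R) ^ θ :=
    one_le_mul_of_one_le_of_one_le (one_le_mul_of_one_le_of_one_le
      (one_le_mul_of_one_le_of_one_le hC n1) (one_le_pow₀ hq)) (one_le_rpow (by linarith) hθ0)
  have main : 1 + E ρ ≤ 3 * C * n * q ^ 13 * (1 + E R) ^ θ := by
    have : E ρ ≤ C * n * q ^ 13 * (2 * (1 + E R) ^ θ) := h.trans (by gcongr)
    linarith
  have hl := log_le_log (by linarith [E0 ρ]) main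
  rw [log_mul (by positivity) (by positivity), log_mul (by positivity) (by positivity),
    log_mul (by positivity) (by positivity), log_pow, log_rpow (by linarith)] at hl
  have := log_le_log (by linarith) hn3
  push_cast at hl
  linarith

theorem GrowthIneq.iterate (hE : Monotone E) (hθ0 : 0 ≤ θ) (hθ1 : θ < 1) {r b c : ℝ} (hr : 1 < r)
    (E0 : ∀ r, 0 ≤ E r) (hb : 0 ≤ b) (hc : 0 ≤ c)
    (h : ∀ (i : ℕ) (ρ d : ℝ), r ≤ ρ → 0 < d → d ≤ r → ρ + 10 * d ≤ 2 * r → 0 ≤ log (r / d) →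
      log (r / d) ≤ 4 * (i + 1) →
      log (1 + E ρ) ≤ b + c * (i + 1) + θ * log (1 + E (ρ + 10 * d))) :
    log (1 + E r) ≤ (b + c + θ * (c / (1 - θ))) / (1 - θ) := by
  have r0 : 0 < r := by linarith
  have key := le_of_iterated_affine_bound (g := fun i : ℕ => log (1 + E (r * (2 - (1 / 2) ^ i))))
    (b := b) (c := c) (θ := θ) (M := log (1 + E (2 * r))) hθ0 hθ1 (fun i => ?_) hb hc fun i => ?_
  · simpa [show r * (2 - 1) = r by ring] using key
  · refine log_le_log (by linarith [E0 (r * (2 - (1 / 2) ^ i))]) ?_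
    have : (0 : ℝ) < (1 / 2) ^ i := by positivity
    linarith [hE (show r * (2 - (1 / 2) ^ i) ≤ 2 * r by nlinarith)]
  · set x : ℝ := (1 / 2) ^ i with hx
    have x0 : 0 < x := by positivity
    have x1 : x ≤ 1 := pow_le_one₀ (by norm_num) (by norm_num)
    have e : r / (r * x / 20) = 20 * 2 ^ i := by rw [hx]; field_simp; rw [← mul_pow]; norm_num
    have l20 : log 20 ≤ 4 := by
      rw [log_le_iff_le_exp (by norm_num), show (4 : ℝ) = ((4 : ℕ) : ℝ) * 1 by norm_num, exp_nat_mul]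
      have := exp_one_gt_d9
      calc (20 : ℝ) ≤ 2.5 ^ 4 := by norm_num
        _ ≤ _ := by gcongr; linarith
    have := h i (r * (2 - x)) (r * x / 20) (by nlinarith) (by positivity) (by nlinarith) (by nlinarith)
      (by
        rw [e]
        exact log_nonneg (by linarith [one_le_pow₀ (n := i) (show (1 : ℝ) ≤ 2 by norm_num)]))
      (by
        rw [e, log_mul (by norm_num) (by positivity), log_pow]
        have := log_two_lt_d9
        have : (0 : ℝ) ≤ i := Nat.cast_nonneg i
        nlinarith)
    rw [show r * (2 - x) + 10 * (r * x / 20) = r * (2 - (1 / 2) ^ (i + 1)) by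
      rw [pow_succ, ← hx]; ring] at this
    exact this

theorem GrowthIneq.exists_log_bound (H : GrowthIneq E C α θ) (hE : Monotone E) (E0 : ∀ r, 0 ≤ E r)
    (hC : 1 ≤ C) (hα1 : α ≤ 1) (hθ0 : 0 ≤ θ) (hθ1 : θ < 1) :
    ∃ A : ℝ, 1 ≤ A ∧ ∀ r, 1 < r → log (1 + E r) ≤ A * (1 + log r) := by
  set κ := (1 - θ) / 2 with hκ
  have κ0 : 0 < κ := by linarith
  have κ1 : κ ≤ 1 := by linarith
  have lC := log_nonneg hC
  have l3C : 0 ≤ log (3 * C) := log_nonneg (by linarith)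
  have lκ : 0 ≤ log (2 / κ) := log_nonneg ((one_le_div κ0).2 (by linarith))
  set B := log (3 * C) + 1 + log (2 / κ) + log C with hB
  have B0 : 0 ≤ B := by positivity
  have hθ' : 0 < 1 - (θ + κ) := by linarith
  set D := (θ + κ) * (68 / (1 - (θ + κ))) with hD
  have D0 : 0 ≤ D := by positivity
  refine ⟨(B + 1 + 68 + D) / (1 - (θ + κ)), ?_, fun r hr => ?_⟩
  · rw [one_le_div hθ']; linarith
  · have lr := log_nonneg hr.le
    refine (GrowthIneq.iterate (b := B + log r) (c := 68) (θ := θ + κ) hE (by linarith) (by linarith)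
      hr E0 (by linarith) (by norm_num) fun i ρ d hρ hd hdr hρd l0 l4 => ?_).trans ?_
    · have h := H.log_le hE E0 hC hα1 hθ0 hθ1.le hr (by linarith) hd hdr hρd le_rfl
      set y := log (1 + E (ρ + 10 * d))
      set l := log (r / d)
      have y0 : 0 ≤ y := log_nonneg (by linarith [E0 (ρ + 10 * d)])
      set L := log C + 4 * l + log r + y with hL
      have L0 : 0 ≤ L := by positivity
      have h2 : log (2 + 2 * L) ≤ κ * (1 + L) + log (2 / κ) := by
        have e : log (2 + 2 * L) = log (κ * (1 + L)) + log (2 / κ) := by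
          rw [← log_mul (by positivity) (by positivity)]
          congr 1; field_simp
        have := log_le_sub_one_of_pos (show 0 < κ * (1 + L) by positivity)
        linarith
      have h3 : κ * (1 + L) ≤ 1 + (log C + 4 * l + log r) + κ * y := by
        have : κ * (1 + (log C + 4 * l + log r)) ≤ 1 * (1 + (log C + 4 * l + log r)) := by
          gcongr
        calc κ * (1 + L) = κ * (1 + (log C + 4 * l + log r)) + κ * y := by rw [hL]; ring
          _ ≤ _ := by linarith
      linarith
    · rw [← hD, div_mul_eq_mul_div]
      gcongr
      have : 0 ≤ (B + 68 + D) * log r := by positivity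
      linarith

theorem GrowthIneq.exists_loglog_bound (H : GrowthIneq E C α θ) (hE : Monotone E)
    (E0 : ∀ r, 0 ≤ E r) (hC : 1 ≤ C) (hα1 : α ≤ 1) (hθ0 : 0 ≤ θ) (hθ1 : θ < 1) :
    ∃ A : ℝ, 1 ≤ A ∧ ∀ r, 1 < r → log (1 + E r) ≤ A * (1 + log (1 + log r)) := by
  obtain ⟨A, hA1, hA⟩ := H.exists_log_bound hE E0 hC hα1 hθ0 hθ1
  have lC := log_nonneg hC
  have l3C : 0 ≤ log (3 * C) := log_nonneg (by linarith)
  set A' := 2 + 2 * (log C + 17 + 2 * A) with hA'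
  have A'1 : 1 ≤ A' := by linarith
  have lA' := log_nonneg A'1
  have hθ' : 0 < 1 - θ := by linarith
  set D := θ * (53 / (1 - θ)) with hD
  have D0 : 0 ≤ D := by positivity
  refine ⟨(log (3 * C) + log A' + 1 + 53 + D) / (1 - θ), ?_, fun r hr => ?_⟩
  · rw [one_le_div hθ']; linarith
  · have lr := log_nonneg hr.le
    have llr : 0 ≤ log (1 + log r) := log_nonneg (by linarith)
    refine (GrowthIneq.iterate (b := log (3 * C) + log A' + log (1 + log r)) (c := 53) (θ := θ) hE hθ0
      hθ1 hr E0 (by positivity) (by norm_num) fun i ρ d hρ hd hdr hρd l0 l4 => ?_).trans ?_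
    · have h := H.log_le hE E0 hC hα1 hθ0 hθ1.le hr (by linarith) hd hdr hρd (hE hρd)
      set y := log (1 + E (2 * r))
      set l := log (r / d)
      have y0 : 0 ≤ y := log_nonneg (by linarith [E0 (2 * r)])
      have hy : y ≤ 2 * A * (1 + log r) := by
        refine (hA (2 * r) (by linarith)).trans ?_
        rw [log_mul (by norm_num) (by linarith)]
        have := log_two_lt_d9
        have : A * (1 + (log 2 + log r)) ≤ A * (2 * (1 + log r)) := by gcongr; linarith
        linarith
      have i0 : (1 : ℝ) ≤ i + 1 := by linarith [Nat.cast_nonneg (α := ℝ) i]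
      set I : ℝ := i + 1 with hI
      have h1 : 2 + 2 * (log C + 4 * l + log r + y) ≤ A' * (1 + log r) * I := by
        have q1 : 1 ≤ (1 + log r) * I := one_le_mul_of_one_le_of_one_le (by linarith) i0
        have q2 : log C * 1 ≤ log C * ((1 + log r) * I) := by gcongr
        have q3 : 1 * I ≤ (1 + log r) * I := by gcongr; linarith
        have q4 : (1 + log r) * 1 ≤ (1 + log r) * I := by gcongr
        have q5 : 2 * A * ((1 + log r) * 1) ≤ 2 * A * ((1 + log r) * I) := by gcongr
        calc _ ≤ 2 * ((1 + log r) * I) + 2 * (log C * ((1 + log r) * I) + 16 * ((1 + log r) * I) +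
              (1 + log r) * I + 2 * A * ((1 + log r) * I)) := by linarith
          _ = _ := by rw [hA']; ring
      have h2 := log_le_log (by positivity) h1
      rw [log_mul (by positivity) (by positivity), log_mul (by positivity) (by positivity)] at h2
      have h3 := log_le_sub_one_of_pos (show 0 < I by positivity)
      linarith
    · rw [← hD, div_mul_eq_mul_div]
      gcongr
      have : 0 ≤ (log (3 * C) + log A' + 53 + D) * log (1 + log r) := by positivity
      linarith

theorem GrowthIneq.exists_dyadic_bound (H : GrowthIneq E C α θ) (hE : Monotone E)
    (E0 : ∀ r, 0 ≤ E r) (hC : 1 ≤ C) (hα1 : α ≤ 1) (hθ0 : 0 ≤ θ) (hθ1 : θ < 1) :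
    ∃ M : ℕ, ∀ k : ℕ, 1 ≤ k → 1 + E (2 ^ k) ≤ exp M * ((k : ℝ) + 1) ^ M := by
  obtain ⟨A, hA1, hA⟩ := H.exists_loglog_bound hE E0 hC hα1 hθ0 hθ1
  refine ⟨⌈A⌉₊, fun k hk => ?_⟩
  have h := hA (2 ^ k) (one_lt_pow₀ (by norm_num) (by omega))
  have k0 : (0 : ℝ) ≤ k := Nat.cast_nonneg k
  have hl : log (1 + log (2 ^ k)) ≤ log ((k : ℝ) + 1) := by
    rw [log_pow]
    have := log_two_lt_d9
    have := log_two_gt_d9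
    exact log_le_log (by positivity) (by nlinarith)
  have hl0 : 0 ≤ log ((k : ℝ) + 1) := log_nonneg (by linarith)
  rw [← log_le_log_iff (by linarith [E0 (2 ^ k)]) (by positivity),
    log_mul (by positivity) (by positivity), log_exp, log_pow]
  calc _ ≤ A * (1 + log ((k : ℝ) + 1)) := h.trans (by gcongr)
    _ ≤ (⌈A⌉₊ : ℝ) * (1 + log ((k : ℝ) + 1)) := by gcongr; exact Nat.le_ceil A
    _ = _ := by ring

theorem tendsto_succ_mul_rpow_mul_pow (M : ℕ) (c : ℝ) :
    Tendsto (fun k : ℕ => ((k : ℝ) + 1) * (((2 : ℝ) ^ k) ^ (-1 / 3 : ℝ) * (c * ((k : ℝ) + 2) ^ M)))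
      atTop (𝓝 0) := by
  set q : ℝ := 2 ^ (-1 / 3 : ℝ) with hq
  have q0 : 0 < q := by positivity
  have q1 : q < 1 := rpow_lt_one_of_one_lt_of_neg (by norm_num) (by norm_num)
  have h := ((tendsto_pow_const_mul_const_pow_of_abs_lt_one (M + 1) (abs_lt.2 ⟨by linarith, q1⟩)).comp
    (tendsto_add_atTop_nat 2)).const_mul (|c| / q ^ 2)
  rw [mul_zero] at h
  refine squeeze_zero_norm (fun k => ?_) h
  have e : ((2 : ℝ) ^ k) ^ (-1 / 3 : ℝ) = q ^ k := by
    rw [hq, ← rpow_natCast, ← rpow_natCast, ← rpow_mul (by norm_num), ← rpow_mul (by norm_num), mul_comm]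
  rw [e, norm_eq_abs, abs_mul, abs_mul, abs_mul, abs_of_nonneg (show (0 : ℝ) ≤ k + 1 by positivity),
    abs_of_pos (show 0 < q ^ k by positivity), abs_of_pos (show (0 : ℝ) < (k + 2) ^ M by positivity)]
  simp only [Function.comp_apply]
  push_cast
  calc _ ≤ ((k : ℝ) + 2) * (q ^ k * (|c| * (k + 2) ^ M)) := by gcongr; norm_num
    _ = _ := by field_simp; ring

theorem GrowthIneq.eq_zero (H : GrowthIneq E C α θ) (hE : Monotone E) (E0 : ∀ r, 0 ≤ E r)
    (hC : 1 ≤ C) (hαθ : α ≤ θ) (hθ0 : 0 < θ) (hθ1 : θ < 1) (r : ℝ) : E r = 0 := by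
  by_contra hne
  have hα1 : α ≤ 1 := by linarith
  set φ := E r with hφd
  have hφ : 0 < φ := lt_of_le_of_ne (E0 r) (Ne.symm hne)
  obtain ⟨M, hM⟩ := H.exists_dyadic_bound hE E0 hC hα1 hθ0.le hθ1
  have lC := log_nonneg hC
  have l4 : 0 ≤ log (10 ^ 4 : ℝ) := log_nonneg (by norm_num)
  set A := 2 + 2 * (log C + log (10 ^ 4) + 1 + 3 * M) with hA
  have A0 : 0 < A := by positivity
  set p := 1 / θ with hp
  have p0 : 0 < p := by positivity
  set D := (C * 10 ^ 13) ^ p * A with hD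
  have D0 : 0 < D := by positivity
  have step : ∀ k : ℕ, 1 ≤ k → E (2 ^ k) ^ p ≤ D * (((k : ℝ) + 1) * (E (2 ^ (k + 1)) - E (2 ^ k)) +
      ((k : ℝ) + 1) * (((2 : ℝ) ^ k) ^ (-1 / 3 : ℝ) * (exp M * ((k : ℝ) + 2) ^ M))) := fun k hk => by
    have k1 : (1 : ℝ) ≤ k := by exact_mod_cast hk
    have E2 := hM (k + 1) (by omega)
    have EE := E0 (2 ^ (k + 1))
    rw [show (((k + 1 : ℕ) : ℝ) + 1) = (k : ℝ) + 2 by push_cast; ring] at E2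
    have t1 : (1 : ℝ) < 2 ^ k := one_lt_pow₀ (by norm_num) (by omega)
    obtain ⟨n, hn1, hn2, hn3⟩ := exists_nat_two_pow (x := C * 10 ^ 4 * (2 ^ k * (1 + E (2 ^ (k + 1)))))
      (one_le_mul_of_one_le_of_one_le (one_le_mul_of_one_le_of_one_le hC (by norm_num))
      (one_le_mul_of_one_le_of_one_le t1.le (by linarith)))
    have n1 : (1 : ℝ) ≤ n := by exact_mod_cast hn1
    have hq : (2 : ℝ) ^ k / (2 ^ k / 10) = 10 := by field_simp
    have hR : (2 : ℝ) ^ k + 10 * (2 ^ k / 10) = 2 ^ (k + 1) := by rw [pow_succ]; ring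
    have h := H (2 ^ k) (2 ^ k) (2 ^ k / 10) n t1 (by positivity) (by positivity) (by linarith)
      (by linarith) hn1 (by rw [hq, hR]; exact hn2)
    rw [hq, hR] at h
    have nA : (n : ℝ) ≤ A * (k + 1) := by
      rw [log_mul (by positivity) (by positivity), log_mul (by positivity) (by positivity),
        log_mul (by positivity) (by positivity), log_pow 2] at hn3
      have h1 := log_le_log (by linarith) E2
      rw [log_mul (by positivity) (by positivity), log_exp, log_pow] at h1
      have h2 := log_le_sub_one_of_pos (show (0 : ℝ) < k + 2 by positivity)
      have h3 : (M : ℝ) * log (k + 2) ≤ M * (k + 1) := by gcongr; linarith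
      have h4 := log_two_lt_d9
      have h5 : (k : ℝ) * log 2 ≤ k * 1 := by gcongr; linarith
      have h6 : (M : ℝ) * 1 ≤ M * (k + 1) := by gcongr; linarith
      have h7 : log C * 1 ≤ log C * (k + 1) := by gcongr; linarith
      have h8 : log (10 ^ 4 : ℝ) * 1 ≤ log (10 ^ 4 : ℝ) * (k + 1) := by gcongr; linarith
      have h9 : (0 : ℝ) ≤ M * (k + 1) := by positivity
      rw [hA]
      linarith
    have mono := hE (show (2 : ℝ) ^ k ≤ 2 ^ (k + 1) by rw [pow_succ]; linarith)
    set T := E (2 ^ (k + 1)) - E (2 ^ k) + ((2 : ℝ) ^ k) ^ (-1 / 3 : ℝ) * (1 + E (2 ^ (k + 1))) with hT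
    have T0 : 0 ≤ T := add_nonneg (by linarith) (by positivity)
    have hb : E (2 ^ k) ≤ C * 10 ^ 13 * (A * (k + 1) * T) ^ θ := by
      rw [mul_rpow (x := A * (k + 1)) (y := T) (by positivity) T0]
      calc _ ≤ C * (n : ℝ) ^ α * 10 ^ 13 * T ^ θ := h
        _ ≤ C * (A * (k + 1)) ^ θ * 10 ^ 13 * T ^ θ := by
          have : (n : ℝ) ^ α ≤ (A * (k + 1)) ^ θ := (rpow_le_rpow_of_exponent_le n1 hαθ).trans
            (rpow_le_rpow (by linarith) nA hθ0.le)
          gcongr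
        _ = _ := by ring
    have hb' := rpow_le_rpow (E0 _) hb p0.le
    rw [mul_rpow (by positivity) (by positivity), ← rpow_mul (by positivity), hp, mul_one_div_cancel hθ0.ne',
      rpow_one, ← hp] at hb'
    calc _ ≤ _ := hb'
      _ = D * ((k + 1) * (E (2 ^ (k + 1)) - E (2 ^ k)) +
          (k + 1) * (((2 : ℝ) ^ k) ^ (-1 / 3 : ℝ) * (1 + E (2 ^ (k + 1))))) := by rw [hD, hT]; ring
      _ ≤ _ := by gcongr
  have hφp : 0 < φ ^ p := by positivity
  obtain ⟨k₁, hk₁⟩ := eventually_atTop.1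
    ((tendsto_succ_mul_rpow_mul_pow M (exp M)).eventually_le_const
      (show 0 < φ ^ p / (2 * D) by positivity))
  obtain ⟨k₂, hk₂⟩ := pow_unbounded_of_one_lt r (show (1 : ℝ) < 2 by norm_num)
  have hF : ∀ k ≥ k₂, φ ≤ E (2 ^ k) := fun k hk =>
    hE (hk₂.le.trans (pow_le_pow_right₀ (by norm_num) hk))
  refine false_of_superlinear_growth (F := fun k => E (2 ^ k)) (φ := φ) (c := 1 / (2 * D)) (p := p)
    (A := exp M) (M := M) (k₀ := max 1 (max k₁ k₂)) hφ (by positivity) ((one_lt_div hθ0).2 hθ1)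
    (fun k hk => hF k ((le_max_right _ _).trans ((le_max_right _ _).trans hk)))
    (fun k hk => by linarith [hM k ((le_max_left _ _).trans hk)]) fun k hk => ?_
  have h1 := step k ((le_max_left _ _).trans hk)
  have h2 := hk₁ k ((le_max_left _ _).trans ((le_max_right _ _).trans hk))
  have h3 := rpow_le_rpow hφ.le (hF k ((le_max_right _ _).trans ((le_max_right _ _).trans hk))) p0.le
  rw [le_div_iff₀ (by positivity)] at h2
  rw [one_div_mul_eq_div, div_le_iff₀ (by positivity)]
  linarith

end Growth

theorem exists_const_of_pd_eq_zero {f : E3 → ℝ} (hf : Sm f) (h : ∀ i x, pd i f x = 0) :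
    ∀ x, f x = f 0 := fun x => by
  refine is_const_of_fderiv_eq_zero (𝕜 := ℝ) hf.diff (fun y => ?_) x 0
  refine ContinuousLinearMap.coe_injective
    ((EuclideanSpace.basisFun (Fin 3) ℝ).toBasis.ext fun i => ?_)
  simpa [pd] using h i y

theorem HasPot.eq_zero_of_pd_eq_zero {s K : ℝ} {f : E3 → ℝ} {F : Fin 3 → E3 → ℝ} (hs : 3 < s)
    (hs6 : s ≤ 6) (hK : 0 ≤ K) (hf : HasPot s K f F) (h : ∀ i x, pd i f x = 0) (x : E3) :
    f x = 0 := by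
  obtain ⟨C, -, hC⟩ := exists_l2_bound hs hs6 hK
  have hc := exists_const_of_pd_eq_zero hf.sm h
  rw [hc x]
  by_contra hne
  have v0 := volume_ball3_pos (r := 1) one_pos
  set q := f 0 ^ 2 * (volume (ball3 1)).toReal with hq
  have q0 : 0 < q := by positivity
  have key : ∀ r : ℝ, 1 < r → q * r ≤ C := fun r hr => by
    have r0 : 0 < r := by linarith
    have h1 := hC f F hf r r (2 * r) 0 hr r0 (by linarith) le_rfl (by linarith) le_rfl
      fun i => by simp [h]
    simp only [hc, setIntegral_const, measureReal_def, smul_eq_mul] at h1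
    rw [volume_ball3 r0.le, show 2 * r - r = r by ring, div_self r0.ne', add_zero, one_rpow, one_pow,
      mul_one, mul_one] at h1
    have h2 : r ^ (5 / 3 : ℝ) ≤ r ^ (2 : ℕ) := by
      rw [← rpow_natCast]; exact rpow_le_rpow_of_exponent_le hr.le (by norm_num)
    have h3 : 0 < r ^ (5 / 3 : ℝ) := by positivity
    have hqC : q * r * r ^ 2 ≤ C * r ^ (5 / 3 : ℝ) := by rw [hq]; linarith
    have : q * r * r ^ (5 / 3 : ℝ) ≤ C * r ^ (5 / 3 : ℝ) := le_trans (by gcongr) hqC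
    exact le_of_mul_le_mul_right this h3
  have h1 := key 2 (by norm_num)
  have h2 := key (2 + C / q) (by have : 0 < C / q := div_pos (by linarith) q0; linarith)
  rw [mul_add, mul_div_cancel₀ _ q0.ne'] at h2
  linarith

theorem FieldSol.eq_zero {U W B : Fin 3 → E3 → ℝ} {P : E3 → ℝ} (h : FieldSol U W B P) {s K : ℝ}
    (hs : 3 < s) (hs6 : s ≤ 6) (hK : 0 ≤ K) {FU FW FB : Fin 3 → Fin 3 → E3 → ℝ}
    (hU : ∀ j, HasPot s K (U j) (FU j)) (hW : ∀ j, HasPot s K (W j) (FW j))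
    (hB : ∀ j, HasPot s K (B j) (FB j)) (j : Fin 3) (x : E3) :
    U j x = 0 ∧ B j x = 0 ∧ W j x = 0 := by
  obtain ⟨C, hC1, hC⟩ := h.exists_energy_bound hs hs6 hK hU hW hB
  have H : GrowthIneq (energy U W B) C ((s - 2) / s) (9 / (s + 6)) := hC
  have s0 : 0 < s := by linarith
  have E0 := H.eq_zero h.energy_mono energy_nonneg hC1
    (by rw [div_le_div_iff₀ s0 (by linarith)]; nlinarith) (by positivity)
    ((div_lt_one (by linarith)).2 (by linarith))
  have hd : ∀ y, dens U W B y = 0 := fun y => by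
    have cd := h.continuous_dens'
    have h0 := (setIntegral_eq_zero_iff_of_nonneg_ae (ae_of_all _ fun x => dens_nonneg x)
      (cd.intOn (‖y‖ + 1))).1 (E0 (‖y‖ + 1))
    exact Measure.eqOn_open_of_ae_eq (g := 0) h0 isOpen_ball cd.continuousOn continuousOn_const
      (mem_ball3.2 (by linarith))
  have hsq := fun i j x => FieldSol.sq_le_dens (U := U) (W := W) (B := B) i j x
  simp only [hd, mul_zero] at hsq
  have z : ∀ {a : ℝ}, a ^ 2 ≤ 0 → a = 0 := fun ha =>
    (pow_eq_zero_iff (by norm_num)).1 (le_antisymm ha (sq_nonneg _))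
  exact ⟨(hU j).eq_zero_of_pd_eq_zero hs hs6 hK (fun i y => z (hsq i j y).1) x,
    (hB j).eq_zero_of_pd_eq_zero hs hs6 hK (fun i y => z (hsq i j y).2.2.1) x, z (hsq j j x).2.2.2⟩

/-- Liouville theorem under growth of mean oscillations of the potentials. -/
theorem liouville_of_potential_growth
    (u w b : E3 → E3) (P : E3 → ℝ) (hsol : IsMMPSolution u w b P)
    (Φ Ψ Υ : E3 → Fin 3 → Fin 3 → ℝ)
    (hΦ : ∀ i j, ContDiff ℝ (⊤ : ℕ∞) (fun x => Φ x i j))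
    (hΨ : ∀ i j, ContDiff ℝ (⊤ : ℕ∞) (fun x => Ψ x i j))
    (hΥ : ∀ i j, ContDiff ℝ (⊤ : ℕ∞) (fun x => Υ x i j))
    (hΦu : ∀ (x : E3) (j : Fin 3), mdiv Φ x j = u x j)
    (hΨb : ∀ (x : E3) (j : Fin 3), mdiv Ψ x j = b x j)
    (hΥw : ∀ (x : E3) (j : Fin 3), mdiv Υ x j = w x j)
    (s : ℝ) (hs1 : 3 < s) (hs2 : s ≤ 6)
    (C₀ : ℝ) (hC₀ : 0 < C₀)
    (hosc : ∀ r : ℝ, 1 < r →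
      meanOsc Φ s r + meanOsc Ψ s r + meanOsc Υ s r ≤ C₀ * r ^ ((1:ℝ)/3 - 1/s))
    : (∀ x, u x = 0) ∧ (∀ x, b x = 0) ∧ (∀ x, w x = 0) := by
  have n := fun r => meanOsc_nonneg Φ s r
  have n' := fun r => meanOsc_nonneg Ψ s r
  have n'' := fun r => meanOsc_nonneg Υ s r
  have s0 : 0 < s := by linarith
  have key := hsol.fieldSol.eq_zero hs1 hs2 (by positivity)
    (hasPot_of_meanOsc s0 hC₀.le hΦ hΦu fun r hr => by linarith [hosc r hr, n' r, n'' r])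
    (hasPot_of_meanOsc s0 hC₀.le hΥ hΥw fun r hr => by linarith [hosc r hr, n r, n' r])
    (hasPot_of_meanOsc s0 hC₀.le hΨ hΨb fun r hr => by linarith [hosc r hr, n r, n'' r])
  refine ⟨fun x => ?_, fun x => ?_, fun x => ?_⟩ <;> ext j
  exacts [(key j x).1, (key j x).2.1, (key j x).2.2]
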